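/- Let B ⊆ P be a faithfully flat Hopf–Galois extension such that P is also a right H-module algebra with pq = q₍₀₎(p ◁ q₍₁₎) for all p,q ∈ P (◁-commutativity). Then H²(L(P,H),B) ≅ H̃²(H,P): the set of equivalence classes of Z²(L(P,H),B) under the transformations Γ ↦ Γ^U (U ∈ C¹(L(P,H),B)) is in bijection with the set of equivalence classes of Z̃²(H,P) under the transformations γ ↦ γ^f, γ^f(h,g) := (f⁻¹(g₍₁₎) ◁ h₍₁₎) f⁻¹(h₍₂₎) γ(h₍₃₎, g₍₂₎) f(g₍₃₎ h₍₄₎), for f ∈ C̃¹(H,P). -/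

import Mathlib

open scoped TensorProduct
open TensorProduct

noncomputable section
attribute [local instance] Classical.propDecidable

/-- Choice-based lift of a (bilinear) function to the tensor product: if a linear map agreeing
with `f` on pure tensors exists, this is it (it is then unique); otherwise `0`. -/
def tlift (R : Type*) [CommRing R] {M N Q : Type*} [AddCommGroup M] [Module R M]
    [AddCommGroup N] [Module R N] [AddCommGroup Q] [Module R Q]
    (f : M → N → Q) : M ⊗[R] N →ₗ[R] Q :=
  if h : ∃ F : M ⊗[R] N →ₗ[R] Q, ∀ x y, F (x ⊗ₜ[R] y) = f x y then h.choose else 0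

/-- Choice-based lift of a (bilinear, balanced) function to a quotient of the tensor product. -/
def qtlift (R : Type*) [CommRing R] {M N Q : Type*} [AddCommGroup M] [Module R M]
    [AddCommGroup N] [Module R N] [AddCommGroup Q] [Module R Q]
    (p : Submodule R (M ⊗[R] N)) (f : M → N → Q) : ((M ⊗[R] N) ⧸ p) →ₗ[R] Q :=
  if h : ∃ F : ((M ⊗[R] N) ⧸ p) →ₗ[R] Q,
      ∀ x y, F (Submodule.Quotient.mk (x ⊗ₜ[R] y)) = f x y then h.choose else 0

variable (k : Type*) [Field k]

/-- Source and target data for a left bialgebroid over `B`: an algebra map `s : B → L` and an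
anti-algebra map `t : B → L` with commuting ranges. -/
structure BgdST (B L : Type*) [Ring B] [Algebra k B] [Ring L] [Algebra k L] where
  s : B →ₐ[k] L
  t : B →ₗ[k] L
  t_one : t 1 = 1
  t_mul : ∀ a b : B, t (a * b) = t b * t a
  st_comm : ∀ a b : B, s a * t b = t b * s a

namespace BgdST

variable {k} {B L : Type*} [Ring B] [Algebra k B] [Ring L] [Algebra k L]
variable (st : BgdST k B L)

/-- The relations defining `L ⊗_B L`: `t a · X ⊗ Y  ~  X ⊗ s a · Y`. -/
def rel : Submodule k (L ⊗[k] L) :=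
  Submodule.span k {z | ∃ (a : B) (X Y : L), z = (st.t a * X) ⊗ₜ[k] Y - X ⊗ₜ[k] (st.s a * Y)}

/-- `L ⊗_B L` (the coring tensor square). -/
abbrev T2 := (L ⊗[k] L) ⧸ st.rel

/-- Class of a pure tensor in `L ⊗_B L`. -/
def mk2 (X Y : L) : st.T2 := Submodule.Quotient.mk (X ⊗ₜ[k] Y)

/-- Evaluate a balanced bilinear expression on an element of `L ⊗_B L`. -/
def lift2 {Q : Type*} [AddCommGroup Q] [Module k Q] (f : L → L → Q) : st.T2 →ₗ[k] Q :=
  qtlift k st.rel f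

/-- The relations defining `L ⊗_{B^{op}} L`: `X·t a ⊗ Y ~ X ⊗ t a · Y`. -/
def relOp : Submodule k (L ⊗[k] L) :=
  Submodule.span k {z | ∃ (a : B) (X Y : L), z = (X * st.t a) ⊗ₜ[k] Y - X ⊗ₜ[k] (st.t a * Y)}

/-- `L ⊗_{B^{op}} L` (domain of the canonical map `λ`). -/
abbrev TOp := (L ⊗[k] L) ⧸ st.relOp

def mkOp (X Y : L) : st.TOp := Submodule.Quotient.mk (X ⊗ₜ[k] Y)

def liftOp {Q : Type*} [AddCommGroup Q] [Module k Q] (f : L → L → Q) : st.TOp →ₗ[k] Q :=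
  qtlift k st.relOp f

/-- The relations defining `L ⊗^{B^{op}} L`: `s a · X ⊗ Y ~ X ⊗ Y · s a`. -/
def relA : Submodule k (L ⊗[k] L) :=
  Submodule.span k {z | ∃ (a : B) (X Y : L), z = (st.s a * X) ⊗ₜ[k] Y - X ⊗ₜ[k] (Y * st.s a)}

/-- `L ⊗^{B^{op}} L` (domain of the canonical map `μ`). -/
abbrev TA := (L ⊗[k] L) ⧸ st.relA

def mkA (X Y : L) : st.TA := Submodule.Quotient.mk (X ⊗ₜ[k] Y)

def liftA {Q : Type*} [AddCommGroup Q] [Module k Q] (f : L → L → Q) : st.TA →ₗ[k] Q :=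
  qtlift k st.relA f

/-- Relations for the triple tensor `L ⊗_B L ⊗_B L`. -/
def rel3 : Submodule k (L ⊗[k] (L ⊗[k] L)) :=
  Submodule.span k
    ({z | ∃ (a : B) (X Y Z : L),
        z = (st.t a * X) ⊗ₜ[k] (Y ⊗ₜ[k] Z) - X ⊗ₜ[k] ((st.s a * Y) ⊗ₜ[k] Z)} ∪
     {z | ∃ (a : B) (X Y Z : L),
        z = X ⊗ₜ[k] ((st.t a * Y) ⊗ₜ[k] Z) - X ⊗ₜ[k] (Y ⊗ₜ[k] (st.s a * Z))})

/-- `L ⊗_B L ⊗_B L`. -/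
abbrev T3 := (L ⊗[k] (L ⊗[k] L)) ⧸ st.rel3

def mk3 (X Y Z : L) : st.T3 := Submodule.Quotient.mk (X ⊗ₜ[k] (Y ⊗ₜ[k] Z))

/-- The factorwise product of two elements of `L ⊗_B L`, whenever it is well defined
on representatives (as it is when the left factor lies in the Takeuchi product);
junk value `0` otherwise. -/
def mulT2 (z w : st.T2) : st.T2 :=
  if h : ∃ u : st.T2, ∀ zr wr : L ⊗[k] L, Submodule.Quotient.mk zr = z →
      Submodule.Quotient.mk wr = w → Submodule.Quotient.mk (zr * wr) = u
  then h.choose else 0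

variable (cop : L →ₗ[k] st.T2) (cou : L →ₗ[k] B)

/-- The axioms of a left bialgebroid over `B` with structure `(s,t,Δ,ε) = (st.s, st.t, cop, cou)`
(Definition 2.3 of the paper): `L` is a `B^e`-ring and a `B`-coring, the coproduct corestricts
to an algebra map into the Takeuchi product, and the counit is a left character. -/
structure IsLeftBialgebroid : Prop where
  comul_one : cop 1 = st.mk2 1 1
  comul_mul : ∀ X Y : L, cop (X * Y) = st.mulT2 (cop X) (cop Y)
  comul_s : ∀ (b : B) (X : L),
    cop (st.s b * X) = st.lift2 (fun x y => st.mk2 (st.s b * x) y) (cop X)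
  comul_t : ∀ (b : B) (X : L),
    cop (st.t b * X) = st.lift2 (fun x y => st.mk2 x (st.t b * y)) (cop X)
  takeuchi : ∀ (b : B) (X : L),
    st.lift2 (fun x y => st.mk2 (x * st.t b) y) (cop X) =
      st.lift2 (fun x y => st.mk2 x (y * st.s b)) (cop X)
  coassoc : ∀ X : L,
    st.lift2 (fun x1 x2 => st.lift2 (fun y1 y2 => st.mk3 x1 y1 y2) (cop x2)) (cop X) =
      st.lift2 (fun x12 x3 => st.lift2 (fun x1 x2 => st.mk3 x1 x2 x3) (cop x12)) (cop X)
  counit_comul_left : ∀ X : L, st.lift2 (fun x1 x2 => st.s (cou x1) * x2) (cop X) = X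
  counit_comul_right : ∀ X : L, st.lift2 (fun x1 x2 => st.t (cou x2) * x1) (cop X) = X
  counit_one : cou 1 = 1
  counit_s : ∀ (b : B) (X : L), cou (st.s b * X) = b * cou X
  counit_t : ∀ (b : B) (X : L), cou (st.t b * X) = cou X * b
  counit_char_s : ∀ X Y : L, cou (X * st.s (cou Y)) = cou (X * Y)
  counit_char_t : ∀ X Y : L, cou (X * st.t (cou Y)) = cou (X * Y)

/-- The canonical map `λ : L ⊗_{B^{op}} L → L ⊗_B L`, `X ⊗ Y ↦ X₍₁₎ ⊗ X₍₂₎Y`. -/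
def lam : st.TOp →ₗ[k] st.T2 :=
  st.liftOp (fun X Y => st.lift2 (fun x1 x2 => st.mk2 x1 (x2 * Y)) (cop X))

/-- A left bialgebroid is a left Hopf algebroid if `λ` is bijective. -/
def IsLeftHopf : Prop := Function.Bijective (st.lam cop)

/-- The canonical map `μ : L ⊗^{B^{op}} L → L ⊗_B L`, `X ⊗ Y ↦ Y₍₁₎X ⊗ Y₍₂₎`. -/
def mu : st.TA →ₗ[k] st.T2 :=
  st.liftA (fun X Y => st.lift2 (fun y1 y2 => st.mk2 (y1 * X) y2) (cop Y))

/-- A left bialgebroid is an anti-left Hopf algebroid if `μ` is bijective. -/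
def IsAntiLeftHopf : Prop := Function.Bijective (st.mu cop)

/-- `X₊ ⊗_{B^{op}} X₋ := λ⁻¹(X ⊗_B 1)` (meaningful when `λ` is bijective). -/
def plusMinus (X : L) : st.TOp := Function.invFun (st.lam cop) (st.mk2 X 1)

/-- `X₍₋₎ ⊗^{B^{op}} X₍₊₎ := μ⁻¹(1 ⊗_B X)` (meaningful when `μ` is bijective). -/
def minusPlus (X : L) : st.TA := Function.invFun (st.mu cop) (st.mk2 1 X)

/-- A left bisection of a left bialgebroid (Definition 3.1). -/
structure IsLeftBisection (σ : L →ₗ[k] B) : Prop where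
  unital : σ 1 = 1
  t_prop : ∀ (b : B) (X : L), σ (st.t b * X) = σ X * b
  s_mul : ∀ a b : B, σ (st.s (a * b)) = σ (st.s a) * σ (st.s b)
  s_bij : Function.Bijective (fun b => σ (st.s b))
  prod_t : ∀ X Y : L, σ (X * Y) = σ (X * st.t (σ Y))
  prod_s : ∀ X Y : L,
    σ (X * Y) = σ (X * st.s (Function.invFun (fun b => σ (st.s b)) (σ Y)))

/-- Convolution of left bisections:  `(σ * η)(X) := σ(s(η(X₍₁₎)) X₍₂₎)`. -/
def bconv (σ η : L →ₗ[k] B) : L →ₗ[k] B :=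
  (st.lift2 (fun x1 x2 => σ (st.s (η x1) * x2))).comp cop

/-- A right bisection of a left bialgebroid (Definition 3.6). -/
structure IsRightBisection (σ : L →ₗ[k] B) : Prop where
  unital : σ 1 = 1
  s_prop : ∀ (b : B) (X : L), σ (st.s b * X) = b * σ X
  t_mul : ∀ a b : B, σ (st.t (a * b)) = σ (st.t b) * σ (st.t a)
  t_bij : Function.Bijective (fun b => σ (st.t b))
  prod_s : ∀ X Y : L, σ (X * Y) = σ (X * st.s (σ Y))
  prod_t : ∀ X Y : L,
    σ (X * Y) = σ (X * st.t (Function.invFun (fun b => σ (st.t b)) (σ Y)))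

/-- Convolution of right bisections:  `(σ • η)(X) := σ(t(η(X₍₂₎)) X₍₁₎)`. -/
def rconv (σ η : L →ₗ[k] B) : L →ₗ[k] B :=
  (st.lift2 (fun x1 x2 => σ (st.t (η x2) * x1))).comp cop

/-- An automorphism `(Φ, φ)` of a left bialgebroid. -/
structure IsBgdAut (Φ : L →ₐ[k] L) (φ : B →ₐ[k] B) : Prop where
  bijL : Function.Bijective Φ
  bijB : Function.Bijective φ
  comp_s : ∀ b : B, Φ (st.s b) = st.s (φ b)
  comp_t : ∀ b : B, Φ (st.t b) = st.t (φ b)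
  comp_comul : ∀ X : L,
    cop (Φ X) = st.lift2 (fun x1 x2 => st.mk2 (Φ x1) (Φ x2)) (cop X)
  comp_counit : ∀ X : L, cou (Φ X) = φ (cou X)

/-- `Ad^L_σ(X) := s(σ(X₍₁₎)) X₍₂₎₊ t(σ(X₍₂₎₋))`, for a left Hopf algebroid. -/
def adL (σ : L →ₗ[k] B) (X : L) : L :=
  st.lift2 (fun x1 x2 => st.s (σ x1) *
    st.liftOp (fun p m => p * st.t (σ m)) (st.plusMinus cop x2)) (cop X)

/-- `Ad^R_σ(X) := t(σ(X₍₂₎)) X₍₁₎₍₊₎ s(σ(X₍₁₎₍₋₎))`, for an anti-left Hopf algebroid. -/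
def adR (σ : L →ₗ[k] B) (X : L) : L :=
  st.lift2 (fun x1 x2 => st.t (σ x2) *
    st.liftA (fun m p => p * st.s (σ m)) (st.minusPlus cop x1)) (cop X)

/-- The `B`-bimodule-map conditions on a map `L → B` used for `C¹(L,B)`. -/
def IsBimodMap (U : L →ₗ[k] B) : Prop :=
  (∀ (b : B) (X : L), U (st.t b * X) = U X * b) ∧
  (∀ (b : B) (X : L), U (st.s b * X) = b * U X)

/-- Convolution `(U * V)(X) = U(X₍₁₎) V(X₍₂₎)` of `B`-valued maps. -/
def cconv (U V : L →ₗ[k] B) : L →ₗ[k] B :=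
  (st.lift2 (fun x1 x2 => U x1 * V x2)).comp cop

/-- Extended vertical bisections `C¹(L,B)`: unital convolution-invertible `B`-bimodule maps
`U : L → B` with `U(X s(b)) = U(X t(b))`. -/
def IsC1 (U : L →ₗ[k] B) : Prop :=
  U 1 = 1 ∧ st.IsBimodMap U ∧
  (∀ (b : B) (X : L), U (X * st.s b) = U (X * st.t b)) ∧
  ∃ V : L →ₗ[k] B, st.IsBimodMap V ∧ st.cconv cop U V = cou ∧ st.cconv cop V U = cou

/-- Convolution product on `B`-bimodule maps `L ⊗_{B^e} L → B`:
`(f ⋆ g)(X,Y) = f(X₍₁₎,Y₍₁₎) g(X₍₂₎,Y₍₂₎)`. -/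
def conv2 (f g : L → L → B) (X Y : L) : B :=
  st.lift2 (fun y1 y2 =>
    st.lift2 (fun x1 x2 => f x1 y1 * g x2 y2) (cop X)) (cop Y)

/-- The unit `ε̃(X ⊗ Y) = ε(XY)` of the convolution algebra. -/
def unit2 (X Y : L) : B := cou (X * Y)

/-- Left-hand side of the 2-cocycle condition: `Γ(X, s(Γ(Y₍₁₎,Z₍₁₎)) Y₍₂₎Z₍₂₎)`. -/
def cocL (Γ : L → L → B) (X Y Z : L) : B :=
  st.lift2 (fun z1 z2 =>
    st.lift2 (fun y1 y2 => Γ X (st.s (Γ y1 z1) * (y2 * z2))) (cop Y)) (cop Z)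

/-- Right-hand side of the 2-cocycle condition: `Γ(s(Γ(X₍₁₎,Y₍₁₎)) X₍₂₎Y₍₂₎, Z)`. -/
def cocR (Γ : L → L → B) (X Y Z : L) : B :=
  st.lift2 (fun y1 y2 =>
    st.lift2 (fun x1 x2 => Γ (st.s (Γ x1 y1) * (x2 * y2)) Z) (cop X)) (cop Y)

/-- Membership of a bilinear map in `_B Hom_B (L ⊗_{B^e} L, B)`. -/
def IsBihom (Γ : L → L → B) : Prop :=
  (∃ Γ' : L →ₗ[k] L →ₗ[k] B, ∀ X Y, Γ' X Y = Γ X Y) ∧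
  (∀ (b c : B) (X Y : L), Γ (st.s b * (st.t c * X)) Y = b * Γ X Y * c) ∧
  (∀ (b c : B) (X Y : L), Γ (X * st.s b * st.t c) Y = Γ X (st.s b * (st.t c * Y)))

/-- An invertible normalised 2-cocycle on a left bialgebroid (Definition 2.6);
the collection of these is `Z²(L,B)`. -/
structure IsZ2 (Γ : L → L → B) : Prop where
  bihom : st.IsBihom Γ
  norm_left : ∀ X : L, Γ 1 X = cou X
  norm_right : ∀ X : L, Γ X 1 = cou X
  st_indep : ∀ (b : B) (X Y : L), Γ X (Y * st.s b) = Γ X (Y * st.t b)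
  cocycle : ∀ X Y Z : L, st.cocL cop Γ X Y Z = st.cocR cop Γ X Y Z
  inv : ∃ Γi : L → L → B, st.IsBihom Γi ∧
    (∀ X Y, st.conv2 cop Γ Γi X Y = unit2 cou X Y) ∧
    (∀ X Y, st.conv2 cop Γi Γ X Y = unit2 cou X Y)

/-- The coboundary `∂U(X,Y) = U⁻¹(X₍₁₎ t(U⁻¹(Y₍₁₎))) U(X₍₂₎Y₍₂₎)` of `U ∈ C¹(L,B)`. -/
def coboundary (U Ui : L →ₗ[k] B) (X Y : L) : B :=
  st.lift2 (fun y1 y2 =>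
    st.lift2 (fun x1 x2 => Ui (x1 * st.t (Ui y1)) * U (x2 * y2)) (cop X)) (cop Y)

/-- The transform `Γ^U(X,Y) = U⁻¹(X₍₁₎ t(U⁻¹(Y₍₁₎))) Γ(X₍₂₎,Y₍₂₎) U(X₍₃₎Y₍₃₎)`. -/
def gammaU (Γ : L → L → B) (U Ui : L →ₗ[k] B) (X Y : L) : B :=
  st.lift2 (fun y1 y23 => st.lift2 (fun y2 y3 =>
    st.lift2 (fun x1 x23 => st.lift2 (fun x2 x3 =>
      Ui (x1 * st.t (Ui y1)) * Γ x2 y2 * U (x3 * y3)) (cop x23)) (cop X))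
    (cop y23)) (cop Y)

/-- The cotwisted product `X ·_Γ Y := s(Γ(X₍₁₎,Y₍₁₎)) t(Γ⁻¹(X₍₃₎,Y₍₃₎)) X₍₂₎Y₍₂₎`. -/
def prodG (Γ Γi : L → L → B) (X Y : L) : L :=
  st.lift2 (fun y1 y23 => st.lift2 (fun y2 y3 =>
    st.lift2 (fun x1 x23 => st.lift2 (fun x2 x3 =>
      st.s (Γ x1 y1) * (st.t (Γi x3 y3) * (x2 * y2))) (cop x23)) (cop X))
    (cop y23)) (cop Y)

/-- `Ad_U(X) := s(U(X₍₁₎)) t(U⁻¹(X₍₃₎)) X₍₂₎`. -/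
def adU (U Ui : L →ₗ[k] B) (X : L) : L :=
  st.lift2 (fun x1 x23 => st.lift2 (fun x2 x3 =>
    st.s (U x1) * (st.t (Ui x3) * x2)) (cop x23)) (cop X)

end BgdST

end

/-! ## Hopf–Galois extensions and the Ehresmann–Schauenburg bialgebroid -/

noncomputable section
attribute [local instance] Classical.propDecidable

universe u v

open scoped TensorProduct
open TensorProduct

variable {k : Type u} [Field k] {H P : Type v} [Ring H] [HopfAlgebra k H]
  [Ring P] [Algebra k P]

/-- A right `H`-comodule algebra structure on `P`. -/
structure ComodAlg (k : Type u) [Field k] (H P : Type v) [Ring H] [HopfAlgebra k H]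
    [Ring P] [Algebra k P] where
  ρ : P →ₗ[k] P ⊗[k] H
  coassoc : ∀ p : P,
    tlift k (fun p0 p1 => p0 ⊗ₜ[k] (Coalgebra.comul (R := k) p1)) (ρ p) =
      tlift k (fun p0 p1 =>
        tlift k (fun q0 q1 => (q0 ⊗ₜ[k] (q1 ⊗ₜ[k] p1) : P ⊗[k] (H ⊗[k] H))) (ρ p0)) (ρ p)
  counit_coact : ∀ p : P,
    tlift k (fun p0 p1 => (Coalgebra.counit (R := k) p1 : k) • p0) (ρ p) = p
  coact_mul : ∀ p q : P, ρ (p * q) = ρ p * ρ q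
  coact_one : ρ 1 = 1

namespace ComodAlg

variable (ca : ComodAlg k H P)

/-- The subalgebra `B = P^{coH}` of coinvariants. -/
def coinv : Subalgebra k P where
  carrier := {p : P | ca.ρ p = p ⊗ₜ[k] (1 : H)}
  mul_mem' := by
    intro a b ha hb
    have ha' : ca.ρ a = a ⊗ₜ[k] (1 : H) := ha
    have hb' : ca.ρ b = b ⊗ₜ[k] (1 : H) := hb
    show ca.ρ (a * b) = (a * b) ⊗ₜ[k] (1 : H)
    rw [ca.coact_mul, ha', hb', Algebra.TensorProduct.tmul_mul_tmul, one_mul]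
  one_mem' := by
    show ca.ρ 1 = (1 : P) ⊗ₜ[k] (1 : H)
    rw [ca.coact_one, Algebra.TensorProduct.one_def]
  add_mem' := by
    intro a b ha hb
    have ha' : ca.ρ a = a ⊗ₜ[k] (1 : H) := ha
    have hb' : ca.ρ b = b ⊗ₜ[k] (1 : H) := hb
    show ca.ρ (a + b) = (a + b) ⊗ₜ[k] (1 : H)
    rw [map_add, ha', hb', TensorProduct.add_tmul]
  algebraMap_mem' := by
    intro r
    show ca.ρ (algebraMap k P r) = (algebraMap k P r) ⊗ₜ[k] (1 : H)
    rw [Algebra.algebraMap_eq_smul_one, map_smul, ca.coact_one, Algebra.TensorProduct.one_def,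
      TensorProduct.smul_tmul']

/-- The relations defining `P ⊗_B P` over the coinvariants. -/
def relB : Submodule k (P ⊗[k] P) :=
  Submodule.span k {z | ∃ (p q b : P), ca.ρ b = b ⊗ₜ[k] (1 : H) ∧
    z = (p * b) ⊗ₜ[k] q - p ⊗ₜ[k] (b * q)}

/-- `P ⊗_B P`. -/
abbrev PBP := (P ⊗[k] P) ⧸ ca.relB

/-- The canonical (Galois) map `χ : P ⊗_B P → P ⊗ H`, `q ⊗ p ↦ q p₍₀₎ ⊗ p₍₁₎`. -/
def chi : ca.PBP →ₗ[k] P ⊗[k] H :=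
  qtlift k ca.relB (fun p q => tlift k (fun q0 q1 => (p * q0) ⊗ₜ[k] q1) (ca.ρ q))

/-- The extension `B ⊆ P` is Hopf–Galois when `χ` is bijective. -/
def IsGalois : Prop := Function.Bijective ca.chi

/-- The translation map `τ(h) = χ⁻¹(1 ⊗ h) ∈ P ⊗_B P`. -/
def tau (h : H) : ca.PBP := Function.invFun ca.chi ((1 : P) ⊗ₜ[k] h)

/-- Relations for the tensor product `M ⊗_B P` of a right `B`-module with `P`. -/
def ffrel (M : Type v) [AddCommGroup M] [Module (↥ca.coinv)ᵐᵒᵖ M] :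
    Submodule ℤ (M ⊗[ℤ] P) :=
  Submodule.span ℤ {z | ∃ (m : M) (b : ↥ca.coinv) (p : P),
    z = (MulOpposite.op b • m) ⊗ₜ[ℤ] p - m ⊗ₜ[ℤ] ((b : P) * p)}

/-- `M ⊗_B P` for a right `B`-module `M`. -/
abbrev MTP (M : Type v) [AddCommGroup M] [Module (↥ca.coinv)ᵐᵒᵖ M] :=
  (M ⊗[ℤ] P) ⧸ ca.ffrel M

/-- The map `M ⊗_B P → N ⊗_B P` induced by `f : M → N`. -/
def ffmap {M N : Type v} [AddCommGroup M] [Module (↥ca.coinv)ᵐᵒᵖ M]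
    [AddCommGroup N] [Module (↥ca.coinv)ᵐᵒᵖ N] (f : M → N) : ca.MTP M →ₗ[ℤ] ca.MTP N :=
  qtlift ℤ (ca.ffrel M) (fun m p => Submodule.Quotient.mk (f m ⊗ₜ[ℤ] p))

/-- `P` is faithfully flat as a left `B`-module: tensoring right `B`-modules with `P` over `B`
preserves injectivity, and detects triviality. -/
def IsFaithfullyFlat : Prop :=
  (∀ (M N : Type v) [AddCommGroup M] [Module (↥ca.coinv)ᵐᵒᵖ M]
      [AddCommGroup N] [Module (↥ca.coinv)ᵐᵒᵖ N] (f : M →+ N),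
      (∀ (b : ↥ca.coinv) (m : M), f (MulOpposite.op b • m) = MulOpposite.op b • f m) →
      Function.Injective f → Function.Injective (ca.ffmap (⇑f))) ∧
  (∀ (M : Type v) [AddCommGroup M] [Module (↥ca.coinv)ᵐᵒᵖ M],
      Subsingleton (ca.MTP M) → Subsingleton M)

/-- The diagonal coaction `β(p ⊗ q) = p₍₀₎ ⊗ q₍₀₎ ⊗ p₍₁₎q₍₁₎` on `P ⊗ P^{op}`. -/
def betaA : (P ⊗[k] Pᵐᵒᵖ) →ₗ[k] (P ⊗[k] Pᵐᵒᵖ) ⊗[k] H :=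
  tlift k (fun p oq => tlift k (fun p0 p1 => tlift k (fun q0 q1 =>
    ((p0 ⊗ₜ[k] (MulOpposite.op q0) : P ⊗[k] Pᵐᵒᵖ)) ⊗ₜ[k] (p1 * q1))
      (ca.ρ (MulOpposite.unop oq))) (ca.ρ p))

/-- Multiplication `p ⊗ q ↦ pq` on `P ⊗ P^{op}`. -/
def mulA : (P ⊗[k] Pᵐᵒᵖ) →ₗ[k] P :=
  tlift k (fun p oq => p * MulOpposite.unop oq)

/-- A bundle automorphism: a unital algebra endomorphism of `P` which is `H`-equivariant
and restricts to an automorphism of the coinvariant subalgebra. -/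
def IsBundleAut (F : P →ₐ[k] P) : Prop :=
  (∀ p : P, ca.ρ (F p) = tlift k (fun p0 p1 => F p0 ⊗ₜ[k] p1) (ca.ρ p)) ∧
  Set.BijOn F {p : P | ca.ρ p = p ⊗ₜ[k] (1 : H)} {p : P | ca.ρ p = p ⊗ₜ[k] (1 : H)}

/-- Pairing of the Ehresmann–Schauenburg coproduct `Δ(p ⊗ q) = p₍₀₎ ⊗ τ(p₍₁₎) ⊗ q` against a
`B`-balanced bilinear form `G` on `A = P ⊗ P^{op}`. -/
def esDeltaEval (ca : ComodAlg k H P) {V : Type*} [AddCommGroup V] [Module k V]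
    (G : (P ⊗[k] Pᵐᵒᵖ) → (P ⊗[k] Pᵐᵒᵖ) → V) : (P ⊗[k] Pᵐᵒᵖ) →ₗ[k] V :=
  tlift k (fun p oq => tlift k (fun p0 p1 =>
    (qtlift k ca.relB (fun u v =>
      G ((p0 ⊗ₜ[k] MulOpposite.op u : P ⊗[k] Pᵐᵒᵖ)) ((v ⊗ₜ[k] oq : P ⊗[k] Pᵐᵒᵖ))))
      (ca.tau p1)) (ca.ρ p))

/-- The right adjoint coaction applied through `f`:  `h ↦ f(h₍₂₎) ⊗ (Sh₍₁₎)h₍₃₎`. -/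
def adCoaction (f : H → P) (h : H) : P ⊗[k] H :=
  tlift k (fun h1 h23 => tlift k (fun h2 h3 =>
    f h2 ⊗ₜ[k] (HopfAlgebra.antipode (R := k) h1 * h3)) (Coalgebra.comul (R := k) h23))
    (Coalgebra.comul (R := k) h)

/-- Convolution of maps `H → P`. -/
def convH (f g : H →ₗ[k] P) : H →ₗ[k] P :=
  (tlift k (fun h1 h2 => f h1 * g h2)).comp (Coalgebra.comul (R := k) (A := H))

/-- The convolution unit `h ↦ ε(h)1`. -/
def unitH : H →ₗ[k] P :=
  (Algebra.linearMap k P).comp (Coalgebra.counit (R := k) (A := H))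

/-- `Z̃¹(H,P)`: unital `H`-colinear maps `f : H → P` (for the right adjoint coaction on `H`)
with `p₍₀₎q₍₀₎ f(p₍₁₎q₍₁₎) = p₍₀₎ f(p₍₁₎) q₍₀₎ f(q₍₁₎)`. -/
def IsZt1 (ca : ComodAlg k H P) (f : H →ₗ[k] P) : Prop :=
  f 1 = 1 ∧ (∀ h : H, ca.ρ (f h) = adCoaction (⇑f) h) ∧
  (∀ p q : P,
    tlift k (fun p0 p1 => tlift k (fun q0 q1 => p0 * q0 * f (p1 * q1)) (ca.ρ q)) (ca.ρ p) =
    tlift k (fun p0 p1 => tlift k (fun q0 q1 => p0 * f p1 * (q0 * f q1)) (ca.ρ q)) (ca.ρ p))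

/-- Evaluation `h₁ ⊗ (u ⊗ v) ↦ u f(Sh₁) v`, used for the inverse in `Z̃¹(H,P)`. -/
def evalMid (f : H → P) : H ⊗[k] (P ⊗[k] P) →ₗ[k] P :=
  tlift k (fun h1 w => (tlift k (fun u v => u * f (HopfAlgebra.antipode (R := k) h1) * v)) w)

/-- The element `h₍₁₎ ⊗ τ(h₍₂₎) ∈ H ⊗ (P ⊗_B P)`. -/
def tauLeg (ca : ComodAlg k H P) (h : H) : H ⊗[k] ca.PBP :=
  tlift k (fun h1 h2 => h1 ⊗ₜ[k] ca.tau h2) (Coalgebra.comul (R := k) h)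

/-- Convolution of maps `H ⊗ H → P`. -/
def convHH (γ δ : H → H → P) (h g : H) : P :=
  tlift k (fun h1 h2 => tlift k (fun g1 g2 => γ h1 g1 * δ h2 g2)
    (Coalgebra.comul (R := k) g)) (Coalgebra.comul (R := k) h)

/-- `Z̃²(H,P)`:  the `H`-colinear elements of `Z²_{◁,as}(H,P)`. -/
def IsZt2 (ca : ComodAlg k H P) (act : P →ₗ[k] H →ₗ[k] P) (γ : H → H → P) : Prop :=
  (∃ γ' : H →ₗ[k] H →ₗ[k] P, ∀ h g, γ' h g = γ h g) ∧
  (∀ h : H, γ h 1 = algebraMap k P (Coalgebra.counit (R := k) h) ∧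
    γ 1 h = algebraMap k P (Coalgebra.counit (R := k) h)) ∧
  (∀ h g f : H,
    tlift k (fun h1 h2 => tlift k (fun g1 g2 => tlift k (fun f1 f2 =>
      act (γ g1 f1) h1 * γ h2 (f2 * g2)) (Coalgebra.comul (R := k) f))
        (Coalgebra.comul (R := k) g)) (Coalgebra.comul (R := k) h) =
    tlift k (fun h1 h2 => tlift k (fun g1 g2 =>
      γ h1 g1 * γ (g2 * h2) f) (Coalgebra.comul (R := k) g)) (Coalgebra.comul (R := k) h)) ∧
  (∀ (h g : H) (b : P),
    tlift k (fun h1 h2 => tlift k (fun g1 g2 => γ h1 g1 * act b (g2 * h2))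
      (Coalgebra.comul (R := k) g)) (Coalgebra.comul (R := k) h) =
    tlift k (fun h1 h2 => tlift k (fun g1 g2 => act b (g1 * h1) * γ h2 g2)
      (Coalgebra.comul (R := k) g)) (Coalgebra.comul (R := k) h)) ∧
  (∀ h g : H, ca.ρ (γ h g) =
    tlift k (fun h1 h23 => tlift k (fun h2 h3 => tlift k (fun g1 g23 => tlift k (fun g2 g3 =>
      γ h2 g2 ⊗ₜ[k] (HopfAlgebra.antipode (R := k) (g1 * h1) * (g3 * h3)))
        (Coalgebra.comul (R := k) g23)) (Coalgebra.comul (R := k) g))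
      (Coalgebra.comul (R := k) h23)) (Coalgebra.comul (R := k) h)) ∧
  (∃ γi : H → H → P, (∃ γi' : H →ₗ[k] H →ₗ[k] P, ∀ h g, γi' h g = γi h g) ∧
    (∀ h g : H, convHH (k := k) γ γi h g =
      algebraMap k P (Coalgebra.counit (R := k) h * Coalgebra.counit (R := k) g)) ∧
    (∀ h g : H, convHH (k := k) γi γ h g =
      algebraMap k P (Coalgebra.counit (R := k) h * Coalgebra.counit (R := k) g)))

/-- `C̃¹(H,P)`: unital convolution-invertible `H`-colinear maps `f : H → P`, commuting
with `B` in the sense `p₍₀₎ b f(p₍₁₎) = p₍₀₎ f(p₍₁₎) b`. -/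
def IsCt1 (ca : ComodAlg k H P) (f : H →ₗ[k] P) : Prop :=
  f 1 = 1 ∧ (∀ h : H, ca.ρ (f h) = adCoaction (⇑f) h) ∧
  (∀ p b : P, ca.ρ b = b ⊗ₜ[k] (1 : H) →
    tlift k (fun p0 p1 => p0 * b * f p1) (ca.ρ p) =
      tlift k (fun p0 p1 => p0 * f p1 * b) (ca.ρ p)) ∧
  ∃ fi : H →ₗ[k] P, convH f fi = unitH ∧ convH fi f = unitH

/-- `γ^f(h,g) := (f⁻¹(g₍₁₎) ◁ h₍₁₎) f⁻¹(h₍₂₎) γ(h₍₃₎, g₍₂₎) f(g₍₃₎ h₍₄₎)`. -/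
def gamF (act : P →ₗ[k] H →ₗ[k] P) (f fi : H → P) (γ : H → H → P) (h g : H) : P :=
  tlift k (fun h1 h234 => tlift k (fun h2 h34 => tlift k (fun h3 h4 =>
    tlift k (fun g1 g23 => tlift k (fun g2 g3 =>
      act (fi g1) h1 * fi h2 * γ h3 g2 * f (g3 * h4)) (Coalgebra.comul (R := k) g23))
      (Coalgebra.comul (R := k) g))
    (Coalgebra.comul (R := k) h34)) (Coalgebra.comul (R := k) h234)) (Coalgebra.comul (R := k) h)

end ComodAlg

section ES

variable {B0 L0 : Type v} [Ring B0] [Algebra k B0] [Ring L0] [Algebra k L0]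

/-- The value of the 2-cocycle `Γ_γ(p ⊗ p', q ⊗ q') = p₍₀₎ q₍₀₎ γ(q₍₁₎, p₍₁₎) q' p'` on the
Ehresmann–Schauenburg bialgebroid, computed in `P` through an embedding `ι`. -/
def GammaOf (ca : ComodAlg k H P) (ι : L0 →ₐ[k] (P ⊗[k] Pᵐᵒᵖ)) (γ : H → H → P)
    (z w : L0) : P :=
  tlift k (fun p op' => tlift k (fun q oq' => tlift k (fun p0 p1 => tlift k (fun q0 q1 =>
    p0 * q0 * γ q1 p1 * MulOpposite.unop oq' * MulOpposite.unop op') (ca.ρ q)) (ca.ρ p))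
      (ι w)) (ι z)

end ES

end

set_option linter.unusedSectionVars false

namespace HopfGalois

section Lifts

variable {R M N Q : Type*} [CommRing R] [AddCommGroup M] [Module R M] [AddCommGroup N] [Module R N]
  [AddCommGroup Q] [Module R Q]

theorem tlift_eq (F : M ⊗[R] N →ₗ[R] Q) {f : M → N → Q} (h : ∀ x y, F (x ⊗ₜ[R] y) = f x y) :
    tlift R f = F := by
  have h' : ∃ F : M ⊗[R] N →ₗ[R] Q, ∀ x y, F (x ⊗ₜ[R] y) = f x y := ⟨F, h⟩
  rw [tlift, dif_pos h']
  ext x y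
  simp [h'.choose_spec, h]

theorem qtlift_eq {p : Submodule R (M ⊗[R] N)} (F : ((M ⊗[R] N) ⧸ p) →ₗ[R] Q) {f : M → N → Q}
    (h : ∀ x y, F (Submodule.Quotient.mk (x ⊗ₜ[R] y)) = f x y) : qtlift R p f = F := by
  have h' : ∃ F : ((M ⊗[R] N) ⧸ p) →ₗ[R] Q,
      ∀ x y, F (Submodule.Quotient.mk (x ⊗ₜ[R] y)) = f x y := ⟨F, h⟩
  rw [qtlift, dif_pos h']
  apply Submodule.linearMap_qext
  ext x y
  exact (h'.choose_spec x y).trans (h x y).symm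

theorem exists_factor {V W Z : Type*} [AddCommGroup V] [Module R V] [AddCommGroup W] [Module R W]
    [AddCommGroup Z] [Module R Z] (T : W →ₗ[R] Z) (hT : Function.Injective T) (φ : V →ₗ[R] Z)
    (h : ∀ v, ∃ w, T w = φ v) : ∃ ψ : V →ₗ[R] W, ∀ v, T (ψ v) = φ v := by
  refine ⟨(LinearEquiv.ofInjective T hT).symm.toLinearMap ∘ₗ
    LinearMap.codRestrict (LinearMap.range T) φ h, fun v => ?_⟩
  exact congrArg Subtype.val ((LinearEquiv.ofInjective T hT).apply_symm_apply
    (LinearMap.codRestrict (LinearMap.range T) φ h v))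

end Lifts

section Convolution

open LinearMap (mul')
open Coalgebra (comul counit)

variable {k : Type*} [Field k] {C D : Type*} [AddCommGroup C] [Module k C] [Coalgebra k C]
  [AddCommGroup D] [Module k D] [Coalgebra k D]
  {A A₂ : Type*} [Ring A] [Algebra k A] [Ring A₂] [Algebra k A₂]
  {N M : Type*} [AddCommGroup N] [Module k N] [AddCommGroup M] [Module k M]

/-- Convolution product of linear maps from a coalgebra to an algebra. -/
def cv (F G : C →ₗ[k] A) : C →ₗ[k] A := mul' k A ∘ₗ map F G ∘ₗ comul

/-- Unit for convolution. -/
def cvOne : C →ₗ[k] A := Algebra.linearMap k A ∘ₗ counit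

theorem cv_assoc (F G K : C →ₗ[k] A) : cv (cv F G) K = cv F (cv G K) :=
  congrArg WithConv.ofConv (mul_assoc (WithConv.toConv F) (WithConv.toConv G) (WithConv.toConv K))

@[simp] theorem cvOne_cv (F : C →ₗ[k] A) : cv cvOne F = F :=
  congrArg WithConv.ofConv (one_mul (WithConv.toConv F))

@[simp] theorem cv_cvOne (F : C →ₗ[k] A) : cv F cvOne = F :=
  congrArg WithConv.ofConv (mul_one (WithConv.toConv F))

theorem comp_cv (φ : A →ₐ[k] A₂) (F G : C →ₗ[k] A) :
    φ.toLinearMap ∘ₗ cv F G = cv (φ.toLinearMap ∘ₗ F) (φ.toLinearMap ∘ₗ G) :=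
  LinearMap.algHom_comp_convMul_distrib φ (WithConv.toConv F) (WithConv.toConv G)

theorem comp_cvOne (φ : A →ₐ[k] A₂) : φ.toLinearMap ∘ₗ (cvOne : C →ₗ[k] A) = cvOne := by
  ext; simp [cvOne]

theorem cv_comp (F G : C →ₗ[k] A) (m : D →ₗc[k] C) :
    cv F G ∘ₗ m.toLinearMap = cv (F ∘ₗ m.toLinearMap) (G ∘ₗ m.toLinearMap) :=
  LinearMap.convMul_comp_coalgHom_distrib (WithConv.toConv F) (WithConv.toConv G) m

theorem cvOne_comp (m : D →ₗc[k] C) : (cvOne : C →ₗ[k] A) ∘ₗ m.toLinearMap = cvOne := by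
  ext; simp [cvOne]

/-- Axioms of a right coaction. -/
structure IsCoact (ρ : N →ₗ[k] N ⊗[k] C) : Prop where
  coassoc : ∀ n, TensorProduct.assoc k N C C (ρ.rTensor C (ρ n)) = (comul (R := k)).lTensor N (ρ n)
  counit : ∀ n, TensorProduct.rid k N ((Coalgebra.counit (R := k)).lTensor N (ρ n)) = n

/-- `n ↦ g(n₀) F(n₁)`. -/
def ract (ρ : N →ₗ[k] N ⊗[k] C) (g : N →ₗ[k] A) (F : C →ₗ[k] A) : N →ₗ[k] A :=
  mul' k A ∘ₗ map g F ∘ₗ ρ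

theorem ract_ract {ρ : N →ₗ[k] N ⊗[k] C} (hρ : IsCoact ρ) (g : N →ₗ[k] A) (F G : C →ₗ[k] A) :
    ract ρ (ract ρ g F) G = ract ρ g (cv F G) := by
  ext n
  have h1 : ∀ w : N ⊗[k] C, mul' k A (map (ract ρ g F) G w) =
      mul' k A (map g (mul' k A ∘ₗ map F G) (TensorProduct.assoc k N C C (ρ.rTensor C w))) := by
    intro w
    induction w using TensorProduct.induction_on with
    | zero => simp
    | add x y hx hy => simp only [map_add, hx, hy]
    | tmul n c =>
      simp only [map_tmul, ract, LinearMap.comp_apply, LinearMap.mul'_apply, LinearMap.rTensor_tmul]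
      generalize ρ n = z
      induction z using TensorProduct.induction_on with
      | zero => simp
      | add x y hx hy => simp only [map_add, add_mul, add_tmul, hx, hy]
      | tmul n c => simp [mul_assoc]
  have h2 : ∀ w : N ⊗[k] C, mul' k A (map g (cv F G) w) =
      mul' k A (map g (mul' k A ∘ₗ map F G) ((comul (R := k)).lTensor N w)) := by
    intro w
    induction w using TensorProduct.induction_on with
    | zero => simp
    | add x y hx hy => simp only [map_add, hx, hy]
    | tmul n c => simp [cv]
  simp only [ract, LinearMap.comp_apply]
  rw [h2, ← hρ.coassoc, ← h1]
  rfl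

theorem ract_cvOne {ρ : N →ₗ[k] N ⊗[k] C} (hρ : IsCoact ρ) (g : N →ₗ[k] A) :
    ract ρ g cvOne = g := by
  ext n
  have h1 : ∀ w : N ⊗[k] C, mul' k A (map g cvOne w) =
      g (TensorProduct.rid k N ((Coalgebra.counit (R := k)).lTensor N w)) := by
    intro w
    induction w using TensorProduct.induction_on with
    | zero => simp
    | add x y hx hy => simp only [map_add, hx, hy]
    | tmul n c =>
      simp [cvOne, Algebra.algebraMap_eq_smul_one]
  simp only [ract, LinearMap.comp_apply, h1, hρ.counit]

theorem comp_ract (φ : A →ₐ[k] A₂) (ρ : N →ₗ[k] N ⊗[k] C) (g : N →ₗ[k] A) (F : C →ₗ[k] A) :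
    φ.toLinearMap ∘ₗ ract ρ g F = ract ρ (φ.toLinearMap ∘ₗ g) (φ.toLinearMap ∘ₗ F) := by
  simp only [ract, ← LinearMap.comp_assoc, AlgHom.comp_mul', map_comp]

/-- `ract` as a linear map in its last argument. -/
def ractL (ρ : N →ₗ[k] N ⊗[k] C) (g : N →ₗ[k] A) : (C →ₗ[k] A) →ₗ[k] (N →ₗ[k] A) where
  toFun F := ract ρ g F
  map_add' F G := by simp [ract, map_add_right, LinearMap.comp_add, LinearMap.add_comp]
  map_smul' c F := by simp [ract, map_smul_right, LinearMap.comp_smul, LinearMap.smul_comp]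

@[simp] theorem ractL_apply (ρ : N →ₗ[k] N ⊗[k] C) (g : N →ₗ[k] A) (F : C →ₗ[k] A) :
    ractL ρ g F = ract ρ g F := rfl

/-- Tensor product of two coactions. -/
def tco (ρ : N →ₗ[k] N ⊗[k] C) (σ : M →ₗ[k] M ⊗[k] D) :
    N ⊗[k] M →ₗ[k] (N ⊗[k] M) ⊗[k] (C ⊗[k] D) :=
  (tensorTensorTensorComm k N C M D).toLinearMap ∘ₗ map ρ σ

theorem IsCoact.tensor {ρ : N →ₗ[k] N ⊗[k] C} {σ : M →ₗ[k] M ⊗[k] D} (hρ : IsCoact ρ)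
    (hσ : IsCoact σ) : IsCoact (tco ρ σ) := by
  constructor
  · intro n
    let Θ : (N ⊗[k] (C ⊗[k] C)) ⊗[k] (M ⊗[k] (D ⊗[k] D)) →ₗ[k]
        (N ⊗[k] M) ⊗[k] ((C ⊗[k] D) ⊗[k] (C ⊗[k] D)) :=
      (tensorTensorTensorComm k C C D D).toLinearMap.lTensor _ ∘ₗ
        (tensorTensorTensorComm k N (C ⊗[k] C) M (D ⊗[k] D)).toLinearMap
    have h1 : ∀ (w : N ⊗[k] C) (z : M ⊗[k] D),
        TensorProduct.assoc k _ _ _ ((tco ρ σ).rTensor _ (tensorTensorTensorComm k N C M D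
          (w ⊗ₜ z))) = Θ (TensorProduct.assoc k N C C (ρ.rTensor C w) ⊗ₜ
            TensorProduct.assoc k M D D (σ.rTensor D z)) := by
      intro w z
      induction w using TensorProduct.induction_on with
      | zero => simp
      | add x y hx hy => simp only [map_add, add_tmul, hx, hy]
      | tmul n c =>
        induction z using TensorProduct.induction_on with
        | zero => simp
        | add x y hx hy => simp only [map_add, tmul_add, hx, hy]
        | tmul m d =>
          simp only [tensorTensorTensorComm_tmul, LinearMap.rTensor_tmul, tco,
            LinearMap.comp_apply, map_tmul, LinearEquiv.coe_coe]
          generalize ρ n = x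
          generalize σ m = y
          induction x using TensorProduct.induction_on with
          | zero => simp
          | add x y hx hy => simp only [map_add, add_tmul, hx, hy]
          | tmul n c' =>
            induction y using TensorProduct.induction_on with
            | zero => simp
            | add x y hx hy => simp only [map_add, tmul_add, add_tmul, hx, hy]
            | tmul m d' => simp [Θ]
    have h2 : ∀ (w : N ⊗[k] C) (z : M ⊗[k] D),
        (comul (R := k)).lTensor _ (tensorTensorTensorComm k N C M D (w ⊗ₜ z)) =
          Θ ((comul (R := k)).lTensor _ w ⊗ₜ (comul (R := k)).lTensor _ z) := by
      intro w z
      induction w using TensorProduct.induction_on with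
      | zero => simp
      | add x y hx hy => simp only [map_add, add_tmul, hx, hy]
      | tmul n c =>
        induction z using TensorProduct.induction_on with
        | zero => simp
        | add x y hx hy => simp only [map_add, tmul_add, hx, hy]
        | tmul m d =>
          simp [Θ, TensorProduct.comul_tmul, AlgebraTensorModule.tensorTensorTensorComm_eq]
    induction n using TensorProduct.induction_on with
    | zero => simp
    | add x y hx hy => simp only [map_add, hx, hy]
    | tmul n m =>
      have := h1 (ρ n) (σ m)
      rw [hρ.coassoc, hσ.coassoc, ← h2] at this
      exact this
  · intro n
    have h1 : ∀ (w : N ⊗[k] C) (z : M ⊗[k] D),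
        TensorProduct.rid k _ ((Coalgebra.counit (R := k)).lTensor _
          (tensorTensorTensorComm k N C M D (w ⊗ₜ z))) =
        (TensorProduct.rid k _ ((Coalgebra.counit (R := k)).lTensor _ w)) ⊗ₜ
          (TensorProduct.rid k _ ((Coalgebra.counit (R := k)).lTensor _ z)) := by
      intro w z
      induction w using TensorProduct.induction_on with
      | zero => simp
      | add x y hx hy => simp only [map_add, add_tmul, hx, hy]
      | tmul n c =>
        induction z using TensorProduct.induction_on with
        | zero => simp
        | add x y hx hy => simp only [map_add, tmul_add, hx, hy]
        | tmul m d =>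
          simp [TensorProduct.counit_tmul, smul_tmul', smul_smul, mul_comm, tmul_smul]
    induction n using TensorProduct.induction_on with
    | zero => simp
    | add x y hx hy => simp only [map_add, hx, hy]
    | tmul n m =>
      have := h1 (ρ n) (σ m)
      rw [hρ.counit, hσ.counit] at this
      exact this

/-- The coaction `ρ` together with the map `μ` allows cancellation of `μ(n₀) F(n₁)`. -/
def Cancels (ρ : N →ₗ[k] N ⊗[k] C) (μ : N →ₗ[k] A) : Prop :=
  ∀ F : C →ₗ[k] A, ract ρ μ F = 0 → F = 0

theorem Cancels.eq {ρ : N →ₗ[k] N ⊗[k] C} {μ : N →ₗ[k] A} (h : Cancels ρ μ) {F G : C →ₗ[k] A}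
    (e : ract ρ μ F = ract ρ μ G) : F = G := by
  rw [← sub_eq_zero]
  apply h
  rw [← ractL_apply, map_sub, ractL_apply, ractL_apply, e, sub_self]

theorem ract_tensor_tmul (ρ : N →ₗ[k] N ⊗[k] C) (σ : M →ₗ[k] M ⊗[k] D) (μ : N →ₗ[k] A)
    (ν : M →ₗ[k] A) (F : C ⊗[k] D →ₗ[k] A) (n : N) (m : M) :
    ract (tco ρ σ) (mul' k A ∘ₗ map μ ν) F (n ⊗ₜ m) =
      ract ρ μ (LinearMap.applyₗ m ∘ₗ ractL σ ν ∘ₗ curry F) n := by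
  simp only [ract, LinearMap.comp_apply, tco, map_tmul]
  generalize ρ n = w
  induction w using TensorProduct.induction_on with
  | zero => simp
  | add x y hx hy => simp only [map_add, add_tmul, hx, hy]
  | tmul n c =>
    simp only [map_tmul, LinearMap.comp_apply, LinearMap.applyₗ_apply_apply, ractL_apply, ract,
      LinearMap.mul'_apply]
    generalize σ m = z
    induction z using TensorProduct.induction_on with
    | zero => simp
    | add x y hx hy => simp only [map_add, tmul_add, mul_add, hx, hy]
    | tmul m d => simp [mul_assoc]

theorem Cancels.tensor {ρ : N →ₗ[k] N ⊗[k] C} {σ : M →ₗ[k] M ⊗[k] D} {μ : N →ₗ[k] A}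
    {ν : M →ₗ[k] A} (hμ : Cancels ρ μ) (hν : Cancels σ ν) :
    Cancels (tco ρ σ) (mul' k A ∘ₗ map μ ν) := by
  intro F hF
  ext c d
  have h1 : ∀ m, LinearMap.applyₗ m ∘ₗ ractL σ ν ∘ₗ curry F = 0 := by
    intro m
    apply hμ
    ext n
    rw [← ract_tensor_tmul, hF]
    rfl
  have h2 : curry F c = 0 := by
    apply hν
    ext m
    exact LinearMap.congr_fun (h1 m) c
  exact LinearMap.congr_fun h2 d

end Convolution
end HopfGalois

namespace HopfGalois

section Galois

open LinearMap (mul')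
open Coalgebra (comul counit)

variable {k : Type u} [Field k] {H P : Type v} [Ring H] [HopfAlgebra k H] [Ring P] [Algebra k P]
  (ca : ComodAlg k H P)

theorem isCoact : IsCoact ca.ρ := by
  constructor
  · intro p
    have h := ca.coassoc p
    rw [tlift_eq ((comul (R := k)).lTensor P)
      (f := fun p0 p1 => p0 ⊗ₜ[k] comul (R := k) p1) (fun _ _ => rfl)] at h
    rw [h, tlift_eq ((TensorProduct.assoc k P H H).toLinearMap ∘ₗ ca.ρ.rTensor H)]
    · rfl
    · intro x y
      rw [tlift_eq ((TensorProduct.assoc k P H H).toLinearMap ∘ₗ (TensorProduct.mk k _ H).flip y)]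
      · rfl
      · intro a b; rfl
  · intro p
    conv_rhs => rw [← ca.counit_coact p]
    rw [tlift_eq ((TensorProduct.rid k P).toLinearMap ∘ₗ (Coalgebra.counit (R := k)).lTensor P)]
    · rfl
    · intro x y; simp

/-- The coaction as an algebra map. -/
def rhoAlg : P →ₐ[k] P ⊗[k] H := AlgHom.ofLinearMap ca.ρ ca.coact_one ca.coact_mul

@[simp] theorem rhoAlg_toLinearMap : (rhoAlg ca).toLinearMap = ca.ρ := rfl

/-- The inclusion `P → P ⊗ H` as an algebra map. -/
abbrev inl : P →ₐ[k] P ⊗[k] H := Algebra.TensorProduct.includeLeft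

theorem chi_mk (p q : P) :
    ca.chi (Submodule.Quotient.mk (p ⊗ₜ[k] q)) = (p ⊗ₜ[k] (1 : H)) * ca.ρ q := by
  have key : ∀ p q : P, tlift k (fun q0 q1 => (p * q0) ⊗ₜ[k] q1) (ca.ρ q) =
      (p ⊗ₜ[k] (1 : H)) * ca.ρ q := by
    intro p q
    rw [tlift_eq (LinearMap.mulLeft k (p ⊗ₜ[k] (1 : H)))]
    · rfl
    · intro x y; simp
  have hle : ca.relB ≤ LinearMap.ker (mul' k (P ⊗[k] H) ∘ₗ map inl.toLinearMap ca.ρ) := by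
    rw [ComodAlg.relB, Submodule.span_le]
    rintro _ ⟨p, q, b, hb, rfl⟩
    simp [ca.coact_mul, hb, ← mul_assoc]
  rw [ComodAlg.chi, qtlift_eq (ca.relB.liftQ _ hle)]
  · simp
  · intro x y
    rw [key]
    simp

variable {ca}
variable {A₂ : Type*} [Ring A₂] [Algebra k A₂]

/-- `a ⊗ h ↦ i(a) F(h)` composed with the canonical map. -/
theorem map_chi_mk (i : P →ₐ[k] A₂) (F : H →ₗ[k] A₂) (a b : P) :
    (mul' k A₂ ∘ₗ map i.toLinearMap F) (ca.chi (Submodule.Quotient.mk (a ⊗ₜ[k] b))) =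
      i a * ract ca.ρ i.toLinearMap F b := by
  rw [chi_mk, ract, LinearMap.comp_apply, LinearMap.comp_apply, LinearMap.comp_apply]
  generalize ca.ρ b = w
  induction w using TensorProduct.induction_on with
  | zero => simp
  | add x y hx hy => simp only [map_add, mul_add, hx, hy]
  | tmul m d => simp [mul_assoc]

theorem linearMap_ext_chi {V : Type*} [AddCommGroup V] [Module k V] (hGal : ca.IsGalois)
    {f g : P ⊗[k] H →ₗ[k] V}
    (h : ∀ a b, f ((a ⊗ₜ[k] (1 : H)) * ca.ρ b) = g ((a ⊗ₜ[k] (1 : H)) * ca.ρ b)) : f = g := by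
  have : f ∘ₗ ca.chi = g ∘ₗ ca.chi := by
    apply Submodule.linearMap_qext
    ext a b
    simpa [chi_mk] using h a b
  ext1
  ext x y
  obtain ⟨z, hz⟩ := hGal.2 (x ⊗ₜ y)
  simpa [hz] using LinearMap.congr_fun this z

theorem cancels (hGal : ca.IsGalois) (i : P →ₐ[k] A₂) : Cancels ca.ρ i.toLinearMap := by
  intro F hF
  have : mul' k A₂ ∘ₗ map i.toLinearMap F = 0 := by
    apply linearMap_ext_chi hGal
    intro a b
    rw [← chi_mk, map_chi_mk, hF]
    simp
  ext h
  simpa using LinearMap.congr_fun this (1 ⊗ₜ h)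

theorem exists_ract_eq (hGal : ca.IsGalois) (u : P →ₗ[k] P)
    (hu : ∀ b p, ca.ρ b = b ⊗ₜ[k] (1 : H) → u (b * p) = b * u p) :
    ∃ f : H →ₗ[k] P, ract ca.ρ LinearMap.id f = u := by
  have hle : ca.relB ≤ LinearMap.ker (mul' k P ∘ₗ map LinearMap.id u) := by
    rw [ComodAlg.relB, Submodule.span_le]
    rintro _ ⟨p, q, b, hb, rfl⟩
    simp [hu b q hb, mul_assoc]
  let e := LinearEquiv.ofBijective ca.chi hGal
  let Ψ := ca.relB.liftQ _ hle ∘ₗ e.symm.toLinearMap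
  have hΨ : ∀ a b, Ψ ((a ⊗ₜ[k] (1 : H)) * ca.ρ b) = a * u b := by
    intro a b
    have : e.symm ((a ⊗ₜ[k] (1 : H)) * ca.ρ b) = Submodule.Quotient.mk (a ⊗ₜ[k] b) := by
      rw [LinearEquiv.symm_apply_eq, ← chi_mk]; rfl
    simp [Ψ, this]
  refine ⟨Ψ ∘ₗ TensorProduct.mk k P H 1, ?_⟩
  have hmul : ∀ c : P, Ψ ∘ₗ LinearMap.mulLeft k (c ⊗ₜ[k] (1 : H)) = LinearMap.mulLeft k c ∘ₗ Ψ := by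
    intro c
    apply linearMap_ext_chi hGal
    intro a b
    simp only [LinearMap.comp_apply, LinearMap.mulLeft_apply, ← mul_assoc]
    rw [hΨ, Algebra.TensorProduct.tmul_mul_tmul, one_mul, hΨ, mul_assoc]
  ext p
  have : ∀ w, (mul' k P ∘ₗ map LinearMap.id (Ψ ∘ₗ TensorProduct.mk k P H 1)) w = Ψ w := by
    intro w
    induction w using TensorProduct.induction_on with
    | zero => simp
    | add x y hx hy => simp only [map_add, hx, hy]
    | tmul m d =>
      have := LinearMap.congr_fun (hmul m) (1 ⊗ₜ d)
      simpa using this.symm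
  refine (this _).trans ?_
  have := hΨ 1 p
  rwa [← Algebra.TensorProduct.one_def, one_mul, one_mul] at this

end Galois

end HopfGalois

namespace HopfGalois

section Sweedler

open LinearMap (mul')
open Coalgebra (comul counit)

variable {k : Type*} [Field k] {C D : Type*} [AddCommGroup C] [Module k C] [Coalgebra k C]
  [AddCommGroup D] [Module k D] [Coalgebra k D] {A : Type*} [Ring A] [Algebra k A]

/-- Convolution as a bilinear map. -/
def cvL : (C →ₗ[k] A) →ₗ[k] (C →ₗ[k] A) →ₗ[k] (C →ₗ[k] A) :=
  LinearMap.mk₂ k cv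
    (by intro F F' G; ext; simp [cv, map_add_left])
    (by intro c F G; ext; simp [cv, map_smul_left])
    (by intro F G G'; ext; simp [cv, map_add_right])
    (by intro c F G; ext; simp [cv, map_smul_right])

@[simp] theorem cvL_apply (F G : C →ₗ[k] A) : cvL F G = cv F G := rfl

/-- The slice `c ↦ F(c ⊗ d)`. -/
def slice (F : C ⊗[k] D →ₗ[k] A) : D →ₗ[k] C →ₗ[k] A := (curry F).flip

@[simp] theorem slice_apply (F : C ⊗[k] D →ₗ[k] A) (c : C) (d : D) :
    slice F d c = F (c ⊗ₜ d) := rfl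

theorem tlift_comul {F G : C →ₗ[k] A} {f : C → C → A} (h : ∀ x y, f x y = F x * G y) (c : C) :
    tlift k f (comul (R := k) c) = cv F G c := by
  rw [tlift_eq (mul' k A ∘ₗ map F G) (by simp [h])]
  rfl

theorem slice_cv (F G : C ⊗[k] D →ₗ[k] A) (d : D) :
    slice (cv F G) d = lift (cvL.compl₁₂ (slice F) (slice G)) (comul (R := k) d) := by
  ext c
  have key : ∀ (w : C ⊗[k] C) (z : D ⊗[k] D),
      mul' k A (map F G (AlgebraTensorModule.tensorTensorTensorComm k k k k C C D D (w ⊗ₜ z))) =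
        lift ((LinearMap.mk₂ k (fun F G => mul' k A (map F G w))
          (by intro F F' G; simp [map_add_left]) (by intro c F G; simp [map_smul_left])
          (by intro F G G'; simp [map_add_right])
          (by intro c F G; simp [map_smul_right])).compl₁₂ (slice F) (slice G)) z := by
    intro w z
    induction z using TensorProduct.induction_on with
    | zero => simp
    | add x y hx hy => simp only [map_add, tmul_add, hx, hy]
    | tmul a b =>
      induction w using TensorProduct.induction_on with
      | zero => simp
      | add x y hx hy =>
        simp only [map_add, add_tmul, hx, hy]
        simp
      | tmul a' b' => simp
  have h1 : cv F G (c ⊗ₜ d) = mul' k A (map F G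
      (AlgebraTensorModule.tensorTensorTensorComm k k k k C C D D
        (comul (R := k) c ⊗ₜ comul (R := k) d))) := by
    simp [cv, TensorProduct.comul_tmul]
  rw [slice_apply, h1, key]
  generalize comul (R := k) d = z
  induction z using TensorProduct.induction_on with
  | zero => simp
  | add x y hx hy => simp only [map_add, hx, hy, LinearMap.add_apply]
  | tmul a b => simp [cv]

theorem tlift_slice {Q : Type*} [AddCommGroup Q] [Module k Q] {F G : C ⊗[k] D →ₗ[k] A}
    {f : D → D → Q} (φ : (C →ₗ[k] A) →ₗ[k] Q)
    (h : ∀ x y, f x y = φ (cv (slice F x) (slice G y))) (d : D) :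
    tlift k f (comul (R := k) d) = φ (slice (cv F G) d) := by
  rw [tlift_eq (φ ∘ₗ lift (cvL.compl₁₂ (slice F) (slice G))) (by simp [h]), slice_cv]
  rfl

theorem tlift_slice_apply {F G : C ⊗[k] D →ₗ[k] A} {f : D → D → A} (c : C)
    (h : ∀ x y, f x y = cv (slice F x) (slice G y) c) (d : D) :
    tlift k f (comul (R := k) d) = cv F G (c ⊗ₜ d) :=
  tlift_slice (F := F) (G := G) (f := f) (LinearMap.applyₗ c) h d

end Sweedler

section Colinear

open LinearMap (mul')
open Coalgebra (comul counit)

variable {k : Type u} [Field k] {H P : Type v} [Ring H] [HopfAlgebra k H] [Ring P] [Algebra k P]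
  (ca : ComodAlg k H P)
  {C : Type*} [AddCommGroup C] [Module k C] [Coalgebra k C] (m : C →ₗc[k] H)
  {N : Type*} [AddCommGroup N] [Module k N]

/-- The map `c ↦ 1 ⊗ m(c)`. -/
def inrMap (m : C →ₗ[k] H) : C →ₗ[k] P ⊗[k] H := TensorProduct.mk k P H 1 ∘ₗ m

/-- Colinearity of `F : C → P` with respect to the adjoint coaction along `m`. -/
def IsCol (F : C →ₗ[k] P) : Prop :=
  cv (inrMap m.toLinearMap) (ca.ρ ∘ₗ F) = cv (inl.toLinearMap ∘ₗ F) (inrMap m.toLinearMap)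

theorem inrMap_eq (m : C →ₗ[k] H) : (inrMap m : C →ₗ[k] P ⊗[k] H) =
    (Algebra.TensorProduct.includeRight : H →ₐ[k] P ⊗[k] H).toLinearMap ∘ₗ m := rfl

theorem inrMap_antipode_cv : cv (inrMap (HopfAlgebra.antipode k ∘ₗ m.toLinearMap))
    (inrMap m.toLinearMap) = (cvOne : C →ₗ[k] P ⊗[k] H) := by
  have h : cv (HopfAlgebra.antipode k) (LinearMap.id : H →ₗ[k] H) = cvOne := by
    ext h; simp [cv, cvOne, ← LinearMap.rTensor_def]
  rw [inrMap_eq, inrMap_eq, ← comp_cv]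
  have h2 := cv_comp (HopfAlgebra.antipode k) (LinearMap.id : H →ₗ[k] H) m
  rw [h, cvOne_comp] at h2
  rw [LinearMap.id_comp] at h2
  rw [← h2, comp_cvOne]

theorem inrMap_cv_antipode : cv (inrMap m.toLinearMap)
    (inrMap (HopfAlgebra.antipode k ∘ₗ m.toLinearMap)) = (cvOne : C →ₗ[k] P ⊗[k] H) := by
  have h : cv (LinearMap.id : H →ₗ[k] H) (HopfAlgebra.antipode k) = cvOne := by
    ext h; simp [cv, cvOne, ← LinearMap.lTensor_def]
  rw [inrMap_eq, inrMap_eq, ← comp_cv]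
  have h2 := cv_comp (LinearMap.id : H →ₗ[k] H) (HopfAlgebra.antipode k) m
  rw [h, cvOne_comp] at h2
  rw [LinearMap.id_comp] at h2
  rw [← h2, comp_cvOne]

theorem isCol_iff_antipode (F : C →ₗ[k] P) : IsCol ca m F ↔ ca.ρ ∘ₗ F =
    cv (inrMap (HopfAlgebra.antipode k ∘ₗ m.toLinearMap))
      (cv (inl.toLinearMap ∘ₗ F) (inrMap m.toLinearMap)) := by
  constructor
  · intro h
    rw [← h, ← cv_assoc, inrMap_antipode_cv, cvOne_cv]
  · intro h
    rw [IsCol, h, ← cv_assoc, inrMap_cv_antipode, cvOne_cv]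

variable {ca m}

theorem IsCol.inv {F G : C →ₗ[k] P} (hF : IsCol ca m F) (h1 : cv F G = cvOne)
    (h2 : cv G F = cvOne) : IsCol ca m G := by
  unfold IsCol at *
  have e1 := comp_cv (rhoAlg ca) F G
  have e2 := comp_cv (inl (k := k) (P := P) (H := H)) G F
  rw [h1, comp_cvOne] at e1
  rw [h2, comp_cvOne] at e2
  rw [rhoAlg_toLinearMap] at e1
  calc _ = cv (cv (inl.toLinearMap ∘ₗ G) (inl.toLinearMap ∘ₗ F))
        (cv (inrMap m.toLinearMap) (ca.ρ ∘ₗ G)) := by rw [← e2, cvOne_cv]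
    _ = cv (inl.toLinearMap ∘ₗ G)
        (cv (cv (inl.toLinearMap ∘ₗ F) (inrMap m.toLinearMap))
          (ca.ρ ∘ₗ G)) := by
      simp only [cv_assoc]
    _ = _ := by
      rw [← hF, cv_assoc, ← e1, cv_cvOne]

theorem map_comp_eq_ract (ρN : N →ₗ[k] N ⊗[k] C) (g : N →ₗ[k] P) (m : C →ₗ[k] H) :
    map g m ∘ₗ ρN = ract ρN (inl.toLinearMap ∘ₗ g) (inrMap m) := by
  ext n
  simp only [ract, LinearMap.comp_apply]
  generalize ρN n = w
  induction w using TensorProduct.induction_on with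
  | zero => simp
  | add x y hx hy => simp only [map_add, hx, hy]
  | tmul a b => simp [inrMap]

theorem isCol_iff {ρN : N →ₗ[k] N ⊗[k] C} (hN : IsCoact ρN) {μ : N →ₗ[k] P}
    (hμ : ca.ρ ∘ₗ μ = map μ m.toLinearMap ∘ₗ ρN) (hc : Cancels ρN ((inl (k := k) (P := P) (H := H)).toLinearMap ∘ₗ μ))
    (F : C →ₗ[k] P) :
    IsCol ca m F ↔ ca.ρ ∘ₗ ract ρN μ F = map (ract ρN μ F) m.toLinearMap ∘ₗ ρN := by
  rw [map_comp_eq_ract] at *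
  rw [← rhoAlg_toLinearMap] at *
  rw [comp_ract, comp_ract, ract_ract hN, hμ, ract_ract hN]
  exact ⟨fun h => congrArg _ h, fun h => hc.eq h⟩

theorem ract_apply_of_col {ρN : N →ₗ[k] N ⊗[k] C} {m : C →ₗ[k] H} {G : N →ₗ[k] P}
    (hG : ca.ρ ∘ₗ G = map G m ∘ₗ ρN) (F : H →ₗ[k] P) (n : N) :
    ract ca.ρ LinearMap.id F (G n) = ract ρN G (F ∘ₗ m) n := by
  have := LinearMap.congr_fun hG n
  simp only [LinearMap.comp_apply] at this
  simp only [ract, LinearMap.comp_apply, this]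
  rw [← LinearMap.comp_apply (map _ _), ← map_comp]
  rfl

end Colinear
end HopfGalois

namespace HopfGalois

section Sweedler

open LinearMap (mul')
open Coalgebra (comul counit)

variable {k : Type*} [Field k] {C D : Type*} [AddCommGroup C] [Module k C] [Coalgebra k C]
  [AddCommGroup D] [Module k D] [Coalgebra k D] {A : Type*} [Ring A] [Algebra k A]

theorem curry_cv (F G : C ⊗[k] D →ₗ[k] A) (c : C) :
    curry (cv F G) c = lift (cvL.compl₁₂ (curry F) (curry G)) (comul (R := k) c) := by
  ext d
  have key : ∀ (w : C ⊗[k] C) (z : D ⊗[k] D),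
      mul' k A (map F G (AlgebraTensorModule.tensorTensorTensorComm k k k k C C D D (w ⊗ₜ z))) =
        lift ((LinearMap.mk₂ k (fun F G => mul' k A (map F G z))
          (by intro F F' G; simp [map_add_left]) (by intro c F G; simp [map_smul_left])
          (by intro F G G'; simp [map_add_right])
          (by intro c F G; simp [map_smul_right])).compl₁₂ (curry F) (curry G)) w := by
    intro w z
    induction w using TensorProduct.induction_on with
    | zero => simp
    | add x y hx hy => simp only [map_add, add_tmul, hx, hy]
    | tmul a b =>
      induction z using TensorProduct.induction_on with
      | zero => simp
      | add x y hx hy =>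
        simp only [map_add, tmul_add, hx, hy]
        simp
      | tmul a' b' => simp
  have h1 : cv F G (c ⊗ₜ d) = mul' k A (map F G
      (AlgebraTensorModule.tensorTensorTensorComm k k k k C C D D
        (comul (R := k) c ⊗ₜ comul (R := k) d))) := by
    simp [cv, TensorProduct.comul_tmul]
  rw [curry_apply, h1, key]
  generalize comul (R := k) c = z
  induction z using TensorProduct.induction_on with
  | zero => simp
  | add x y hx hy => simp only [map_add, hx, hy, LinearMap.add_apply]
  | tmul a b => simp [cv]

theorem tlift_comul_map {Q : Type*} [AddCommGroup Q] [Module k Q] {F G : C →ₗ[k] A} {f : C → C → Q}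
    (φ : A →ₗ[k] Q) (h : ∀ x y, f x y = φ (F x * G y)) (c : C) :
    tlift k f (comul (R := k) c) = φ (cv F G c) := by
  rw [tlift_eq (φ ∘ₗ mul' k A ∘ₗ map F G) (by simp [h])]
  rfl

theorem curry_cvOne (c : C) : curry (cvOne : C ⊗[k] D →ₗ[k] A) c =
    (counit (R := k) c) • cvOne := by
  ext d
  simp [cvOne, TensorProduct.counit_tmul, Algebra.smul_def]
  rw [← map_mul, mul_comm, map_mul]

end Sweedler

section Transport

open LinearMap (mul')

variable {k : Type*} [Field k] {C D C' D' N M N' M' A : Type*}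
  [AddCommGroup C] [Module k C] [AddCommGroup D] [Module k D]
  [AddCommGroup C'] [Module k C'] [AddCommGroup D'] [Module k D']
  [AddCommGroup N] [Module k N] [AddCommGroup M] [Module k M]
  [AddCommGroup N'] [Module k N'] [AddCommGroup M'] [Module k M'] [Ring A] [Algebra k A]

theorem tco_comp_map {ρ : N →ₗ[k] N ⊗[k] C} {ρ' : M →ₗ[k] M ⊗[k] D} {σ : N' →ₗ[k] N' ⊗[k] C'}
    {σ' : M' →ₗ[k] M' ⊗[k] D'} {F : N' →ₗ[k] N} {G : M' →ₗ[k] M} {m : C' →ₗ[k] C}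
    {n : D' →ₗ[k] D} (hF : ρ ∘ₗ F = map F m ∘ₗ σ) (hG : ρ' ∘ₗ G = map G n ∘ₗ σ') :
    tco ρ ρ' ∘ₗ map F G = map (map F G) (map m n) ∘ₗ tco σ σ' := by
  have h : (tensorTensorTensorComm k N C M D).toLinearMap ∘ₗ map (map F m) (map G n) =
      map (map F G) (map m n) ∘ₗ (tensorTensorTensorComm k N' C' M' D').toLinearMap := by
    ext a b c d
    simp
  rw [tco, tco, LinearMap.comp_assoc, ← map_comp, hF, hG, map_comp, ← LinearMap.comp_assoc, h,
    LinearMap.comp_assoc]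

theorem ract_comp_of_col {ρ : N →ₗ[k] N ⊗[k] C} {σ : N' →ₗ[k] N' ⊗[k] C'} {g : N' →ₗ[k] N}
    {m : C' →ₗ[k] C} (h : ρ ∘ₗ g = map g m ∘ₗ σ) (i : N →ₗ[k] A) (F : C →ₗ[k] A) :
    ract ρ i F ∘ₗ g = ract σ (i ∘ₗ g) (F ∘ₗ m) := by
  rw [ract, ract, LinearMap.comp_assoc, LinearMap.comp_assoc, h, map_comp, LinearMap.comp_assoc]

end Transport

section Braided

open LinearMap (mul')
open Coalgebra (comul counit)

variable {k : Type u} [Field k] {H P : Type v} [Ring H] [HopfAlgebra k H] [Ring P] [Algebra k P]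
  (ca : ComodAlg k H P)

/-- The diagonal coaction on `P ⊗ P`. -/
abbrev rhoTwo : P ⊗[k] P →ₗ[k] (P ⊗[k] P) ⊗[k] (H ⊗[k] H) := tco ca.ρ ca.ρ

variable (k P) in
/-- The multiplication of `P`, in a form suitable for `ract_tensor_tmul`. -/
abbrev muTwo : P ⊗[k] P →ₗ[k] P := mul' k P ∘ₗ map LinearMap.id LinearMap.id

variable (k H) in
/-- The multiplication of `H` as a coalgebra map. -/
abbrev mulCo : H ⊗[k] H →ₗc[k] H := Bialgebra.mulCoalgHom k H

theorem isCoact_rhoTwo : IsCoact (rhoTwo ca) := (isCoact ca).tensor (isCoact ca)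

theorem rho_comp_muTwo : ca.ρ ∘ₗ muTwo k P = map (muTwo k P) (mulCo k H).toLinearMap ∘ₗ rhoTwo ca := by
  ext p q
  simp only [AlgebraTensorModule.curry_apply, curry_apply, LinearMap.restrictScalars_self,
    LinearMap.comp_apply, map_tmul, LinearMap.id_apply, LinearMap.mul'_apply, ca.coact_mul, tco]
  generalize ca.ρ p = w
  generalize ca.ρ q = z
  induction w using TensorProduct.induction_on with
  | zero => simp
  | add x y hx hy => simp only [map_add, add_tmul, add_mul, hx, hy]
  | tmul a b =>
    induction z using TensorProduct.induction_on with
    | zero => simp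
    | add x y hx hy => simp only [map_add, tmul_add, mul_add, hx, hy]
    | tmul c d => simp

variable {ca}

theorem cancels_id (hGal : ca.IsGalois) : Cancels ca.ρ (LinearMap.id : P →ₗ[k] P) :=
  cancels hGal (AlgHom.id k P)

theorem cancels_inl (hGal : ca.IsGalois) :
    Cancels ca.ρ ((inl (k := k) (P := P) (H := H)).toLinearMap ∘ₗ LinearMap.id) :=
  cancels hGal inl

theorem cancels_muTwo (hGal : ca.IsGalois) : Cancels (rhoTwo ca) (muTwo k P) :=
  (cancels_id hGal).tensor (cancels_id hGal)

theorem cancels_inl_muTwo (hGal : ca.IsGalois) :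
    Cancels (rhoTwo ca) ((inl (k := k) (P := P) (H := H)).toLinearMap ∘ₗ muTwo k P) := by
  have h : (inl (k := k) (P := P) (H := H)).toLinearMap ∘ₗ muTwo k P =
      mul' k (P ⊗[k] H) ∘ₗ map (inl (k := k) (P := P) (H := H)).toLinearMap
        (inl (k := k) (P := P) (H := H)).toLinearMap := by
    ext p q; simp
  rw [h]
  exact (cancels hGal inl).tensor (cancels hGal inl)

theorem rho_comp_id : ca.ρ ∘ₗ (LinearMap.id : P →ₗ[k] P) =
    map LinearMap.id (CoalgHom.id k H).toLinearMap ∘ₗ ca.ρ := by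
  ext p
  change _ = map LinearMap.id LinearMap.id _
  simp

/-- Colinearity of `f`, expressed on `P`. -/
theorem isCol_id_iff (hGal : ca.IsGalois) (f : H →ₗ[k] P) : IsCol ca (CoalgHom.id k H) f ↔
    ca.ρ ∘ₗ ract ca.ρ LinearMap.id f =
      map (ract ca.ρ LinearMap.id f) (CoalgHom.id k H).toLinearMap ∘ₗ ca.ρ :=
  isCol_iff (isCoact ca) rho_comp_id (cancels_inl hGal) f

theorem isCol_mulCo_iff (hGal : ca.IsGalois) (φ : H ⊗[k] H →ₗ[k] P) : IsCol ca (mulCo k H) φ ↔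
    ca.ρ ∘ₗ ract (rhoTwo ca) (muTwo k P) φ =
      map (ract (rhoTwo ca) (muTwo k P) φ) (mulCo k H).toLinearMap ∘ₗ rhoTwo ca :=
  isCol_iff (isCoact_rhoTwo ca) (rho_comp_muTwo ca) (cancels_inl_muTwo hGal) φ

theorem ract_id_mul (f : H →ₗ[k] P) {b : P} (hb : ca.ρ b = b ⊗ₜ[k] (1 : H)) (p : P) :
    ract ca.ρ LinearMap.id f (b * p) = b * ract ca.ρ LinearMap.id f p := by
  simp only [ract, LinearMap.comp_apply, ca.coact_mul, hb]
  generalize ca.ρ p = w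
  induction w using TensorProduct.induction_on with
  | zero => simp
  | add x y hx hy => simp only [map_add, mul_add, hx, hy]
  | tmul a b => simp [mul_assoc]

theorem ract_apply_coinv {A₂ : Type*} [Ring A₂] [Algebra k A₂] (i : P →ₗ[k] A₂) (f : H →ₗ[k] A₂)
    {b : P} (hb : ca.ρ b = b ⊗ₜ[k] (1 : H)) : ract ca.ρ i f b = i b * f 1 := by
  simp [ract, hb]

theorem ract_rhoTwo_tmul (φ : H ⊗[k] H →ₗ[k] P) (p q : P) :
    ract (rhoTwo ca) (muTwo k P) φ (p ⊗ₜ q) = ract ca.ρ LinearMap.id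
      (LinearMap.applyₗ q ∘ₗ ractL ca.ρ LinearMap.id ∘ₗ curry φ) p :=
  ract_tensor_tmul _ _ _ _ _ _ _

theorem exists_ract_rhoTwo_eq (hGal : ca.IsGalois) (G : P ⊗[k] P →ₗ[k] P)
    (h1 : ∀ b p q, ca.ρ b = b ⊗ₜ[k] (1 : H) → G ((b * p) ⊗ₜ q) = b * G (p ⊗ₜ q))
    (h2 : ∀ b p q, ca.ρ b = b ⊗ₜ[k] (1 : H) → G (p ⊗ₜ (b * q)) = b * G (p ⊗ₜ q))
    (hcen : ∀ b p : P, ca.ρ b = b ⊗ₜ[k] (1 : H) → p * b = b * p) :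
    ∃ φ : H ⊗[k] H →ₗ[k] P, ract (rhoTwo ca) (muTwo k P) φ = G := by
  have inj : Function.Injective (ractL ca.ρ (LinearMap.id : P →ₗ[k] P)) :=
    fun F F' h => (cancels_id hGal).eq h
  obtain ⟨ψ, hψ⟩ := exists_factor (ractL ca.ρ (LinearMap.id : P →ₗ[k] P)) inj (curry G).flip
    (fun q => exists_ract_eq hGal _ (fun b p hb => h1 b p q hb))
  obtain ⟨χ, hχ⟩ := exists_factor (ractL ca.ρ (LinearMap.id : P →ₗ[k] P)) inj ψ.flip (by
    intro h
    apply exists_ract_eq hGal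
    intro b q hb
    have : ψ (b * q) = LinearMap.mulLeft k b ∘ₗ ψ q := by
      apply inj
      rw [hψ]
      ext p
      have e : b * G (p ⊗ₜ q) = b * (curry G).flip q p := rfl
      rw [LinearMap.flip_apply, curry_apply, h2 _ _ _ hb, e, ← hψ q]
      simp only [ractL_apply, ract, LinearMap.comp_apply]
      generalize ca.ρ p = w
      induction w using TensorProduct.induction_on with
      | zero => simp
      | add x y hx hy => simp only [map_add, mul_add, hx, hy]
      | tmul a c => simp [← mul_assoc, hcen b a hb]
    exact LinearMap.congr_fun this h)
  refine ⟨lift χ, ?_⟩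
  ext p q
  have e : LinearMap.applyₗ q ∘ₗ ractL ca.ρ LinearMap.id ∘ₗ curry (lift χ) = ψ q := by
    ext h
    exact LinearMap.congr_fun (hχ h) q
  refine (ract_rhoTwo_tmul (lift χ) p q).trans ?_
  rw [e]
  exact LinearMap.congr_fun (hψ q) p

variable {act : P →ₗ[k] H →ₗ[k] P}

theorem cv_act_comm (hGal : ca.IsGalois)
    (hbr : ∀ p, ract ca.ρ LinearMap.id (act p) = LinearMap.mulLeft k p)
    {φ : H ⊗[k] H →ₗ[k] P} (hφ : IsCol ca (mulCo k H) φ) (b : P) :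
    cv φ (act b ∘ₗ (mulCo k H).toLinearMap) = cv (act b ∘ₗ (mulCo k H).toLinearMap) φ := by
  apply (cancels_muTwo hGal).eq
  rw [← ract_ract (isCoact_rhoTwo ca), ← ract_ract (isCoact_rhoTwo ca)]
  ext1
  ext p q
  have h1 := ract_apply_of_col ((isCol_mulCo_iff hGal φ).1 hφ) (act b) (p ⊗ₜ q)
  have h2 : ract (rhoTwo ca) (muTwo k P) (act b ∘ₗ (mulCo k H).toLinearMap) =
      LinearMap.mulLeft k b ∘ₗ muTwo k P := by
    ext1
    ext p q
    have := ract_apply_of_col (rho_comp_muTwo ca) (act b) (p ⊗ₜ q)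
    rw [hbr] at this
    exact this.symm
  rw [h2]
  refine h1.symm.trans ?_
  rw [hbr]
  simp only [AlgebraTensorModule.curry_apply, curry_apply, LinearMap.restrictScalars_self]
  rw [LinearMap.mulLeft_apply]
  simp only [ract, LinearMap.comp_apply]
  generalize rhoTwo ca (p ⊗ₜ q) = w
  induction w using TensorProduct.induction_on with
  | zero => simp
  | add x y hx hy => simp only [map_add, mul_add, hx, hy]
  | tmul a c => simp [mul_assoc]

/-- The left-hand side of the cocycle condition as a map on `(H ⊗ H) ⊗ H`. -/
noncomputable def cocA (act : P →ₗ[k] H →ₗ[k] P) (φ : H ⊗[k] H →ₗ[k] P) : (H ⊗[k] H) ⊗[k] H →ₗ[k] P :=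
  cv (lift act ∘ₗ φ.rTensor H) (φ ∘ₗ (mulCo k H).toLinearMap.rTensor H)

/-- The right-hand side of the cocycle condition, as a map on `H ⊗ H` for fixed last argument. -/
noncomputable def cocB (φ : H ⊗[k] H →ₗ[k] P) (f : H) : H ⊗[k] H →ₗ[k] P :=
  cv φ (curry φ f ∘ₗ (mulCo k H).toLinearMap)

theorem cocycle_iff (hGal : ca.IsGalois)
    (hbr : ∀ p, ract ca.ρ LinearMap.id (act p) = LinearMap.mulLeft k p)
    {φ : H ⊗[k] H →ₗ[k] P} (hφ : IsCol ca (mulCo k H) φ) :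
    (∀ f g h, cocA act φ ((f ⊗ₜ g) ⊗ₜ h) = cocB φ f (g ⊗ₜ h)) ↔
    ∀ p q r, ract (rhoTwo ca) (muTwo k P) φ (ract (rhoTwo ca) (muTwo k P) φ (p ⊗ₜ q) ⊗ₜ r) =
      ract (rhoTwo ca) (muTwo k P) φ (p ⊗ₜ ract (rhoTwo ca) (muTwo k P) φ (q ⊗ₜ r)) := by
  have hcol := (isCol_mulCo_iff hGal φ).1 hφ
  let ρ3 := tco (rhoTwo ca) ca.ρ
  let μ3 : (P ⊗[k] P) ⊗[k] P →ₗ[k] P := mul' k P ∘ₗ map (muTwo k P) LinearMap.id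
  have c3 : Cancels ρ3 μ3 := (cancels_muTwo hGal).tensor (cancels_id hGal)
  have i3 : IsCoact ρ3 := (isCoact_rhoTwo ca).tensor (isCoact ca)
  have hA0 : ract ρ3 μ3 (lift act ∘ₗ φ.rTensor H) =
      mul' k P ∘ₗ map (ract (rhoTwo ca) (muTwo k P) φ) LinearMap.id := by
    refine TensorProduct.ext (LinearMap.ext fun n => LinearMap.ext fun r => ?_)
    refine (ract_tensor_tmul (rhoTwo ca) ca.ρ (muTwo k P) LinearMap.id _ n r).trans ?_
    have e : LinearMap.applyₗ r ∘ₗ ractL ca.ρ LinearMap.id ∘ₗ curry (lift act ∘ₗ φ.rTensor H) =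
        LinearMap.mulRight k r ∘ₗ φ := by
      ext1
      ext g h
      have : curry (lift act ∘ₗ φ.rTensor H) (g ⊗ₜ h) = act (φ (g ⊗ₜ h)) := by
        ext x; simp
      have e2 := LinearMap.congr_fun (hbr (φ (g ⊗ₜ h))) r
      simpa [this] using e2
    rw [e]
    change _ = mul' k P (map (muTwo k P) φ (rhoTwo ca n)) * r
    simp only [ract, LinearMap.comp_apply]
    generalize rhoTwo ca n = w
    induction w using TensorProduct.induction_on with
    | zero => simp
    | add x y hx hy => simp only [map_add, add_mul, hx, hy]
    | tmul a c => simp [mul_assoc]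
  have hA : ract ρ3 μ3 (cocA act φ) = ract (rhoTwo ca) (muTwo k P) φ ∘ₗ
      map (ract (rhoTwo ca) (muTwo k P) φ) LinearMap.id := by
    rw [cocA, ← ract_ract i3, hA0]
    have hc := tco_comp_map hcol (ρ' := ca.ρ) (G := LinearMap.id) (n := LinearMap.id) (σ' := ca.ρ)
      (by simp)
    rw [muTwo, map_id, LinearMap.comp_id] at hc ⊢
    exact (ract_comp_of_col hc (mul' k P) φ).symm
  let K : (H ⊗[k] H) ⊗[k] H →ₗ[k] P :=
    lift (cvL φ ∘ₗ LinearMap.lcomp k P (mulCo k H).toLinearMap ∘ₗ curry φ) ∘ₗ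
      (TensorProduct.assoc k H H H).toLinearMap
  have hK : ∀ f g h, K ((f ⊗ₜ g) ⊗ₜ h) = cocB φ f (g ⊗ₜ h) := fun f g h => rfl
  have hB : ∀ p q r, ract ρ3 μ3 K ((p ⊗ₜ q) ⊗ₜ r) =
      ract (rhoTwo ca) (muTwo k P) φ (p ⊗ₜ ract (rhoTwo ca) (muTwo k P) φ (q ⊗ₜ r)) := by
    intro p q r
    refine (ract_tensor_tmul (rhoTwo ca) ca.ρ (muTwo k P) LinearMap.id _ _ r).trans ?_
    rw [ract_rhoTwo_tmul, ract_rhoTwo_tmul φ p]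
    congr 2
    ext f
    have h1 : ract (rhoTwo ca) (muTwo k P) (cocB φ f) (q ⊗ₜ r) =
        ract ca.ρ LinearMap.id (curry φ f) (ract (rhoTwo ca) (muTwo k P) φ (q ⊗ₜ r)) := by
      rw [cocB, ← ract_ract (isCoact_rhoTwo ca)]
      exact (ract_apply_of_col hcol (curry φ f) (q ⊗ₜ r)).symm
    rw [ract_rhoTwo_tmul (cocB φ f)] at h1
    exact h1
  constructor
  · intro h p q r
    have : cocA act φ = K := by
      refine TensorProduct.ext (TensorProduct.ext' fun f g => LinearMap.ext fun x => ?_)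
      exact (h f g x).trans (hK f g x).symm
    rw [← hB, ← this, hA]
    rfl
  · intro h f g x
    have : cocA act φ = K := by
      apply c3.eq
      refine TensorProduct.ext (TensorProduct.ext' fun p q => LinearMap.ext fun r => ?_)
      exact (LinearMap.congr_fun hA _).trans ((h p q r).trans (hB p q r).symm)
    rw [this, hK]

end Braided
end HopfGalois

namespace HopfGalois

section Flat

variable {k : Type u} [Field k] {H P : Type v} [Ring H] [HopfAlgebra k H] [Ring P] [Algebra k P]
  {ca : ComodAlg k H P}

variable (ca) in
/-- Right modules over the coinvariants are left modules over this ring. -/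
abbrev CoinvOp := (↥ca.coinv)ᵐᵒᵖ

section Exact

variable {L M N Q : Type v} [AddCommGroup L] [Module (CoinvOp ca) L] [AddCommGroup M] [Module (CoinvOp ca) M]
  [AddCommGroup N] [Module (CoinvOp ca) N]

/-- The class of a pure tensor in `M ⊗_B P`. -/
def mtp (m : M) (p : P) : ca.MTP M := Submodule.Quotient.mk (m ⊗ₜ[ℤ] p)

theorem mtp_smul (b : ca.coinv) (m : M) (p : P) :
    mtp (MulOpposite.op b • m) p = mtp (ca := ca) m ((b : P) * p) :=
  (Submodule.Quotient.eq _).2 (Submodule.subset_span ⟨m, b, p, rfl⟩)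

theorem mtp_add_left (m m' : M) (p : P) :
    mtp (ca := ca) (m + m') p = mtp m p + mtp m' p := by
  rw [mtp, add_tmul]; rfl

theorem mtp_add_right (m : M) (p p' : P) :
    mtp (ca := ca) m (p + p') = mtp m p + mtp m p' := by
  rw [mtp, tmul_add]; rfl

theorem mtp_induction {motive : ca.MTP M → Prop} (w : ca.MTP M)
    (h0 : motive 0) (h1 : ∀ m p, motive (mtp m p))
    (hadd : ∀ x y, motive x → motive y → motive (x + y)) : motive w := by
  obtain ⟨w, rfl⟩ := Submodule.Quotient.mk_surjective _ w
  induction w using TensorProduct.induction_on with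
  | zero => exact h0
  | tmul m p => exact h1 m p
  | add x y hx hy => exact hadd _ _ hx hy

/-- The universal property of `M ⊗_B P`. -/
theorem exists_mtp_lift {Q : Type*} [AddCommGroup Q] (g : M →+ P →+ Q)
    (hg : ∀ (b : ca.coinv) m p, g (MulOpposite.op b • m) p = g m ((b : P) * p)) :
    ∃ F : ca.MTP M →+ Q, ∀ m p, F (mtp m p) = g m p := by
  let F0 : M ⊗[ℤ] P →+ Q := TensorProduct.liftAddHom g
    (by intro r m n; rw [map_zsmul, map_zsmul]; rfl)
  have hF0 : ∀ m p, F0 (m ⊗ₜ p) = g m p := fun m p => rfl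
  refine ⟨((ca.ffrel M).liftQ F0.toIntLinearMap ?_).toAddMonoidHom, fun m p => rfl⟩
  rw [ComodAlg.ffrel, Submodule.span_le]
  rintro _ ⟨m, b, p, rfl⟩
  refine LinearMap.mem_ker.2 ?_
  rw [AddMonoidHom.coe_toIntLinearMap, map_sub, hF0, hF0, hg, sub_self]

theorem ffmap_mtp (f : M →ₗ[CoinvOp ca] N) (m : M) (p : P) :
    ca.ffmap f (mtp m p) = mtp (f m) p := by
  obtain ⟨F, hF⟩ := exists_mtp_lift (ca := ca) (M := M) (Q := ca.MTP N)
    { toFun := fun m => ⟨⟨mtp (f m), by simp [mtp]⟩, mtp_add_right _⟩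
      map_zero' := by ext p; simp [mtp]
      map_add' := by intro x y; ext p; simp [mtp_add_left] } (by
        intro b m p
        change mtp (f (MulOpposite.op b • m)) p = mtp (f m) _
        rw [map_smul, mtp_smul])
  have : ca.ffmap f = F.toIntLinearMap := qtlift_eq _ hF
  rw [this]
  exact hF m p

theorem ffmap_injective (hFF : ca.IsFaithfullyFlat) (f : M →ₗ[CoinvOp ca] N)
    (hf : Function.Injective f) : Function.Injective (ca.ffmap f) :=
  hFF.1 M N f.toAddMonoidHom (fun _ m => map_smul f _ m) hf

theorem mem_range_ffmap (hFF : ca.IsFaithfullyFlat) (i : L →ₗ[CoinvOp ca] M) (f : M →ₗ[CoinvOp ca] N)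
    (hif : LinearMap.ker f ≤ LinearMap.range i) {w : ca.MTP M} (hw : ca.ffmap f w = 0) :
    ∃ x, ca.ffmap i x = w := by
  let f' := f.rangeRestrict
  have e : ∀ x, ca.ffmap f x = ca.ffmap (LinearMap.range f).subtype (ca.ffmap f' x) := by
    intro x
    induction x using mtp_induction with
    | h0 => simp
    | hadd x y hx hy => simp only [map_add, hx, hy]
    | h1 m p => rw [ffmap_mtp, ffmap_mtp, ffmap_mtp]; rfl
  have hw' : ca.ffmap f' w = 0 := by
    apply ffmap_injective hFF _ (LinearMap.range f).injective_subtype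
    rw [← e, hw, map_zero]
  let π := (LinearMap.range (ca.ffmap i)).mkQ
  have key : ∀ m m' p, f m = f m' → π (mtp m p) = π (mtp m' p) := by
    intro m m' p h
    obtain ⟨l, hl⟩ := hif (show m - m' ∈ LinearMap.ker f by simp [h])
    refine (Submodule.Quotient.eq _).2 ⟨mtp l p, ?_⟩
    rw [ffmap_mtp, hl, sub_eq_add_neg, mtp_add_left, sub_eq_add_neg]
    congr 1
  let σ : LinearMap.range f → M := fun y => y.2.choose
  have hσ : ∀ y, f (σ y) = y := fun y => y.2.choose_spec
  obtain ⟨g, hg⟩ := exists_mtp_lift (ca := ca) (M := LinearMap.range f)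
    (Q := ca.MTP M ⧸ LinearMap.range (ca.ffmap i))
    { toFun := fun y => ⟨⟨fun p => π (mtp (σ y) p), by simp [mtp]⟩,
        fun p p' => by simp [mtp_add_right]⟩
      map_zero' := by
        ext p
        exact (key _ 0 p (by simp [hσ])).trans (by simp [mtp])
      map_add' := by
        intro x y
        ext p
        exact (key _ (σ x + σ y) p (by simp [hσ])).trans (by simp [mtp_add_left]) } (by
    intro b m p
    change π (mtp (σ _) p) = π (mtp (σ m) _)
    rw [← mtp_smul]
    exact key _ _ p (by simp [hσ]))
  have hgf : ∀ x, g (ca.ffmap f' x) = π x := by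
    intro x
    induction x using mtp_induction with
    | h0 => simp
    | hadd x y hx hy => simp only [map_add, hx, hy]
    | h1 m p =>
      rw [ffmap_mtp, hg]
      exact key _ _ p (hσ _)
  have : π w = 0 := by rw [← hgf, hw', map_zero]
  exact (Submodule.Quotient.mk_eq_zero _).1 this

end Exact

end Flat
end HopfGalois

namespace HopfGalois

section Schneider

open LinearMap (mul')
open Coalgebra (comul counit)

variable {k : Type u} [Field k] {H P : Type v} [Ring H] [HopfAlgebra k H] [Ring P] [Algebra k P]
  {ca : ComodAlg k H P}

section GalMap

variable {M : Type v} [AddCommGroup M] [Module k M] [Module (CoinvOp ca) M]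

variable (ca) in
/-- A right action of `P` extending a given right action of the coinvariants. -/
structure IsRightAct (R : P →ₗ[k] M →ₗ[k] M) : Prop where
  one : ∀ m, R 1 m = m
  mul : ∀ p q m, R (p * q) m = R q (R p m)
  coinv : ∀ (b : ca.coinv) m, MulOpposite.op b • m = R b m

variable {R : P →ₗ[k] M →ₗ[k] M} (hR : IsRightAct ca R)

include hR

theorem exists_galMap : ∃ E : ca.MTP M →+ M ⊗[k] H,
    ∀ m p, E (mtp m p) = (R.flip m).rTensor H (ca.ρ p) := by
  refine exists_mtp_lift (ca := ca)
    { toFun := fun m => ((R.flip m).rTensor H ∘ₗ ca.ρ).toAddMonoidHom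
      map_zero' := by ext p; simp
      map_add' := by intro x y; ext p; simp } ?_
  intro b m p
  have hb : ca.ρ b = (b : P) ⊗ₜ[k] (1 : H) := b.2
  change (R.flip (MulOpposite.op b • m)).rTensor H (ca.ρ p) =
    (R.flip m).rTensor H (ca.ρ (b * p))
  rw [ca.coact_mul, hb]
  generalize ca.ρ p = w
  induction w using TensorProduct.induction_on with
  | zero => simp
  | add x y hx hy => simp only [map_add, mul_add, hx, hy]
  | tmul a c => simp [hR.mul, hR.coinv]

/-- The map `M ⊗_B P → M ⊗ H`, `m ⊗ p ↦ m p₍₀₎ ⊗ p₍₁₎`. -/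
noncomputable def galMap : ca.MTP M →+ M ⊗[k] H := (exists_galMap hR).choose

theorem galMap_mtp (m : M) (p : P) : galMap hR (mtp m p) = (R.flip m).rTensor H (ca.ρ p) :=
  (exists_galMap hR).choose_spec m p

theorem mtp_smul_act (c : k) (m : M) (p : P) : mtp (ca := ca) (c • m) p = mtp m (c • p) := by
  have h := mtp_smul (algebraMap k ca.coinv c) m p
  rw [hR.coinv] at h
  have e : ((algebraMap k ca.coinv c : ca.coinv) : P) = c • (1 : P) :=
    Algebra.algebraMap_eq_smul_one c
  rw [e, map_smul, LinearMap.smul_apply, hR.one, smul_mul_assoc, one_mul] at h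
  exact h

theorem exists_unfold (m : M) : ∃ D : ca.PBP →+ ca.MTP M,
    ∀ u v, D (Submodule.Quotient.mk (u ⊗ₜ[k] v)) = mtp (R u m) v := by
  let F : P ⊗[k] P →+ ca.MTP M := TensorProduct.liftAddHom
    { toFun := fun u => ⟨⟨mtp (R u m), by simp [mtp]⟩, mtp_add_right _⟩
      map_zero' := by ext p; simp [mtp]
      map_add' := by intro x y; ext p; simp [mtp_add_left] } (by
    intro c u v
    change mtp (R (c • u) m) v = mtp (R u m) (c • v)
    rw [map_smul, LinearMap.smul_apply, mtp_smul_act hR])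
  have hF : ∀ u v, F (u ⊗ₜ v) = mtp (R u m) v := fun _ _ => rfl
  refine ⟨QuotientAddGroup.lift ca.relB.toAddSubgroup F ?_, hF⟩
  intro x hx
  refine Submodule.closure_induction (p := fun x _ => F x = 0) (map_zero F)
    (fun x y _ _ hx hy => by rw [map_add, hx, hy, add_zero]) ?_ hx
  rintro c _ ⟨p, q, b, hb, rfl⟩
  rw [smul_sub, smul_tmul', smul_tmul', map_sub, hF, hF, ← smul_mul_assoc, hR.mul]
  rw [← mtp_smul ⟨b, hb⟩, hR.coinv, sub_self]

theorem exists_galMap_inv (hGal : ca.IsGalois) : ∃ D : M ⊗[k] H →+ ca.MTP M,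
    (∀ x, D (galMap hR x) = x) ∧ ∀ y, galMap hR (D y) = y := by
  choose D hD using exists_unfold hR
  let χ := LinearEquiv.ofBijective ca.chi hGal
  have hχ : ∀ u v, χ (Submodule.Quotient.mk (u ⊗ₜ v)) = (u ⊗ₜ[k] (1 : H)) * ca.ρ v :=
    fun u v => chi_mk ca u v
  have ind : ∀ (T T' : ca.PBP →+ ca.MTP M), (∀ u v, T (Submodule.Quotient.mk (u ⊗ₜ v)) =
      T' (Submodule.Quotient.mk (u ⊗ₜ v))) → ∀ y, T y = T' y := by
    intro T T' h y
    obtain ⟨y, rfl⟩ := Submodule.Quotient.mk_surjective _ y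
    induction y using TensorProduct.induction_on with
    | zero => simp
    | tmul u v => exact h u v
    | add a b ha hb => rw [Submodule.Quotient.mk_add, map_add, map_add, ha, hb]
  have hadd : ∀ m m' y, D (m + m') y = D m y + D m' y := by
    intro m m' y
    refine ind (D (m + m')) (D m + D m') (fun u v => ?_) y
    simp only [AddMonoidHom.add_apply, hD, map_add, mtp_add_left]
  have hzero : ∀ y, D 0 y = 0 := by
    intro y
    have := hadd 0 0 y
    simpa using this
  let χs := χ.symm.toLinearMap.toAddMonoidHom
  have hact : ∀ m x w, D (R x m) (χ.symm w) = D m (χ.symm ((x ⊗ₜ 1) * w)) := by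
    intro m x w
    obtain ⟨y, rfl⟩ := χ.surjective w
    rw [χ.symm_apply_apply]
    refine ind (D (R x m)) ((D m).comp (χs.comp ((LinearMap.mulLeft k
      (x ⊗ₜ[k] (1 : H))).toAddMonoidHom.comp χ.toLinearMap.toAddMonoidHom))) (fun u v => ?_) y
    change _ = D m (χ.symm ((x ⊗ₜ[k] (1 : H)) * χ (Submodule.Quotient.mk (u ⊗ₜ v))))
    have e : (x ⊗ₜ[k] (1 : H)) * χ (Submodule.Quotient.mk (u ⊗ₜ v)) =
        χ (Submodule.Quotient.mk ((x * u) ⊗ₜ v)) := by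
      rw [hχ, hχ, ← mul_assoc]; simp
    rw [e, χ.symm_apply_apply, hD, hD, hR.mul]
  let D0 : M ⊗[k] H →+ ca.MTP M := TensorProduct.liftAddHom
    { toFun := fun m => (D m).comp (χs.comp (TensorProduct.mk k P H 1).toAddMonoidHom)
      map_zero' := by ext h; exact hzero _
      map_add' := by intro x y; ext h; exact hadd _ _ _ } (by
    intro c m h
    have := hact m (c • 1) (1 ⊗ₜ h)
    rw [map_smul, LinearMap.smul_apply, hR.one] at this
    refine this.trans ?_
    change _ = D m (χ.symm (1 ⊗ₜ (c • h)))
    simp [smul_tmul])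
  have hD0 : ∀ m h, D0 (m ⊗ₜ h) = D m (χ.symm (1 ⊗ₜ h)) := fun _ _ => rfl
  refine ⟨D0, ?_, ?_⟩
  · intro x
    induction x using mtp_induction with
    | h0 => simp
    | hadd x y hx hy => simp only [map_add, hx, hy]
    | h1 m p =>
      have key : ∀ w, D0 ((R.flip m).rTensor H w) = D m (χ.symm w) := by
        intro w
        induction w using TensorProduct.induction_on with
        | zero => simp
        | add x y hx hy => simp only [map_add, hx, hy]
        | tmul a c =>
          rw [LinearMap.rTensor_tmul, hD0, LinearMap.flip_apply, hact]
          simp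
      rw [galMap_mtp, key]
      have e : ca.ρ p = χ (Submodule.Quotient.mk (1 ⊗ₜ p)) := by
        rw [hχ, ← Algebra.TensorProduct.one_def, one_mul]
      rw [e, χ.symm_apply_apply, hD, hR.one]
  · intro y
    induction y using TensorProduct.induction_on with
    | zero => simp
    | add x y hx hy => simp only [map_add, hx, hy]
    | tmul m h =>
      have key : ∀ y, galMap hR (D m y) = (R.flip m).rTensor H (χ y) := by
        intro y
        obtain ⟨y, rfl⟩ := Submodule.Quotient.mk_surjective _ y
        induction y using TensorProduct.induction_on with
        | zero => simp
        | add a b ha hb => simp only [Submodule.Quotient.mk_add, map_add, ha, hb]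
        | tmul u v =>
          rw [hD, galMap_mtp, hχ]
          generalize ca.ρ v = w
          induction w using TensorProduct.induction_on with
          | zero => simp
          | add x y hx hy => simp only [map_add, mul_add, hx, hy]
          | tmul a c => simp [hR.mul]
      rw [hD0, key, χ.apply_symm_apply]
      simp [hR.one]

theorem galMap_bijective (hGal : ca.IsGalois) : Function.Bijective (galMap hR) := by
  obtain ⟨D, h1, h2⟩ := exists_galMap_inv hR hGal
  exact Function.bijective_iff_has_inverse.2 ⟨D, h1, h2⟩

end GalMap

end Schneider
end HopfGalois

namespace HopfGalois

section HopfUnfold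

open LinearMap (mul')
open Coalgebra (comul counit)

variable (k : Type*) [Field k] (H : Type*) [Ring H] [HopfAlgebra k H]

/-- The canonical map `g ⊗ h ↦ g h₍₁₎ ⊗ h₍₂₎` of `H`. -/
noncomputable def unfoldMap : H ⊗[k] H →ₗ[k] H ⊗[k] H :=
  mul' k (H ⊗[k] H) ∘ₗ map (Algebra.TensorProduct.includeLeft : H →ₐ[k] H ⊗[k] H).toLinearMap
    (comul (R := k))

theorem unfoldMap_tmul (g h : H) :
    unfoldMap k H (g ⊗ₜ h) = (g ⊗ₜ[k] (1 : H)) * comul (R := k) h := by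
  simp [unfoldMap]

theorem unfoldMap_injective : Function.Injective (unfoldMap k H) := by
  let inl : H →ₐ[k] H ⊗[k] H := Algebra.TensorProduct.includeLeft
  let inr : H →ₐ[k] H ⊗[k] H := Algebra.TensorProduct.includeRight
  let S := HopfAlgebra.antipode k (A := H)
  let θ : H →ₗ[k] H ⊗[k] H := cv (inl.toLinearMap ∘ₗ S) inr.toLinearMap
  let ξ : H ⊗[k] H →ₗ[k] H ⊗[k] H := mul' k (H ⊗[k] H) ∘ₗ map inl.toLinearMap θ
  have hS : cv inl.toLinearMap (inl.toLinearMap ∘ₗ S) = cvOne := by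
    have : cv LinearMap.id S = (cvOne : H →ₗ[k] H) := by
      ext h
      simp [cv, cvOne, S, ← LinearMap.lTensor_def]
    rw [← comp_cvOne inl, ← this, comp_cv]
    rfl
  have h1 : ∀ h, ξ (comul (R := k) h) = 1 ⊗ₜ h := by
    intro h
    have : cv inl.toLinearMap θ = inr.toLinearMap := by
      rw [← cv_assoc, hS, cvOne_cv]
    exact LinearMap.congr_fun this h
  have h2 : ∀ g w, ξ ((g ⊗ₜ 1) * w) = (g ⊗ₜ[k] (1 : H)) * ξ w := by
    intro g w
    induction w using TensorProduct.induction_on with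
    | zero => simp
    | add x y hx hy => simp only [map_add, mul_add, hx, hy]
    | tmul a c => simp [ξ, inl, ← mul_assoc]
  refine Function.LeftInverse.injective (g := ξ) fun w => ?_
  induction w using TensorProduct.induction_on with
  | zero => simp
  | add x y hx hy => simp only [map_add, hx, hy]
  | tmul g h => rw [unfoldMap_tmul, h2, h1]; simp

end HopfUnfold

section Schneider

open LinearMap (mul')
open Coalgebra (comul counit)

variable {k : Type u} [Field k] {H P : Type v} [Ring H] [HopfAlgebra k H] [Ring P] [Algebra k P]
  {ca : ComodAlg k H P}

variable {L A : Type v} [AddCommGroup L] [Module (CoinvOp ca) L] [AddCommGroup A] [Module k A]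
  [Module (CoinvOp ca) A] [SMulCommClass k (CoinvOp ca) A]

/-- Descent for relative Hopf modules: a Hopf module `A` is induced from its coinvariants `L`. -/
theorem exists_induced (hGal : ca.IsGalois) (hFF : ca.IsFaithfullyFlat)
    {R : P →ₗ[k] A →ₗ[k] A} (hR : IsRightAct ca R) {β : A →ₗ[k] A ⊗[k] H} (hβ : IsCoact β)
    (hβR : ∀ r z, β (R r z) = map₂ R (LinearMap.mul k H).flip (ca.ρ r) (β z))
    (i : L →ₗ[CoinvOp ca] A) (hi : Function.Injective i)
    (hrange : ∀ z, β z = z ⊗ₜ[k] (1 : H) ↔ ∃ x, i x = z) :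
    ∃ F : ca.MTP L →+ A, (∀ x r, F (mtp x r) = R r (i x)) ∧ Function.Bijective F := by
  have hsm : ∀ (b : ca.coinv) (x : A ⊗[k] H), MulOpposite.op b • x = (R b).rTensor H x := by
    intro b x
    induction x using TensorProduct.induction_on with
    | zero => simp
    | add x y hx hy => simp only [smul_add, map_add, hx, hy]
    | tmul a c => rw [smul_tmul', hR.coinv]; rfl
  let RN : P →ₗ[k] (A ⊗[k] H) →ₗ[k] (A ⊗[k] H) := LinearMap.rTensorHom H ∘ₗ R
  have hRN : IsRightAct ca RN := by
    refine ⟨fun m => ?_, fun p q m => ?_, hsm⟩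
    · have : R 1 = LinearMap.id := LinearMap.ext hR.one
      simp [RN, this]
    · have : R (p * q) = R q ∘ₗ R p := LinearMap.ext (hR.mul p q)
      simp [RN, this, LinearMap.rTensor_comp]
  let f : A →ₗ[CoinvOp ca] A ⊗[k] H :=
    { toFun := fun z => β z - z ⊗ₜ 1
      map_add' := by intro x y; rw [map_add, add_tmul]; abel
      map_smul' := by
        intro b z
        obtain ⟨b, rfl⟩ := MulOpposite.op_surjective b
        have hb : ca.ρ b = (b : P) ⊗ₜ[k] (1 : H) := b.2
        rw [RingHom.id_apply, smul_sub, smul_tmul', hsm, hR.coinv, hβR, hb]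
        congr 1
        generalize β z = w
        induction w using TensorProduct.induction_on with
        | zero => simp
        | add x y hx hy => simp only [map_add, hx, hy]
        | tmul a c => simp }
  have hf : ∀ z, f z = β z - z ⊗ₜ 1 := fun _ => rfl
  obtain ⟨F, hF⟩ := exists_mtp_lift (ca := ca) (M := L) (Q := A)
    { toFun := fun x => (R.flip (i x)).toAddMonoidHom
      map_zero' := by ext p; simp
      map_add' := by intro x y; ext p; simp } (by
    intro b x p
    change R p (i (MulOpposite.op b • x)) = R (b * p) (i x)
    rw [map_smul, hR.coinv, hR.mul])
  have hF : ∀ x r, F (mtp x r) = R r (i x) := hF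
  have h1 : ∀ w, galMap hR (ca.ffmap i w) = β (F w) := by
    intro w
    induction w using mtp_induction with
    | h0 => simp
    | hadd x y hx hy => simp only [map_add, hx, hy]
    | h1 x r =>
      rw [ffmap_mtp, galMap_mtp, hF, hβR, (hrange _).2 ⟨x, rfl⟩]
      generalize ca.ρ r = w
      induction w using TensorProduct.induction_on with
      | zero => simp
      | add x y hx hy => simp only [map_add, LinearMap.add_apply, hx, hy]
      | tmul a c => simp
  refine ⟨F, hF, fun w w' h => ?_, fun a => ?_⟩
  · apply ffmap_injective hFF i hi
    apply (galMap_bijective hR hGal).1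
    rw [h1, h1, h]
  obtain ⟨w, hw⟩ := (galMap_bijective hR hGal).2 (β a)
  let Ξ : (A ⊗[k] H) ⊗[k] H →ₗ[k] A ⊗[k] (H ⊗[k] H) :=
    (unfoldMap k H).lTensor A ∘ₗ (TensorProduct.assoc k A H H).toLinearMap
  have hΞ : Function.Injective Ξ :=
    (Module.Flat.lTensor_preserves_injective_linearMap _ (unfoldMap_injective k H)).comp
      (TensorProduct.assoc k A H H).injective
  let σ : H ⊗[k] H →ₗ[k] H →ₗ[k] H ⊗[k] H :=
    (LinearMap.mul k (H ⊗[k] H)).flip.compr₂ LinearMap.id |>.compl₂ ((TensorProduct.mk k H H).flip 1)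
  have hσ : ∀ w g, σ w g = (g ⊗ₜ[k] (1 : H)) * w := fun _ _ => rfl
  have hA : ∀ (w : P ⊗[k] H) y, Ξ ((RN.flip y).rTensor H w) =
      map₂ R σ ((comul (R := k)).lTensor P w) y := by
    intro w y
    induction w using TensorProduct.induction_on with
    | zero => simp
    | add x y hx hy => simp only [map_add, LinearMap.add_apply, hx, hy]
    | tmul a c =>
      induction y using TensorProduct.induction_on with
      | zero => simp
      | add x y hx hy => simp only [map_add, LinearMap.add_apply, LinearMap.rTensor_add, hx, hy]
      | tmul z g => simp [Ξ, RN, unfoldMap_tmul, hσ]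
  have hB : ∀ (w : P ⊗[k] H) z, TensorProduct.assoc k A H H (β.rTensor H ((R.flip z).rTensor H w)) =
      map₂ R σ (TensorProduct.assoc k P H H (ca.ρ.rTensor H w)) (β z) := by
    intro w z
    induction w using TensorProduct.induction_on with
    | zero => simp
    | add x y hx hy => simp only [map_add, LinearMap.add_apply, hx, hy]
    | tmul a c =>
      simp only [LinearMap.rTensor_tmul, LinearMap.flip_apply, hβR]
      generalize β z = y
      generalize ca.ρ a = x
      induction x using TensorProduct.induction_on with
      | zero => simp
      | add x y hx hy => simp only [map_add, LinearMap.add_apply, add_tmul, hx, hy]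
      | tmul a d =>
        induction y using TensorProduct.induction_on with
        | zero => simp
        | add x y hx hy => simp only [map_add, add_tmul, hx, hy]
        | tmul z g => simp [hσ]
  have hC : ∀ (w : P ⊗[k] H) z, Ξ ((RN.flip (z ⊗ₜ 1)).rTensor H w) =
      (comul (R := k)).lTensor A ((R.flip z).rTensor H w) := by
    intro w z
    induction w using TensorProduct.induction_on with
    | zero => simp
    | add x y hx hy => simp only [map_add, hx, hy]
    | tmul a c => simp [Ξ, RN, unfoldMap_tmul, ← Algebra.TensorProduct.one_def]
  have hD : ∀ w, Ξ (galMap hRN (ca.ffmap f w)) =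
      TensorProduct.assoc k A H H (β.rTensor H (galMap hR w)) -
        (comul (R := k)).lTensor A (galMap hR w) := by
    intro w
    induction w using mtp_induction with
    | h0 => simp
    | hadd x y hx hy => simp only [map_add, hx, hy]; abel
    | h1 z r =>
      rw [ffmap_mtp, galMap_mtp, galMap_mtp, hf, map_sub, LinearMap.rTensor_sub,
        LinearMap.sub_apply, map_sub, hA, hC, hB, (isCoact ca).coassoc]
  have hker : ca.ffmap f w = 0 := by
    apply (galMap_bijective hRN hGal).1
    apply hΞ
    rw [hD, hw, hβ.coassoc, sub_self, map_zero, map_zero]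
  obtain ⟨x, hx⟩ := mem_range_ffmap hFF i f (fun z hz => by
    obtain ⟨x, hx⟩ := (hrange z).1 (sub_eq_zero.1 hz)
    exact ⟨x, hx⟩) hker
  refine ⟨x, ?_⟩
  have : β (F x) = β a := by rw [← h1, hx, hw]
  rw [← hβ.counit (F x), this, hβ.counit]

end Schneider
end HopfGalois

namespace HopfGalois

section Pushforward

open Coalgebra (comul counit)

variable {k : Type*} [Field k] {C D N M : Type*} [AddCommGroup C] [Module k C] [Coalgebra k C]
  [AddCommGroup D] [Module k D] [Coalgebra k D] [AddCommGroup N] [Module k N] [AddCommGroup M]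
  [Module k M]

/-- A coaction pushed forward along a coalgebra map, and transported along an isomorphism. -/
theorem IsCoact.push {ρ : N →ₗ[k] N ⊗[k] C} (hρ : IsCoact ρ) (m : C →ₗc[k] D) (e : N ≃ₗ[k] M) :
    IsCoact (map e.toLinearMap m.toLinearMap ∘ₗ ρ ∘ₗ e.symm.toLinearMap) := by
  constructor
  · intro n
    simp only [LinearMap.comp_apply, LinearEquiv.coe_coe]
    have h1 : ∀ w : N ⊗[k] C, TensorProduct.assoc k M D D
        ((map e.toLinearMap m.toLinearMap ∘ₗ ρ ∘ₗ e.symm.toLinearMap).rTensor D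
          (map e.toLinearMap m.toLinearMap w)) =
        map e.toLinearMap (map m.toLinearMap m.toLinearMap)
          (TensorProduct.assoc k N C C (ρ.rTensor C w)) := by
      intro w
      induction w using TensorProduct.induction_on with
      | zero => simp
      | add x y hx hy => simp only [map_add, hx, hy]
      | tmul a c =>
        simp only [map_tmul, LinearMap.rTensor_tmul, LinearMap.comp_apply, LinearEquiv.coe_coe,
          LinearEquiv.symm_apply_apply]
        generalize ρ a = z
        induction z using TensorProduct.induction_on with
        | zero => simp
        | add x y hx hy => simp only [map_add, add_tmul, hx, hy]
        | tmul a' c' => simp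
    have h2 : ∀ w : N ⊗[k] C, (comul (R := k)).lTensor M (map e.toLinearMap m.toLinearMap w) =
        map e.toLinearMap (map m.toLinearMap m.toLinearMap) ((comul (R := k)).lTensor N w) := by
      intro w
      induction w using TensorProduct.induction_on with
      | zero => simp
      | add x y hx hy => simp only [map_add, hx, hy]
      | tmul a c =>
        have := LinearMap.congr_fun m.map_comp_comul c
        simp only [map_tmul, LinearMap.lTensor_tmul]
        congr 1
        exact this.symm
    rw [h1, h2, hρ.coassoc]
  · intro n
    simp only [LinearMap.comp_apply, LinearEquiv.coe_coe]
    have h1 : ∀ w : N ⊗[k] C, TensorProduct.rid k M ((Coalgebra.counit (R := k)).lTensor M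
        (map e.toLinearMap m.toLinearMap w)) =
        e (TensorProduct.rid k N ((Coalgebra.counit (R := k)).lTensor N w)) := by
      intro w
      induction w using TensorProduct.induction_on with
      | zero => simp
      | add x y hx hy => simp only [map_add, hx, hy]
      | tmul a c => simp
    rw [h1, hρ.counit, LinearEquiv.apply_symm_apply]

end Pushforward

section Env

open LinearMap (mul')
open Coalgebra (comul counit)

variable {k : Type u} [Field k] {H P : Type v} [Ring H] [HopfAlgebra k H] [Ring P] [Algebra k P]
  {ca : ComodAlg k H P}

variable (k P) in
/-- The enveloping algebra of `P`. -/
abbrev Env := P ⊗[k] Pᵐᵒᵖ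

variable (k) in
/-- The element `1 ⊗ r` of the enveloping algebra. -/
noncomputable abbrev opR (r : P) : Env k P := (1 : P) ⊗ₜ[k] MulOpposite.op r

variable (k P) in
/-- The linear identification of `P ⊗ P` with the enveloping algebra. -/
noncomputable abbrev envEquiv : P ⊗[k] P ≃ₗ[k] Env k P :=
  TensorProduct.congr (LinearEquiv.refl k P) (MulOpposite.opLinearEquiv k)

theorem betaA_eq : ca.betaA =
    map (envEquiv k P).toLinearMap (mulCo k H).toLinearMap ∘ₗ rhoTwo ca ∘ₗ
      (envEquiv k P).symm.toLinearMap := by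
  have h1 : ∀ w z : P ⊗[k] H, tlift k (fun p0 p1 => tlift k (fun q0 q1 =>
      ((p0 ⊗ₜ[k] (MulOpposite.op q0) : P ⊗[k] Pᵐᵒᵖ)) ⊗ₜ[k] (p1 * q1)) z) w =
      map (envEquiv k P).toLinearMap (mulCo k H).toLinearMap
        (tensorTensorTensorComm k P H P H (w ⊗ₜ z)) := by
    intro w z
    let Θ : P ⊗[k] H →ₗ[k] P ⊗[k] H →ₗ[k] (Env k P) ⊗[k] H :=
      curry (map (envEquiv k P).toLinearMap
        (mulCo k H).toLinearMap ∘ₗ (tensorTensorTensorComm k P H P H).toLinearMap)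
    rw [tlift_eq (LinearMap.applyₗ z ∘ₗ Θ)]
    · rfl
    · intro p0 p1
      rw [tlift_eq (Θ (p0 ⊗ₜ p1))]
      · rfl
      · intro q0 q1
        simp [Θ]
  refine tlift_eq _ fun x y => ?_
  rw [h1]
  simp [tco]

theorem isCoact_betaA : IsCoact ca.betaA := by
  rw [betaA_eq]
  exact (isCoact_rhoTwo (ca := ca)).push _ _

variable (k P) in
/-- Right multiplication on the second leg of the enveloping algebra. -/
noncomputable def envR : P →ₗ[k] Env k P →ₗ[k] Env k P :=
  LinearMap.mul k (Env k P) ∘ₗ TensorProduct.mk k P Pᵐᵒᵖ 1 ∘ₗ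
    (MulOpposite.opLinearEquiv k).toLinearMap

@[simp] theorem envR_apply (r : P) (z : Env k P) : envR k P r z = opR k r * z := rfl

theorem betaA_envR (r : P) (z : Env k P) : ca.betaA (envR k P r z) =
    map₂ (envR k P) (LinearMap.mul k H).flip (ca.ρ r) (ca.betaA z) := by
  induction z using TensorProduct.induction_on with
  | zero => simp
  | add x y hx hy => simp only [map_add, hx, hy]
  | tmul p q =>
    rw [betaA_eq]
    simp only [envR_apply, Algebra.TensorProduct.tmul_mul_tmul, one_mul, LinearMap.comp_apply,
      LinearEquiv.coe_coe, congr_symm_tmul, LinearEquiv.refl_symm, LinearEquiv.refl_apply,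
      MulOpposite.coe_opLinearEquiv_symm, MulOpposite.unop_mul, MulOpposite.unop_op, tco,
      map_tmul, ca.coact_mul]
    generalize ca.ρ p = w
    generalize ca.ρ (MulOpposite.unop q) = w'
    generalize ca.ρ r = w''
    induction w using TensorProduct.induction_on with
    | zero => simp
    | add x y hx hy => simp only [map_add, add_tmul, hx, hy]
    | tmul a b =>
      induction w' using TensorProduct.induction_on with
      | zero => simp
      | add x y hx hy => simp only [map_add, add_mul, tmul_add, hx, hy]
      | tmul a' b' =>
        induction w'' using TensorProduct.induction_on with
        | zero => simp
        | add x y hx hy => simp only [map_add, mul_add, tmul_add, LinearMap.add_apply, hx, hy]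
        | tmul a'' b'' => simp [mul_assoc]

/-- The data of the Ehresmann–Schauenburg bialgebroid of a faithfully flat Hopf–Galois extension
with central coinvariants. -/
structure IsES (ca : ComodAlg k H P) {B0 L0 : Type v} [Ring B0] [Algebra k B0] [Ring L0]
    [Algebra k L0] (ιB : B0 →ₐ[k] P) (ι : L0 →ₐ[k] Env k P) (st : BgdST k B0 L0)
    (cop : L0 →ₗ[k] st.T2) (cou : L0 →ₗ[k] B0) : Prop where
  gal : ca.IsGalois
  ff : ca.IsFaithfullyFlat
  injB : Function.Injective ιB
  rangeB : ∀ p, ca.ρ p = p ⊗ₜ[k] (1 : H) ↔ ∃ b, ιB b = p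
  inj : Function.Injective ι
  range : ∀ z, ca.betaA z = z ⊗ₜ[k] (1 : H) ↔ ∃ x, ι x = z
  map_s : ∀ b : B0, ι (st.s b) = (ιB b) ⊗ₜ[k] MulOpposite.op (1 : P)
  map_t : ∀ b : B0, ι (st.t b) = (1 : P) ⊗ₜ[k] MulOpposite.op (ιB b)
  map_cou : ∀ z : L0, ιB (cou z) = ComodAlg.mulA (ι z)
  map_cop : ∀ (V : Type v) [AddCommGroup V] [Module k V]
      (G : (P ⊗[k] Pᵐᵒᵖ) →ₗ[k] (P ⊗[k] Pᵐᵒᵖ) →ₗ[k] V),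
      (∀ (b : B0) (X Y : P ⊗[k] Pᵐᵒᵖ),
        G ((((1 : P) ⊗ₜ[k] MulOpposite.op (ιB b)) : P ⊗[k] Pᵐᵒᵖ) * X) Y =
          G X ((((ιB b) ⊗ₜ[k] MulOpposite.op (1 : P)) : P ⊗[k] Pᵐᵒᵖ) * Y)) →
      ∀ z : L0, st.lift2 (fun x y => G (ι x) (ι y)) (cop z) =
        ca.esDeltaEval (fun x y => G x y) (ι z)
  central : ∀ b p, p * ιB b = ιB b * p

namespace IsES

variable {B0 L0 : Type v} [Ring B0] [Algebra k B0] [Ring L0] [Algebra k L0] {ιB : B0 →ₐ[k] P}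
  {ι : L0 →ₐ[k] Env k P} {st : BgdST k B0 L0} {cop : L0 →ₗ[k] st.T2} {cou : L0 →ₗ[k] B0}
  (E : IsES ca ιB ι st cop cou)

include E

/-- `P ⊗ P` is induced from its coinvariants. -/
theorem exists_lift_and_span :
    (∀ {Q : Type v} [AddCommGroup Q] (g : L0 →+ P →+ Q),
      (∀ b X r, g (st.t b * X) r = g X (ιB b * r)) →
        ∃ h : Env k P →+ Q, ∀ X r, h (opR k r * ι X) = g X r) ∧
    (∀ z : Env k P, z ∈ AddSubmonoid.closure {w | ∃ X r, w = opR k r * ι X}) := by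
  let j : CoinvOp ca →ₐ[k] Env k P :=
    (Algebra.TensorProduct.includeRight : Pᵐᵒᵖ →ₐ[k] Env k P).comp (AlgHom.op ca.coinv.val)
  have hj : ∀ b : ca.coinv, j (MulOpposite.op b) = opR k (b : P) := fun b => rfl
  let e := AlgEquiv.ofInjective ι E.inj
  have hjr : ∀ c, j c ∈ ι.range := by
    intro c
    obtain ⟨b, hb⟩ := (E.rangeB _).1 (MulOpposite.unop c).2
    exact ⟨st.t b, (E.map_t b).trans (by rw [hb]; rfl)⟩
  let j0 : CoinvOp ca →ₐ[k] L0 := e.symm.toAlgHom.comp (j.codRestrict ι.range hjr)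
  have hj0 : ∀ c, ι (j0 c) = j c := fun c => congrArg Subtype.val (e.apply_symm_apply _)
  let iL : Module (CoinvOp ca) L0 := Module.compHom L0 j0.toRingHom
  let iA : Module (CoinvOp ca) (Env k P) := Module.compHom (Env k P) j.toRingHom
  have hsL : ∀ (c : CoinvOp ca) (x : L0), c • x = j0 c * x := fun _ _ => rfl
  have hsA : ∀ (c : CoinvOp ca) (x : Env k P), c • x = j c * x := fun _ _ => rfl
  let _ : SMulCommClass k (CoinvOp ca) (Env k P) :=
    ⟨fun a c x => by rw [hsA, hsA, mul_smul_comm]⟩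
  let i : L0 →ₗ[CoinvOp ca] Env k P :=
    { toFun := ι, map_add' := map_add ι, map_smul' := fun c x => by simp [hsL, hsA, hj0] }
  have hR : IsRightAct ca (envR k P) := by
    refine ⟨fun m => ?_, fun p q m => ?_, fun b m => rfl⟩
    · rw [envR_apply]
      exact one_mul m
    · simp only [envR_apply, ← mul_assoc]
      simp
      rfl
  obtain ⟨F, hF, hFb⟩ := exists_induced E.gal E.ff hR isCoact_betaA betaA_envR i E.inj E.range
  constructor
  · intro Q _ g hg
    obtain ⟨F', hF'⟩ := exists_mtp_lift (ca := ca) g (by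
      intro b X r
      obtain ⟨b', hb'⟩ := (E.rangeB _).1 b.2
      have : j0 (MulOpposite.op b) = st.t b' := E.inj (by rw [hj0, hj, E.map_t, hb'])
      rw [hsL, this, hg, hb'])
    let e' := AddEquiv.ofBijective F hFb
    refine ⟨F'.comp e'.symm.toAddMonoidHom, fun X r => ?_⟩
    have : e'.symm (opR k r * ι X) = mtp X r := by
      rw [AddEquiv.symm_apply_eq]
      exact (hF X r).symm
    simp only [AddMonoidHom.comp_apply, AddEquiv.toAddMonoidHom_eq_coe,
      AddMonoidHom.coe_coe, this, hF']
  · intro z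
    obtain ⟨w, rfl⟩ := hFb.2 z
    induction w using mtp_induction with
    | h0 => rw [map_zero]; exact zero_mem _
    | h1 m p => exact AddSubmonoid.subset_closure ⟨m, p, hF m p⟩
    | hadd x y hx hy => rw [map_add]; exact add_mem hx hy

/-- Linear maps on the enveloping algebra are determined on `P`-translates of coinvariants. -/
theorem env_ext {V : Type*} [AddCommGroup V] [Module k V] {D1 D2 : Env k P →ₗ[k] V}
    (h : ∀ X r, D1 (opR k r * ι X) = D2 (opR k r * ι X)) : D1 = D2 := by
  refine LinearMap.ext fun z => ?_
  induction E.exists_lift_and_span.2 z using AddSubmonoid.closure_induction with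
  | mem x hx => obtain ⟨X, r, rfl⟩ := hx; exact h X r
  | zero => simp
  | add x y _ _ hx hy => simp only [map_add, hx, hy]

end IsES

end Env

end HopfGalois

namespace HopfGalois

section Hat

open LinearMap (mul')
open Coalgebra (comul counit)

variable {k : Type u} [Field k] {H P : Type v} [Ring H] [HopfAlgebra k H] [Ring P] [Algebra k P]
  {ca : ComodAlg k H P}

/-- Extension of `u` to a right `P`-linear map `p ⊗ p' ↦ u(p) p'`. -/
noncomputable def hat : (P →ₗ[k] P) →ₗ[k] (Env k P →ₗ[k] P) where
  toFun u := mul' k P ∘ₗ map u (MulOpposite.opLinearEquiv k).symm.toLinearMap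
  map_add' u v := by ext; simp [add_mul]
  map_smul' c u := by ext; simp

@[simp] theorem hat_tmul (u : P →ₗ[k] P) (p : P) (q : Pᵐᵒᵖ) :
    hat u (p ⊗ₜ q) = u p * MulOpposite.unop q := rfl

theorem hat_opR_mul (u : P →ₗ[k] P) (r : P) (z : Env k P) : hat u (opR k r * z) = hat u z * r := by
  induction z using TensorProduct.induction_on with
  | zero => simp
  | add x y hx hy => simp only [mul_add, map_add, add_mul, hx, hy]
  | tmul p q => simp [mul_assoc]

/-- `(p ⊗ p', q ⊗ q') ↦ G(p ⊗ q) q' p'`. -/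
noncomputable def hatTwo (G : P ⊗[k] P →ₗ[k] P) : Env k P →ₗ[k] Env k P →ₗ[k] P :=
  (hat ∘ₗ (hat ∘ₗ curry G).flip).flip

theorem hatTwo_apply (G : P ⊗[k] P →ₗ[k] P) (a c : Env k P) :
    hatTwo G a c = hat ((hat ∘ₗ curry G).flip c) a := rfl

@[simp] theorem hatTwo_tmul (G : P ⊗[k] P →ₗ[k] P) (p : P) (p' : Pᵐᵒᵖ) (q : P) (q' : Pᵐᵒᵖ) :
    hatTwo G (p ⊗ₜ p') (q ⊗ₜ q') = G (p ⊗ₜ q) * MulOpposite.unop q' * MulOpposite.unop p' := rfl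

variable (f : P →ₗ[k] Env k P →ₗ[k] P)

theorem map₂_betaA_opR_mul (hf : ∀ p r c, f p (opR k r * c) = f p c * r) (w : P ⊗[k] H) (r : P)
    (c : Env k P) : map₂ f (LinearMap.mul k H) w (ca.betaA (opR k r * c)) =
      map₂ f (LinearMap.mul k H) w (ca.betaA c) * ca.ρ r := by
  rw [← envR_apply, betaA_envR]
  generalize ca.betaA c = z
  generalize ca.ρ r = y
  induction w using TensorProduct.induction_on with
  | zero => simp
  | add x y hx hy => simp only [map_add, LinearMap.add_apply, add_mul, hx, hy]
  | tmul p h =>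
    induction z using TensorProduct.induction_on with
    | zero => simp
    | add x y hx hy => simp only [map_add, add_mul, hx, hy]
    | tmul a h' =>
      induction y using TensorProduct.induction_on with
      | zero => simp
      | add x y hx hy => simp only [map_add, LinearMap.add_apply, mul_add, hx, hy]
      | tmul r' h'' => simp [hf, mul_assoc]

theorem map₂_tmul_one (w : P ⊗[k] H) (c : Env k P) :
    map₂ f (LinearMap.mul k H) w (c ⊗ₜ[k] (1 : H)) = (f.flip c).rTensor H w := by
  induction w using TensorProduct.induction_on with
  | zero => simp
  | add x y hx hy => simp only [map_add, LinearMap.add_apply, hx, hy]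
  | tmul p h => simp

theorem rho_eq_of_tmul_one (hf : ∀ p r c, f p (opR k r * c) = f p c * r) {g : Env k P →ₗ[k] P}
    (hg : ∀ r c, g (opR k r * c) = g c * r) (w : P ⊗[k] H)
    (h : ∀ q, ca.ρ (g (q ⊗ₜ 1)) = map₂ f (LinearMap.mul k H) w (ca.betaA (q ⊗ₜ 1))) (c : Env k P) :
    ca.ρ (g c) = map₂ f (LinearMap.mul k H) w (ca.betaA c) := by
  induction c using TensorProduct.induction_on with
  | zero => simp
  | add x y hx hy => simp only [map_add, hx, hy]
  | tmul q q' =>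
    have : (q ⊗ₜ q' : Env k P) = opR k (MulOpposite.unop q') * (q ⊗ₜ 1) := by simp
    rw [this, hg, ca.coact_mul, map₂_betaA_opR_mul f hf, h]

theorem betaA_tmul_one (q : P) : ca.betaA (q ⊗ₜ[k] (1 : Pᵐᵒᵖ)) =
    ((TensorProduct.mk k P Pᵐᵒᵖ).flip 1).rTensor H (ca.ρ q) := by
  rw [betaA_eq]
  simp only [LinearMap.comp_apply, LinearEquiv.coe_coe, congr_symm_tmul, tco, map_tmul]
  simp only [LinearEquiv.refl_symm, LinearEquiv.refl_apply, MulOpposite.coe_opLinearEquiv_symm,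
    MulOpposite.unop_one, ca.coact_one]
  generalize ca.ρ q = w
  induction w using TensorProduct.induction_on with
  | zero => simp
  | add x y hx hy => simp only [map_add, add_tmul, hx, hy]
  | tmul p h => simp [Algebra.TensorProduct.one_def]

theorem map₂_betaA_tmul_one (w : P ⊗[k] H) (q : P) :
    map₂ f (LinearMap.mul k H) w (ca.betaA (q ⊗ₜ[k] (1 : Pᵐᵒᵖ))) =
      map (lift f ∘ₗ ((TensorProduct.mk k P Pᵐᵒᵖ).flip 1).lTensor P) (mulCo k H).toLinearMap
        (tensorTensorTensorComm k P H P H (w ⊗ₜ ca.ρ q)) := by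
  rw [betaA_tmul_one]
  generalize ca.ρ q = z
  induction w using TensorProduct.induction_on with
  | zero => simp
  | add x y hx hy => simp only [map_add, LinearMap.add_apply, add_tmul, hx, hy]
  | tmul p h =>
    induction z using TensorProduct.induction_on with
    | zero => simp
    | add x y hx hy => simp only [map_add, tmul_add, hx, hy]
    | tmul a h' => simp

namespace IsES

variable {B0 L0 : Type v} [Ring B0] [Algebra k B0] [Ring L0] [Algebra k L0] {ιB : B0 →ₐ[k] P}
  {ι : L0 →ₐ[k] Env k P} {st : BgdST k B0 L0} {cop : L0 →ₗ[k] st.T2} {cou : L0 →ₗ[k] B0}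
  (E : IsES ca ιB ι st cop cou)

include E

theorem rho_iota (X : L0) : ca.betaA (ι X) = ι X ⊗ₜ[k] (1 : H) := (E.range _).2 ⟨X, rfl⟩

theorem rho_iotaB (b : B0) : ca.ρ (ιB b) = ιB b ⊗ₜ[k] (1 : H) := (E.rangeB _).2 ⟨b, rfl⟩

theorem central' {b : P} (hb : ca.ρ b = b ⊗ₜ[k] (1 : H)) (p : P) : p * b = b * p := by
  obtain ⟨b, rfl⟩ := (E.rangeB _).1 hb
  exact E.central b p

theorem rho_eq_of_iota (hf : ∀ p r c, f p (opR k r * c) = f p c * r) {g : Env k P →ₗ[k] P}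
    (hg : ∀ r c, g (opR k r * c) = g c * r) (w : P ⊗[k] H)
    (h : ∀ X, ca.ρ (g (ι X)) = (f.flip (ι X)).rTensor H w) (c : Env k P) :
    ca.ρ (g c) = map₂ f (LinearMap.mul k H) w (ca.betaA c) := by
  have : ca.ρ ∘ₗ g = map₂ f (LinearMap.mul k H) w ∘ₗ ca.betaA := by
    apply E.env_ext
    intro X r
    simp only [LinearMap.comp_apply]
    rw [hg, ca.coact_mul, map₂_betaA_opR_mul f hf, h, E.rho_iota, map₂_tmul_one]
  exact LinearMap.congr_fun this c

theorem exists_hat_eq (φ : L0 →ₗ[k] P) (hφ : ∀ b X, φ (st.t b * X) = φ X * ιB b) :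
    ∃ u : P →ₗ[k] P, ∀ X, hat u (ι X) = φ X := by
  obtain ⟨h, hh⟩ := E.exists_lift_and_span.1
    (Q := P)
    { toFun := fun X => (LinearMap.mulLeft k (φ X)).toAddMonoidHom
      map_zero' := by ext; simp
      map_add' := fun x y => by ext; simp [add_mul] }
    (fun b X r => by simp [hφ])
  have hh' : ∀ X r, h (opR k r * ι X) = φ X * r := hh
  have hr : ∀ z r, h (opR k r * z) = h z * r := by
    intro z r
    induction E.exists_lift_and_span.2 z using AddSubmonoid.closure_induction with
    | mem x hx =>
      obtain ⟨X, r', rfl⟩ := hx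
      have : opR k r * (opR k r' * ι X) = opR k (r' * r) * ι X := by
        rw [← mul_assoc]
        simp
        rfl
      rw [this, hh', hh', mul_assoc]
    | zero => simp
    | add x y _ _ hx hy => simp only [mul_add, add_mul, map_add, hx, hy]
  have hk : ∀ z (c : k), h (c • z) = c • h z := by
    intro z c
    induction E.exists_lift_and_span.2 z using AddSubmonoid.closure_induction with
    | mem x hx =>
      obtain ⟨X, r', rfl⟩ := hx
      rw [← mul_smul_comm, ← map_smul, hh', hh', map_smul, smul_mul_assoc]
    | zero => simp
    | add x y _ _ hx hy => simp only [smul_add, map_add, hx, hy]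
  let h' : Env k P →ₗ[k] P := { h with map_smul' := fun c z => hk z c }
  refine ⟨h' ∘ₗ (TensorProduct.mk k P Pᵐᵒᵖ).flip 1, fun X => ?_⟩
  have : hat (h' ∘ₗ (TensorProduct.mk k P Pᵐᵒᵖ).flip 1) = h' := by
    refine TensorProduct.ext' fun p q => ?_
    rw [hat_tmul]
    change h (p ⊗ₜ 1) * _ = h (p ⊗ₜ q)
    rw [← hr]
    simp
  rw [this]
  change h (ι X) = φ X
  have := hh' X 1
  rwa [mul_one, show opR k (1 : P) = 1 from rfl, one_mul] at this

theorem hat_inj {u v : P →ₗ[k] P} (h : ∀ X, hat u (ι X) = hat v (ι X)) : u = v := by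
  have : hat u = hat v := E.env_ext fun X r => by rw [hat_opR_mul, hat_opR_mul, h]
  ext p
  simpa using LinearMap.congr_fun this (p ⊗ₜ 1)

theorem hatTwo_inj {G G' : P ⊗[k] P →ₗ[k] P}
    (h : ∀ X Y, hatTwo G (ι X) (ι Y) = hatTwo G' (ι X) (ι Y)) : G = G' := by
  have h1 : ∀ Y, (hat ∘ₗ curry G).flip (ι Y) = (hat ∘ₗ curry G').flip (ι Y) :=
    fun Y => E.hat_inj fun X => h X Y
  refine TensorProduct.ext (LinearMap.ext fun p => ?_)
  exact E.hat_inj fun Y => LinearMap.congr_fun (h1 Y) p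

theorem exists_iotaB_hat_iff (u : P →ₗ[k] P) : (∀ X, ∃ b, ιB b = hat u (ι X)) ↔
    ca.ρ ∘ₗ u = map u (CoalgHom.id k H).toLinearMap ∘ₗ ca.ρ := by
  let f : P →ₗ[k] Env k P →ₗ[k] P := (LinearMap.mul k P).compl₂ (hat u)
  have hf : ∀ p r c, f p (opR k r * c) = f p c * r := fun p r c => by
    simp [f, hat_opR_mul, mul_assoc]
  have hw : ∀ q, map₂ f (LinearMap.mul k H) ((1 : P) ⊗ₜ[k] (1 : H)) (ca.betaA (q ⊗ₜ 1)) =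
      map u (CoalgHom.id k H).toLinearMap (ca.ρ q) := by
    intro q
    rw [map₂_betaA_tmul_one]
    generalize ca.ρ q = z
    induction z using TensorProduct.induction_on with
    | zero => simp
    | add x y hx hy => simp only [map_add, tmul_add, hx, hy]
    | tmul a h' => simp [f]
  have hX : ∀ X, (f.flip (ι X)).rTensor H ((1 : P) ⊗ₜ[k] (1 : H)) = hat u (ι X) ⊗ₜ (1 : H) := by
    intro X; simp [f]
  simp_rw [← E.rangeB]
  constructor
  · intro h
    ext q
    have := E.rho_eq_of_iota f hf (hat_opR_mul u) _ (fun X => (h X).trans (hX X).symm) (q ⊗ₜ 1)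
    rw [hw] at this
    simpa using this
  · intro h X
    have := rho_eq_of_tmul_one f hf (hat_opR_mul u) ((1 : P) ⊗ₜ[k] (1 : H)) (fun q => by
      rw [hw]
      simpa using LinearMap.congr_fun h q) (ι X)
    rw [this, E.rho_iota, map₂_tmul_one, hX]

theorem exists_iotaB_hatTwo_iff (G : P ⊗[k] P →ₗ[k] P) :
    (∀ X Y, ∃ b, ιB b = hatTwo G (ι X) (ι Y)) ↔
    ca.ρ ∘ₗ G = map G (mulCo k H).toLinearMap ∘ₗ rhoTwo ca := by
  let f : P →ₗ[k] Env k P →ₗ[k] P := hat ∘ₗ curry G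
  have hf : ∀ p r c, f p (opR k r * c) = f p c * r := fun p r c => hat_opR_mul _ _ _
  have hw : ∀ p q, map₂ f (LinearMap.mul k H) (ca.ρ p) (ca.betaA (q ⊗ₜ 1)) =
      map G (mulCo k H).toLinearMap (rhoTwo ca (p ⊗ₜ q)) := by
    intro p q
    rw [map₂_betaA_tmul_one]
    simp only [tco, LinearMap.comp_apply, map_tmul, LinearEquiv.coe_coe]
    congr 2
    refine TensorProduct.ext' fun a b => ?_
    simp [f]
  have key : (∀ X Y, ∃ b, ιB b = hatTwo G (ι X) (ι Y)) ↔
      ∀ Y p, ca.ρ (f p (ι Y)) = (f.flip (ι Y)).rTensor H (ca.ρ p) := by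
    rw [forall_comm]
    refine forall_congr' fun Y => (E.exists_iotaB_hat_iff (f.flip (ι Y))).trans ?_
    exact ⟨fun h p => LinearMap.congr_fun h p, fun h => LinearMap.ext h⟩
  rw [key]
  constructor
  · intro h
    refine TensorProduct.ext' fun p q => ?_
    have := E.rho_eq_of_iota f hf (g := f p) (hf p) _ (fun X => h X p) (q ⊗ₜ 1)
    rw [hw] at this
    simpa [f] using this
  · intro h Y p
    have := rho_eq_of_tmul_one f hf (g := f p) (hf p) (ca.ρ p) (fun q => by
      rw [hw]
      simpa [f] using LinearMap.congr_fun h (p ⊗ₜ q)) (ι Y)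
    rw [this, E.rho_iota, map₂_tmul_one]

end IsES
end Hat
end HopfGalois

namespace HopfGalois

section Correspondence

open LinearMap (mul')
open Coalgebra (comul counit)

variable {k : Type u} [Field k] {H P : Type v} [Ring H] [HopfAlgebra k H] [Ring P] [Algebra k P]
  {ca : ComodAlg k H P}

theorem hat_tmul_one_mul (u : P →ₗ[k] P) (b : P) (z : Env k P) :
    hat u ((b ⊗ₜ MulOpposite.op (1 : P)) * z) = hat (u ∘ₗ LinearMap.mulLeft k b) z := by
  induction z using TensorProduct.induction_on with
  | zero => simp
  | add x y hx hy => simp only [mul_add, map_add, hx, hy]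
  | tmul p q => simp

theorem hat_mul_tmul_one (u : P →ₗ[k] P) (b : P) (z : Env k P) :
    hat u (z * (b ⊗ₜ MulOpposite.op (1 : P))) = hat (u ∘ₗ LinearMap.mulRight k b) z := by
  induction z using TensorProduct.induction_on with
  | zero => simp
  | add x y hx hy => simp only [add_mul, map_add, hx, hy]
  | tmul p q => simp

theorem hat_mul_opR (u : P →ₗ[k] P) (b : P) (z : Env k P) :
    hat u (z * opR k b) = hat (LinearMap.mulRight k b ∘ₗ u) z := by
  induction z using TensorProduct.induction_on with
  | zero => simp
  | add x y hx hy => simp only [add_mul, map_add, hx, hy]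
  | tmul p q => simp [mul_assoc]

theorem hat_mulLeft_comp (u : P →ₗ[k] P) (b : P) (z : Env k P) :
    hat (LinearMap.mulLeft k b ∘ₗ u) z = b * hat u z := by
  induction z using TensorProduct.induction_on with
  | zero => simp
  | add x y hx hy => simp only [mul_add, map_add, hx, hy]
  | tmul p q => simp [mul_assoc]

theorem ract_id_mulLeft_comp {b : P} (hb : ∀ p : P, p * b = b * p) (f : H →ₗ[k] P) :
    ract ca.ρ LinearMap.id (LinearMap.mulLeft k b ∘ₗ f) =
      LinearMap.mulLeft k b ∘ₗ ract ca.ρ LinearMap.id f := by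
  ext p
  simp only [ract, LinearMap.comp_apply]
  generalize ca.ρ p = w
  induction w using TensorProduct.induction_on with
  | zero => simp
  | add x y hx hy => simp only [map_add, hx, hy]
  | tmul a h => simp [← mul_assoc, hb]

theorem hatTwo_mulLeft_comp (G : P ⊗[k] P →ₗ[k] P) (b : P) (X Y : Env k P) :
    hatTwo (LinearMap.mulLeft k b ∘ₗ G) X Y = b * hatTwo G X Y := by
  induction X using TensorProduct.induction_on with
  | zero => simp
  | add x y hx hy => simp only [mul_add, map_add, LinearMap.add_apply, hx, hy]
  | tmul p p' =>
    induction Y using TensorProduct.induction_on with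
    | zero => simp
    | add x y hx hy => simp only [mul_add, map_add, hx, hy]
    | tmul q q' => simp [mul_assoc]

theorem hatTwo_tmul_one_mul_left (G : P ⊗[k] P →ₗ[k] P) (b : P) (X Y : Env k P) :
    hatTwo G ((b ⊗ₜ MulOpposite.op (1 : P)) * X) Y =
      hatTwo (G ∘ₗ map (LinearMap.mulLeft k b) LinearMap.id) X Y := by
  rw [hatTwo_apply, hat_tmul_one_mul, hatTwo_apply]
  rfl

theorem hatTwo_mul_tmul_one_left (G : P ⊗[k] P →ₗ[k] P) (b : P) (X Y : Env k P) :
    hatTwo G (X * (b ⊗ₜ MulOpposite.op (1 : P))) Y =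
      hatTwo (G ∘ₗ map (LinearMap.mulRight k b) LinearMap.id) X Y := by
  rw [hatTwo_apply, hat_mul_tmul_one, hatTwo_apply]
  rfl

theorem hatTwo_tmul_one_mul_right (G : P ⊗[k] P →ₗ[k] P) (b : P) (X Y : Env k P) :
    hatTwo G X ((b ⊗ₜ MulOpposite.op (1 : P)) * Y) =
      hatTwo (G ∘ₗ map LinearMap.id (LinearMap.mulLeft k b)) X Y := by
  induction X using TensorProduct.induction_on with
  | zero => simp
  | add x y hx hy => simp only [map_add, LinearMap.add_apply, hx, hy]
  | tmul p p' =>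
    induction Y using TensorProduct.induction_on with
    | zero => simp
    | add x y hx hy => simp only [mul_add, map_add, hx, hy]
    | tmul q q' => simp

/-- The partial pairing `h ↦ q₀ φ(h ⊗ q₁) q'` of a map on `H ⊗ H` with `q ⊗ q'`. -/
noncomputable def omega (ca : ComodAlg k H P) (φ : H ⊗[k] H →ₗ[k] P) (c : Env k P) : H →ₗ[k] P :=
  hat.flip c ∘ₗ ractL ca.ρ LinearMap.id ∘ₗ curry φ

theorem omega_apply (φ : H ⊗[k] H →ₗ[k] P) (c : Env k P) (h : H) :
    omega ca φ c h = hat (ract ca.ρ LinearMap.id (curry φ h)) c := rfl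

theorem hatTwo_ract (φ : H ⊗[k] H →ₗ[k] P) (a c : Env k P) :
    hatTwo (ract (rhoTwo ca) (muTwo k P) φ) a c = hat (ract ca.ρ LinearMap.id (omega ca φ c)) a := by
  rw [hatTwo_apply]
  congr 2
  ext p
  induction c using TensorProduct.induction_on with
  | zero => simp [omega, ract]
  | add x y hx hy =>
    rw [map_add, LinearMap.add_apply, hx, hy, show omega ca φ (x + y) = omega ca φ x + omega ca φ y by
      ext; simp [omega]]
    simp [ract, map_add_right]
  | tmul q q' =>
    simp only [LinearMap.flip_apply, LinearMap.comp_apply, hat_tmul, curry_apply]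
    rw [ract_rhoTwo_tmul]
    simp only [ract, LinearMap.comp_apply]
    generalize ca.ρ p = w
    induction w using TensorProduct.induction_on with
    | zero => simp
    | add x y hx hy => simp only [map_add, add_mul, hx, hy]
    | tmul a h => simp [omega, mul_assoc]

namespace IsES

variable {B0 L0 : Type v} [Ring B0] [Algebra k B0] [Ring L0] [Algebra k L0] {ιB : B0 →ₐ[k] P}
  {ι : L0 →ₐ[k] Env k P} {st : BgdST k B0 L0} {cop : L0 →ₗ[k] st.T2} {cou : L0 →ₗ[k] B0}
  (E : IsES ca ιB ι st cop cou)

include E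

theorem hat_ract_iota_s_mul (f : H →ₗ[k] P) (b : B0) (X : L0) :
    hat (ract ca.ρ LinearMap.id f) (ι (st.s b * X)) =
      ιB b * hat (ract ca.ρ LinearMap.id f) (ι X) := by
  rw [map_mul, E.map_s, hat_tmul_one_mul, ← hat_mulLeft_comp]
  congr 2
  ext p
  exact ract_id_mul f (E.rho_iotaB b) p

theorem hat_iota_t_mul (u : P →ₗ[k] P) (b : B0) (X : L0) :
    hat u (ι (st.t b * X)) = hat u (ι X) * ιB b := by
  rw [map_mul, E.map_t]
  exact hat_opR_mul _ _ _

theorem hat_ract_iota_mul_s (f : H →ₗ[k] P) (b : B0) (X : L0) :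
    hat (ract ca.ρ LinearMap.id f) (ι (X * st.s b)) =
      ιB b * hat (ract ca.ρ LinearMap.id f) (ι X) := by
  rw [map_mul, E.map_s, hat_mul_tmul_one, ← hat_mulLeft_comp]
  congr 2
  ext p
  simp only [LinearMap.comp_apply, LinearMap.mulRight_apply, LinearMap.mulLeft_apply]
  rw [E.central, ract_id_mul f (E.rho_iotaB b) p]

theorem hat_iota_mul_t (u : P →ₗ[k] P) (b : B0) (X : L0) :
    hat u (ι (X * st.t b)) = ιB b * hat u (ι X) := by
  rw [map_mul, E.map_t, ← hat_mulLeft_comp]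
  refine (hat_mul_opR _ _ _).trans ?_
  congr 2
  ext p
  exact E.central _ _

/-- `B`-bimodule maps out of the bialgebroid correspond to maps `H → P`. -/
theorem exists_hat_ract_eq {U : L0 →ₗ[k] B0} (hU : st.IsBimodMap U) :
    ∃ f : H →ₗ[k] P, ∀ X, ιB (U X) = hat (ract ca.ρ LinearMap.id f) (ι X) := by
  obtain ⟨u, hu⟩ := E.exists_hat_eq (ιB.toLinearMap ∘ₗ U) (fun b X => by simp [hU.1])
  have hmul : ∀ b p, ca.ρ b = b ⊗ₜ[k] (1 : H) → u (b * p) = b * u p := by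
    intro b p hb
    obtain ⟨b, rfl⟩ := (E.rangeB _).1 hb
    have : u ∘ₗ LinearMap.mulLeft k (ιB b) = LinearMap.mulLeft k (ιB b) ∘ₗ u := by
      apply E.hat_inj
      intro X
      rw [hat_mulLeft_comp, ← hat_tmul_one_mul, ← E.map_s, ← map_mul, hu, hu]
      simp [hU.2]
    exact LinearMap.congr_fun this p
  obtain ⟨f, hf⟩ := exists_ract_eq E.gal u hmul
  exact ⟨f, fun X => by rw [hf, hu]; rfl⟩

theorem isCol_id_of_hat {U : L0 → B0} {f : H →ₗ[k] P}
    (h : ∀ X, ιB (U X) = hat (ract ca.ρ LinearMap.id f) (ι X)) : IsCol ca (CoalgHom.id k H) f :=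
  (isCol_id_iff E.gal f).2 ((E.exists_iotaB_hat_iff _).1 fun X => ⟨_, h X⟩)

theorem exists_of_isCol_id {f : H →ₗ[k] P} (hf : IsCol ca (CoalgHom.id k H) f) :
    ∃ U : L0 →ₗ[k] B0, ∀ X, ιB (U X) = hat (ract ca.ρ LinearMap.id f) (ι X) :=
  exists_factor ιB.toLinearMap E.injB (hat (ract ca.ρ LinearMap.id f) ∘ₗ ι.toLinearMap)
    ((E.exists_iotaB_hat_iff _).2 ((isCol_id_iff E.gal f).1 hf))

theorem isBimodMap_of_hat {U : L0 →ₗ[k] B0} {f : H →ₗ[k] P}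
    (h : ∀ X, ιB (U X) = hat (ract ca.ρ LinearMap.id f) (ι X)) : st.IsBimodMap U :=
  ⟨fun b X => E.injB (by rw [h, map_mul ιB, h, E.hat_iota_t_mul]),
    fun b X => E.injB (by rw [h, map_mul ιB, h, E.hat_ract_iota_s_mul])⟩

theorem mul_s_eq_mul_t_of_hat {U : L0 → B0} {f : H →ₗ[k] P}
    (h : ∀ X, ιB (U X) = hat (ract ca.ρ LinearMap.id f) (ι X)) (b : B0) (X : L0) :
    U (X * st.s b) = U (X * st.t b) :=
  E.injB (by rw [h, h, E.hat_ract_iota_mul_s, E.hat_iota_mul_t])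

theorem hat_ract_inj {f g : H →ₗ[k] P} (h : ∀ X, hat (ract ca.ρ LinearMap.id f) (ι X) =
    hat (ract ca.ρ LinearMap.id g) (ι X)) : f = g :=
  (cancels_id E.gal).eq (E.hat_inj h)

theorem hatTwo_ract_inj {φ ψ : H ⊗[k] H →ₗ[k] P}
    (h : ∀ X Y, hatTwo (ract (rhoTwo ca) (muTwo k P) φ) (ι X) (ι Y) =
      hatTwo (ract (rhoTwo ca) (muTwo k P) ψ) (ι X) (ι Y)) : φ = ψ :=
  (cancels_muTwo E.gal).eq (E.hatTwo_inj h)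

theorem exists_hatTwo_eq (Γ : L0 →ₗ[k] L0 →ₗ[k] P)
    (h1 : ∀ b X Y, Γ (st.t b * X) Y = Γ X Y * ιB b)
    (h2 : ∀ b X Y, Γ X (st.t b * Y) = Γ (X * st.t b) Y) :
    ∃ G : P ⊗[k] P →ₗ[k] P, ∀ X Y, hatTwo G (ι X) (ι Y) = Γ X Y := by
  let T : (P →ₗ[k] P) →ₗ[k] (L0 →ₗ[k] P) := LinearMap.lcomp k P ι.toLinearMap ∘ₗ hat
  have hT : Function.Injective T := fun u v h => E.hat_inj fun X => LinearMap.congr_fun h X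
  obtain ⟨ψ, hψ⟩ := exists_factor T hT Γ.flip fun Y => by
    obtain ⟨u, hu⟩ := E.exists_hat_eq (Γ.flip Y) (fun b X => h1 b X Y)
    exact ⟨u, LinearMap.ext hu⟩
  have hψ' : ∀ X Y, hat (ψ Y) (ι X) = Γ X Y := fun X Y => LinearMap.congr_fun (hψ Y) X
  obtain ⟨χ, hχ⟩ := exists_factor T hT ψ.flip fun p => by
    obtain ⟨u, hu⟩ := E.exists_hat_eq (ψ.flip p) (fun b Y => by
      have : ψ (st.t b * Y) = LinearMap.mulLeft k (ιB b) ∘ₗ ψ Y := by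
        apply E.hat_inj
        intro X
        rw [hat_mulLeft_comp, hψ', h2, ← hψ', E.hat_iota_mul_t]
      simp [this, E.central])
    exact ⟨u, LinearMap.ext hu⟩
  refine ⟨lift χ, fun X Y => ?_⟩
  rw [hatTwo_apply, ← hψ']
  congr 2
  ext p
  exact LinearMap.congr_fun (hχ p) Y

theorem omega_iota_s_mul (φ : H ⊗[k] H →ₗ[k] P) (b : B0) (Y : L0) :
    omega ca φ (ι (st.s b * Y)) = LinearMap.mulLeft k (ιB b) ∘ₗ omega ca φ (ι Y) := by
  ext h
  simp only [omega_apply, LinearMap.comp_apply, E.hat_ract_iota_s_mul, LinearMap.mulLeft_apply]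

theorem omega_iota_t_mul (φ : H ⊗[k] H →ₗ[k] P) (b : B0) (Y : L0) :
    omega ca φ (ι (st.t b * Y)) = LinearMap.mulLeft k (ιB b) ∘ₗ omega ca φ (ι Y) := by
  ext h
  simp only [omega_apply, LinearMap.comp_apply, E.hat_iota_t_mul, LinearMap.mulLeft_apply, E.central]

theorem omega_iota_mul_s (φ : H ⊗[k] H →ₗ[k] P) (b : B0) (Y : L0) :
    omega ca φ (ι (Y * st.s b)) = omega ca φ (ι (Y * st.t b)) := by
  ext h
  simp only [omega_apply, E.hat_ract_iota_mul_s, E.hat_iota_mul_t]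

theorem hat_ract_mulLeft_comp (f : H →ₗ[k] P) (b : B0) (a : Env k P) :
    hat (ract ca.ρ LinearMap.id (LinearMap.mulLeft k (ιB b) ∘ₗ f)) a =
      ιB b * hat (ract ca.ρ LinearMap.id f) a := by
  rw [ract_id_mulLeft_comp (E.central b), hat_mulLeft_comp]

/-- Bilinear bimodule maps on the bialgebroid correspond to maps `H ⊗ H → P`. -/
theorem exists_hatTwo_ract_eq {Γ : L0 → L0 → B0} (hΓ : st.IsBihom Γ) :
    ∃ φ : H ⊗[k] H →ₗ[k] P, ∀ X Y,
      ιB (Γ X Y) = hatTwo (ract (rhoTwo ca) (muTwo k P) φ) (ι X) (ι Y) := by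
  obtain ⟨⟨Γ', hΓ'⟩, hl, hm⟩ := hΓ
  have hs1 : ∀ b X Y, Γ (st.s b * X) Y = b * Γ X Y := fun b X Y => by
    simpa [st.t_one] using hl b 1 X Y
  have ht1 : ∀ b X Y, Γ (st.t b * X) Y = Γ X Y * b := fun b X Y => by
    simpa using hl 1 b X Y
  have hs2 : ∀ b X Y, Γ (X * st.s b) Y = Γ X (st.s b * Y) := fun b X Y => by
    simpa [st.t_one] using hm b 1 X Y
  have ht2 : ∀ b X Y, Γ (X * st.t b) Y = Γ X (st.t b * Y) := fun b X Y => by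
    simpa using hm 1 b X Y
  obtain ⟨G, hG⟩ := E.exists_hatTwo_eq (Γ'.compr₂ ιB.toLinearMap)
    (fun b X Y => by simp [hΓ', ht1]) (fun b X Y => by simp [hΓ', ht2])
  have hG' : ∀ X Y, hatTwo G (ι X) (ι Y) = ιB (Γ X Y) := fun X Y => by
    rw [hG, ← hΓ']; rfl
  have key : ∀ b, G ∘ₗ map (LinearMap.mulLeft k (ιB b)) LinearMap.id =
      LinearMap.mulLeft k (ιB b) ∘ₗ G := fun b => by
    apply E.hatTwo_inj
    intro X Y
    rw [hatTwo_mulLeft_comp, ← hatTwo_tmul_one_mul_left, ← E.map_s, ← map_mul, hG', hG', hs1,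
      map_mul]
  have key2 : ∀ b, G ∘ₗ map LinearMap.id (LinearMap.mulLeft k (ιB b)) =
      LinearMap.mulLeft k (ιB b) ∘ₗ G := fun b => by
    rw [← key]
    apply E.hatTwo_inj
    intro X Y
    have : (LinearMap.mulLeft k (ιB b) : P →ₗ[k] P) = LinearMap.mulRight k (ιB b) := by
      ext p; exact (E.central b p).symm
    rw [← hatTwo_tmul_one_mul_right, this, ← hatTwo_mul_tmul_one_left, ← E.map_s, ← map_mul,
      ← map_mul, hG', hG', hs2]
  obtain ⟨φ, hφ⟩ := exists_ract_rhoTwo_eq E.gal G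
    (fun b p q hb => by
      obtain ⟨b, rfl⟩ := (E.rangeB _).1 hb
      exact LinearMap.congr_fun (key b) (p ⊗ₜ q))
    (fun b p q hb => by
      obtain ⟨b, rfl⟩ := (E.rangeB _).1 hb
      exact LinearMap.congr_fun (key2 b) (p ⊗ₜ q))
    (fun b p hb => E.central' hb p)
  exact ⟨φ, fun X Y => by rw [hφ, hG']⟩

theorem isCol_mulCo_of_hatTwo {Γ : L0 → L0 → B0} {φ : H ⊗[k] H →ₗ[k] P}
    (h : ∀ X Y, ιB (Γ X Y) = hatTwo (ract (rhoTwo ca) (muTwo k P) φ) (ι X) (ι Y)) :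
    IsCol ca (mulCo k H) φ :=
  (isCol_mulCo_iff E.gal φ).2 ((E.exists_iotaB_hatTwo_iff _).1 fun X Y => ⟨_, h X Y⟩)

theorem exists_of_isCol_mulCo {φ : H ⊗[k] H →ₗ[k] P} (hφ : IsCol ca (mulCo k H) φ) :
    ∃ Γ : L0 →ₗ[k] L0 →ₗ[k] B0, ∀ X Y,
      ιB (Γ X Y) = hatTwo (ract (rhoTwo ca) (muTwo k P) φ) (ι X) (ι Y) := by
  let T : (L0 →ₗ[k] B0) →ₗ[k] (L0 →ₗ[k] P) := LinearMap.compRight k ιB.toLinearMap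
  have hT : Function.Injective T := fun u v h =>
    LinearMap.ext fun X => E.injB (LinearMap.congr_fun h X)
  obtain ⟨Γ, hΓ⟩ := exists_factor T hT
    ((hatTwo (ract (rhoTwo ca) (muTwo k P) φ)).compl₁₂ ι.toLinearMap ι.toLinearMap) fun X => by
      obtain ⟨w, hw⟩ := exists_factor ιB.toLinearMap E.injB
        (hatTwo (ract (rhoTwo ca) (muTwo k P) φ) (ι X) ∘ₗ ι.toLinearMap)
        ((E.exists_iotaB_hatTwo_iff _).2 ((isCol_mulCo_iff E.gal φ).1 hφ) X)
      exact ⟨w, LinearMap.ext hw⟩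
  exact ⟨Γ, fun X Y => LinearMap.congr_fun (hΓ X) Y⟩

theorem isBihom_of_hatTwo {Γ : L0 → L0 → B0} {φ : H ⊗[k] H →ₗ[k] P}
    (h : ∀ X Y, ιB (Γ X Y) = hatTwo (ract (rhoTwo ca) (muTwo k P) φ) (ι X) (ι Y)) :
    st.IsBihom Γ := by
  refine ⟨?_, fun b c X Y => E.injB ?_, fun b c X Y => E.injB ?_⟩
  · obtain ⟨Γ', hΓ'⟩ := E.exists_of_isCol_mulCo (E.isCol_mulCo_of_hatTwo h)
    exact ⟨Γ', fun X Y => E.injB (by rw [h, hΓ'])⟩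
  · simp only [h, hatTwo_ract, map_mul ιB, E.hat_ract_iota_s_mul, E.hat_iota_t_mul, mul_assoc]
  · simp only [h, hatTwo_ract, E.hat_ract_iota_mul_s, E.hat_iota_mul_t, E.omega_iota_s_mul,
      E.omega_iota_t_mul, E.hat_ract_mulLeft_comp]
    rw [← mul_assoc, ← mul_assoc, E.central]

theorem st_indep_of_hatTwo {Γ : L0 → L0 → B0} {φ : H ⊗[k] H →ₗ[k] P}
    (h : ∀ X Y, ιB (Γ X Y) = hatTwo (ract (rhoTwo ca) (muTwo k P) φ) (ι X) (ι Y)) (b : B0)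
    (X Y : L0) : Γ X (Y * st.s b) = Γ X (Y * st.t b) :=
  E.injB (by simp only [h, hatTwo_ract, E.omega_iota_mul_s])

end IsES
end Correspondence
end HopfGalois

namespace HopfGalois

section Coproduct

open LinearMap (mul')
open Coalgebra (comul counit)

variable {k : Type u} [Field k] {H P : Type v} [Ring H] [HopfAlgebra k H] [Ring P] [Algebra k P]

theorem cv_mulRight_comp {C A : Type*} [AddCommGroup C] [Module k C] [Coalgebra k C] [Ring A]
    [Algebra k A] (a : A) (F G : C →ₗ[k] A) :
    cv (LinearMap.mulRight k a ∘ₗ F) G = cv F (LinearMap.mulLeft k a ∘ₗ G) := by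
  ext c
  simp only [cv, LinearMap.comp_apply]
  generalize comul (R := k) c = w
  induction w using TensorProduct.induction_on with
  | zero => simp
  | add x y hx hy => simp only [map_add, hx, hy]
  | tmul a h => simp [mul_assoc]

variable (k P) in
/-- The left inclusion of `P` into `P ⊗ Pᵒᵖ`. -/
abbrev inlA : P →ₐ[k] Env k P := Algebra.TensorProduct.includeLeft

theorem inlA_mul_opR (a b : P) : inlA k P a * opR k b = opR k b * inlA k P a := by simp

/-- `p ⊗ p' ↦ (1 ⊗ p') T(p)`. -/
noncomputable def hatA : (P →ₗ[k] Env k P) →ₗ[k] (Env k P →ₗ[k] Env k P) where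
  toFun T := lift ((LinearMap.mul k (Env k P)).flip.compl₁₂ T
    (Algebra.TensorProduct.includeRight : Pᵐᵒᵖ →ₐ[k] Env k P).toLinearMap)
  map_add' u v := TensorProduct.ext' fun p q => by simp
  map_smul' c u := TensorProduct.ext' fun p q => by simp

@[simp] theorem hatA_tmul (T : P →ₗ[k] Env k P) (p : P) (q : Pᵐᵒᵖ) :
    hatA T (p ⊗ₜ q) = opR k (MulOpposite.unop q) * T p := rfl

theorem mulA_tmul (p : P) (q : Pᵐᵒᵖ) :
    ComodAlg.mulA (p ⊗ₜ[k] q : Env k P) = p * MulOpposite.unop q := by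
  rw [ComodAlg.mulA, tlift_eq (hat (k := k) (P := P) LinearMap.id)]
  · rfl
  · intro x y; rfl

theorem mulA_eq : (ComodAlg.mulA : Env k P →ₗ[k] P) = hat LinearMap.id :=
  TensorProduct.ext' fun p q => mulA_tmul p q

theorem mulA_inlA_mul (p : P) (z : Env k P) :
    ComodAlg.mulA (inlA k P p * z) = p * ComodAlg.mulA z := by
  induction z using TensorProduct.induction_on with
  | zero => simp
  | add x y hx hy => simp only [mul_add, map_add, hx, hy]
  | tmul a b => simp [mulA_tmul, mul_assoc]

theorem mulA_hatA (u : P →ₗ[k] P) (z : Env k P) :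
    ComodAlg.mulA (hatA ((inlA k P).toLinearMap ∘ₗ u) z) = hat u z := by
  induction z using TensorProduct.induction_on with
  | zero => simp
  | add x y hx hy => simp only [map_add, hx, hy]
  | tmul a b => simp [mulA_tmul]

theorem hatA_inlA (z : Env k P) : hatA (inlA k P).toLinearMap z = z := by
  induction z using TensorProduct.induction_on with
  | zero => simp
  | add x y hx hy => simp only [map_add, hx, hy]
  | tmul a b => simp

theorem cv_inlA_comp {C : Type*} [AddCommGroup C] [Module k C] [Coalgebra k C] (f : C →ₗ[k] P)
    (F : C →ₗ[k] Env k P) : cv ((inlA k P).toLinearMap ∘ₗ f)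
      ((inlA k P).toLinearMap ∘ₗ ComodAlg.mulA ∘ₗ F) =
    (inlA k P).toLinearMap ∘ₗ ComodAlg.mulA ∘ₗ cv ((inlA k P).toLinearMap ∘ₗ f) F := by
  ext c
  simp only [cv, LinearMap.comp_apply]
  generalize comul (R := k) c = w
  induction w using TensorProduct.induction_on with
  | zero => simp
  | add x y hx hy => simp only [map_add, hx, hy]
  | tmul a h =>
    simp only [map_tmul, LinearMap.mul'_apply, LinearMap.comp_apply, AlgHom.toLinearMap_apply,
      mulA_inlA_mul, map_mul]

variable {ca : ComodAlg k H P}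

theorem esDeltaEval_eq (hGal : ca.IsGalois) {V : Type*} [AddCommGroup V] [Module k V]
    {F : Env k P → Env k P → V} (Φ : P → P → (P ⊗[k] H →ₗ[k] V))
    (hΦ : ∀ p a b q, F (p ⊗ₜ MulOpposite.op a) (b ⊗ₜ q) =
      Φ (MulOpposite.unop q) p (ca.chi (Submodule.Quotient.mk (a ⊗ₜ b))))
    (R' : P → P ⊗[k] H →ₗ[k] V) (hR' : ∀ q p h, Φ q p (1 ⊗ₜ h) = R' q (p ⊗ₜ h))
    (R : Env k P →ₗ[k] V) (hR : ∀ p q, R (p ⊗ₜ q) = R' (MulOpposite.unop q) (ca.ρ p)) :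
    ca.esDeltaEval F = R := by
  rw [ComodAlg.esDeltaEval]
  refine tlift_eq R fun p q => ?_
  rw [hR, tlift_eq (R' (MulOpposite.unop q))]
  intro p0 p1
  rw [qtlift_eq (Φ (MulOpposite.unop q) p0 ∘ₗ ca.chi)]
  · rw [LinearMap.comp_apply, ComodAlg.tau, Function.rightInverse_invFun hGal.2, hR']
  · intro a b
    rw [hΦ, LinearMap.comp_apply]

theorem ract_inlA_mul (β : H →ₗ[k] Env k P) {b : P} (hb : ca.ρ b = b ⊗ₜ[k] (1 : H)) (p : P) :
    ract ca.ρ (inlA k P).toLinearMap β (b * p) =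
      inlA k P b * ract ca.ρ (inlA k P).toLinearMap β p := by
  simp only [ract, LinearMap.comp_apply, ca.coact_mul, hb]
  generalize ca.ρ p = w
  induction w using TensorProduct.induction_on with
  | zero => simp
  | add x y hx hy => simp only [map_add, mul_add, hx, hy]
  | tmul a h => simp [← mul_assoc]

theorem hatA_ract_mul (β : H →ₗ[k] Env k P) {b : P} (hb : ca.ρ b = b ⊗ₜ[k] (1 : H)) (z : Env k P) :
    hatA (ract ca.ρ (inlA k P).toLinearMap β) ((b ⊗ₜ MulOpposite.op (1 : P)) * z) =
      inlA k P b * hatA (ract ca.ρ (inlA k P).toLinearMap β) z := by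
  induction z using TensorProduct.induction_on with
  | zero => simp
  | add x y hx hy => simp only [map_add, mul_add, hx, hy]
  | tmul p q =>
    rw [Algebra.TensorProduct.tmul_mul_tmul, hatA_tmul, hatA_tmul, ract_inlA_mul β hb, ← mul_assoc,
      ← inlA_mul_opR, mul_assoc]
    simp

theorem esDeltaEval_hat_hatA (hGal : ca.IsGalois) (u : P →ₗ[k] P) (β : H →ₗ[k] Env k P) :
    ca.esDeltaEval (fun x y => inlA k P (hat u x) *
      hatA (ract ca.ρ (inlA k P).toLinearMap β) y) =
    hatA (ract ca.ρ ((inlA k P).toLinearMap ∘ₗ u) β) := by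
  refine esDeltaEval_eq hGal
    (fun q p => LinearMap.mulLeft k (opR k q * inlA k P (u p)) ∘ₗ
      mul' k (Env k P) ∘ₗ map (inlA k P).toLinearMap β) (fun p a b q => ?_)
    (fun q => LinearMap.mulLeft k (opR k q) ∘ₗ mul' k (Env k P) ∘ₗ
      map ((inlA k P).toLinearMap ∘ₗ u) β) (fun q p h => ?_) _ (fun p q => ?_)
  · rw [LinearMap.comp_apply, map_chi_mk, hat_tmul, hatA_tmul, LinearMap.mulLeft_apply,
      ← mul_assoc, inlA_mul_opR, map_mul, MulOpposite.unop_op]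
    simp only [mul_assoc]
  · simp only [LinearMap.comp_apply, map_tmul, LinearMap.mul'_apply, LinearMap.mulLeft_apply,
      AlgHom.toLinearMap_apply, map_one, one_mul, mul_assoc]
  · rw [hatA_tmul]; rfl

variable (ca) in
/-- `c ↦ (h ↦ (1 ⊗ q') (q₀ ψ(h ⊗ q₁) ⊗ 1))` for `c = q ⊗ q'`. -/
noncomputable def Omega (ψ : H ⊗[k] H →ₗ[k] P) : Env k P →ₗ[k] H →ₗ[k] Env k P :=
  (hatA ∘ₗ ractL ca.ρ (inlA k P).toLinearMap ∘ₗ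
    LinearMap.compRight k (inlA k P).toLinearMap ∘ₗ curry ψ).flip

theorem Omega_apply (ψ : H ⊗[k] H →ₗ[k] P) (c : Env k P) (h : H) : Omega ca ψ c h =
    hatA (ract ca.ρ (inlA k P).toLinearMap ((inlA k P).toLinearMap ∘ₗ curry ψ h)) c := rfl

theorem inlA_comp_ract (f : H →ₗ[k] P) :
    ract ca.ρ (inlA k P).toLinearMap ((inlA k P).toLinearMap ∘ₗ f) =
      (inlA k P).toLinearMap ∘ₗ ract ca.ρ LinearMap.id f :=
  (comp_ract (inlA k P) ca.ρ LinearMap.id f).symm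

theorem mulA_Omega (ψ : H ⊗[k] H →ₗ[k] P) (c : Env k P) :
    ComodAlg.mulA ∘ₗ Omega ca ψ c = omega ca ψ c := by
  ext h
  rw [LinearMap.comp_apply, Omega_apply, inlA_comp_ract, mulA_hatA, omega_apply]

theorem Omega_cvOne (c : Env k P) (h : H) :
    Omega ca cvOne c h = counit (R := k) h • c := by
  rw [Omega_apply, curry_cvOne, LinearMap.comp_smul, ← ractL_apply, map_smul, map_smul,
    LinearMap.smul_apply, ractL_apply, inlA_comp_ract, ract_cvOne (isCoact ca)]
  rw [LinearMap.comp_id, hatA_inlA]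

theorem tmul_mul_Omega (ψ : H ⊗[k] H →ₗ[k] P) {b : P} (hb : ca.ρ b = b ⊗ₜ[k] (1 : H))
    (z : Env k P) : Omega ca ψ ((b ⊗ₜ MulOpposite.op (1 : P)) * z) =
      LinearMap.mulLeft k (inlA k P b) ∘ₗ Omega ca ψ z := by
  ext h
  exact hatA_ract_mul _ hb z

theorem opR_mul_omega (φ : H ⊗[k] H →ₗ[k] P) (b : P) (z : Env k P) :
    omega ca φ (opR k b * z) = LinearMap.mulRight k b ∘ₗ omega ca φ z := by
  ext h
  exact hat_opR_mul _ _ _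

theorem inlA_comp_mulRight (f : H →ₗ[k] P) (b : P) :
    (inlA k P).toLinearMap ∘ₗ LinearMap.mulRight k b ∘ₗ f =
      LinearMap.mulRight k (inlA k P b) ∘ₗ (inlA k P).toLinearMap ∘ₗ f := by
  ext; simp

theorem esDeltaEval_Omega (hGal : ca.IsGalois) (φ ψ : H ⊗[k] H →ₗ[k] P) :
    ca.esDeltaEval (fun x y => cv ((inlA k P).toLinearMap ∘ₗ omega ca φ x) (Omega ca ψ y)) =
      Omega ca (cv φ ψ) := by
  let M : H →ₗ[k] P ⊗[k] H →ₗ[k] Env k P :=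
    LinearMap.compRight k (mul' k (Env k P)) ∘ₗ
      TensorProduct.mapBilinear (.id k) P H (Env k P) (Env k P) (inlA k P).toLinearMap ∘ₗ
      LinearMap.compRight k (inlA k P).toLinearMap ∘ₗ curry ψ
  let N : P →ₗ[k] H →ₗ[k] Env k P :=
    (LinearMap.compRight k (inlA k P).toLinearMap ∘ₗ ractL ca.ρ LinearMap.id ∘ₗ curry φ).flip
  let K : H →ₗ[k] H →ₗ[k] Env k P :=
    LinearMap.compRight k (inlA k P).toLinearMap ∘ₗ (curry ψ).flip
  let N' : P → P →ₗ[k] H →ₗ[k] Env k P := fun q =>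
    LinearMap.compRight k (LinearMap.mulLeft k (opR k q)) ∘ₗ N
  refine esDeltaEval_eq hGal
    (fun q p => cvL (N' q p) ∘ₗ M.flip) (fun p a b q => ?_)
    (fun q => lift (cvL.compl₁₂ (N' q) K)) (fun q p h => ?_) _ (fun p q => ?_)
  · have h1 : (inlA k P).toLinearMap ∘ₗ omega ca φ (p ⊗ₜ MulOpposite.op a) =
        LinearMap.mulRight k (inlA k P a) ∘ₗ N p := by
      ext h
      simp [omega_apply, N]
    have h2 : LinearMap.mulLeft k (inlA k P a) ∘ₗ Omega ca ψ (b ⊗ₜ q) =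
        LinearMap.mulLeft k (opR k (MulOpposite.unop q)) ∘ₗ
          M.flip (ca.chi (Submodule.Quotient.mk (a ⊗ₜ b))) := by
      ext h
      have := map_chi_mk (ca := ca) (inlA k P) ((inlA k P).toLinearMap ∘ₗ curry ψ h) a b
      rw [LinearMap.comp_apply, LinearMap.comp_apply, Omega_apply, LinearMap.mulLeft_apply,
        LinearMap.mulLeft_apply, hatA_tmul, ← mul_assoc, inlA_mul_opR, mul_assoc, ← this]
      rfl
    have h3 : LinearMap.mulRight k (opR k (MulOpposite.unop q)) ∘ₗ N p =
        N' (MulOpposite.unop q) p := by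
      ext h
      exact inlA_mul_opR _ _
    rw [h1, cv_mulRight_comp, h2, ← cv_mulRight_comp, h3]
    rfl
  · have : M.flip (1 ⊗ₜ h) = K h := by
      ext g
      change inlA k P 1 * inlA k P (ψ (g ⊗ₜ h)) = inlA k P (ψ (g ⊗ₜ h))
      rw [map_one, one_mul]
    rw [LinearMap.comp_apply, this]
    rfl
  · ext h
    have hR : lift (cvL.compl₁₂ (N' (MulOpposite.unop q)) K) (ca.ρ p) h =
        mul' k (Env k P) ((lift ((TensorProduct.mapBilinear (.id k) H H (Env k P) (Env k P)).compl₁₂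
          (N' (MulOpposite.unop q)) K) (ca.ρ p)) (comul (R := k) h)) := by
      generalize ca.ρ p = z
      induction z using TensorProduct.induction_on with
      | zero => simp
      | add x y hx hy => simp only [map_add, LinearMap.add_apply, hx, hy]
      | tmul a g => rfl
    rw [hR, Omega_apply, hatA_tmul, curry_cv]
    generalize comul (R := k) h = w
    induction w using TensorProduct.induction_on with
    | zero => simp [ract]
    | add x y hx hy =>
      rw [map_add, map_add, map_add, ← hx, ← hy, LinearMap.comp_add, ← mul_add]
      congr 1
      exact LinearMap.congr_fun (map_add (ractL ca.ρ (inlA k P).toLinearMap) _ _) p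
    | tmul h1 h2 =>
      rw [lift.tmul, LinearMap.compl₁₂_apply, cvL_apply, inlA_comp_ract, ← ract_ract (isCoact ca),
        LinearMap.comp_apply, ract, LinearMap.comp_apply, LinearMap.comp_apply]
      generalize ca.ρ p = z
      induction z using TensorProduct.induction_on with
      | zero => simp
      | add x y hx hy => simp only [map_add, LinearMap.add_apply, mul_add, hx, hy]
      | tmul a g =>
        change opR k _ * inlA k P (ract ca.ρ LinearMap.id (curry φ h1) a * ψ (h2 ⊗ₜ g)) =
          opR k _ * inlA k P (ract ca.ρ LinearMap.id (curry φ h1) a) * inlA k P (ψ (h2 ⊗ₜ g))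
        rw [map_mul, mul_assoc]

end Coproduct
end HopfGalois

namespace HopfGalois

section Evaluation

open LinearMap (mul')
open Coalgebra (comul counit)

variable {k : Type u} [Field k] {H P : Type v} [Ring H] [HopfAlgebra k H] [Ring P] [Algebra k P]
  {ca : ComodAlg k H P}

namespace IsES

variable {B0 L0 : Type v} [Ring B0] [Algebra k B0] [Ring L0] [Algebra k L0] {ιB : B0 →ₐ[k] P}
  {ι : L0 →ₐ[k] Env k P} {st : BgdST k B0 L0} {cop : L0 →ₗ[k] st.T2} {cou : L0 →ₗ[k] B0}
  (E : IsES ca ιB ι st cop cou)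

include E

theorem iotaB_lift2 {V : Type v} [AddCommGroup V] [Module k V] (F : Env k P →ₗ[k] Env k P →ₗ[k] V)
    (hF : ∀ (b : B0) X Y, F (opR k (ιB b) * X) Y = F X ((ιB b ⊗ₜ MulOpposite.op (1 : P)) * Y))
    (Λ : V →ₗ[k] P) {f : L0 → L0 → B0} (hf : ∀ x y, ιB (f x y) = Λ (F (ι x) (ι y))) (z : L0) :
    ιB (st.lift2 f (cop z)) = Λ (ca.esDeltaEval (fun x y => F x y) (ι z)) := by
  let b : L0 ⊗[k] L0 →ₗ[k] V := lift (F.compl₁₂ ι.toLinearMap ι.toLinearMap)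
  have hb : ∀ x y, b (x ⊗ₜ y) = F (ι x) (ι y) := fun x y => rfl
  obtain ⟨ψ, hψ⟩ := exists_factor ιB.toLinearMap E.injB (Λ ∘ₗ b) (fun v => by
    induction v using TensorProduct.induction_on with
    | zero => exact ⟨0, by simp⟩
    | add x y hx hy =>
      obtain ⟨⟨w, hw⟩, ⟨w', hw'⟩⟩ := And.intro hx hy
      exact ⟨w + w', by rw [map_add, map_add, hw, hw']⟩
    | tmul x y => exact ⟨f x y, hf x y⟩)
  have hbal : ∀ z ∈ st.rel, b z = 0 := by
    intro z hz
    refine Submodule.span_le (p := LinearMap.ker b) |>.2 ?_ hz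
    rintro _ ⟨a, X, Y, rfl⟩
    rw [SetLike.mem_coe, LinearMap.mem_ker, map_sub, hb, hb, map_mul ι, map_mul ι, E.map_s, E.map_t]
    exact sub_eq_zero.2 (hF a _ _)
  have hbalψ : ∀ z ∈ st.rel, ψ z = 0 := fun z hz => E.injB (by
    rw [map_zero]
    refine (hψ z).trans ?_
    rw [LinearMap.comp_apply, hbal z hz, map_zero])
  have hψ' : ∀ x y, ψ (x ⊗ₜ y) = f x y := fun x y => E.injB ((hψ _).trans (hf x y).symm)
  have e1 : st.lift2 f = st.rel.liftQ ψ hbalψ := qtlift_eq _ fun x y => hψ' x y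
  have e2 : st.lift2 (fun x y => F (ι x) (ι y)) = st.rel.liftQ b hbal := qtlift_eq _ fun x y => hb x y
  have e3 : ιB.toLinearMap ∘ₗ st.rel.liftQ ψ hbalψ = Λ ∘ₗ st.rel.liftQ b hbal := by
    apply Submodule.linearMap_qext
    ext x y
    exact hψ _
  rw [← E.map_cop V F hF z, e1, e2]
  exact LinearMap.congr_fun e3 _

theorem iotaB_lift2_hat (ω : H →ₗ[k] P) (β : H →ₗ[k] Env k P) (Λ : Env k P →ₗ[k] P)
    {f : L0 → L0 → B0} (hf : ∀ x y, ιB (f x y) =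
      Λ (inlA k P (hat (ract ca.ρ LinearMap.id ω) (ι x)) *
        hatA (ract ca.ρ (inlA k P).toLinearMap β) (ι y))) (X : L0) :
    ιB (st.lift2 f (cop X)) = Λ (hatA (ract ca.ρ (inlA k P).toLinearMap
      (cv ((inlA k P).toLinearMap ∘ₗ ω) β)) (ι X)) := by
  rw [E.iotaB_lift2 ((LinearMap.mul k (Env k P)).compl₁₂
    ((inlA k P).toLinearMap ∘ₗ hat (ract ca.ρ LinearMap.id ω))
    (hatA (ract ca.ρ (inlA k P).toLinearMap β))) (fun b X Y => ?_) Λ hf, ← ract_ract (isCoact ca),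
    inlA_comp_ract, ← esDeltaEval_hat_hatA E.gal]
  · rfl
  · change inlA k P (hat _ _) * _ = inlA k P (hat _ _) * hatA _ _
    rw [hat_opR_mul, hatA_ract_mul _ (E.rho_iotaB b), map_mul, mul_assoc]

theorem iotaB_lift2_omega (φ ψ : H ⊗[k] H →ₗ[k] P) (Λ : (H →ₗ[k] Env k P) →ₗ[k] P)
    {f : L0 → L0 → B0} (hf : ∀ x y, ιB (f x y) =
      Λ (cv ((inlA k P).toLinearMap ∘ₗ omega ca φ (ι x)) (Omega ca ψ (ι y)))) (X : L0) :
    ιB (st.lift2 f (cop X)) = Λ (Omega ca (cv φ ψ) (ι X)) := by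
  let F : Env k P →ₗ[k] Env k P →ₗ[k] H →ₗ[k] Env k P :=
    cvL.compl₁₂ (LinearMap.compRight k (inlA k P).toLinearMap ∘ₗ
      (hat ∘ₗ ractL ca.ρ LinearMap.id ∘ₗ curry φ).flip) (Omega ca ψ)
  have hF : ∀ x y, F x y = cv ((inlA k P).toLinearMap ∘ₗ omega ca φ x) (Omega ca ψ y) :=
    fun x y => rfl
  rw [E.iotaB_lift2 (V := H →ₗ[k] Env k P) F (fun b X Y => ?_) Λ hf,
    ← esDeltaEval_Omega E.gal]
  · rfl
  · rw [hF, hF, opR_mul_omega, inlA_comp_mulRight, cv_mulRight_comp,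
      tmul_mul_Omega _ (E.rho_iotaB b)]

theorem iotaB_cconv {U V : L0 →ₗ[k] B0} {f g : H →ₗ[k] P}
    (hU : ∀ X, ιB (U X) = hat (ract ca.ρ LinearMap.id f) (ι X))
    (hV : ∀ X, ιB (V X) = hat (ract ca.ρ LinearMap.id g) (ι X)) (X : L0) :
    ιB (st.cconv cop U V X) = hat (ract ca.ρ LinearMap.id (cv f g)) (ι X) := by
  rw [BgdST.cconv, LinearMap.comp_apply,
    E.iotaB_lift2_hat f ((inlA k P).toLinearMap ∘ₗ g) ComodAlg.mulA (fun x y => ?_), ← comp_cv,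
    inlA_comp_ract, mulA_hatA]
  rw [mulA_inlA_mul, inlA_comp_ract, mulA_hatA, map_mul ιB, hU, hV]

theorem iotaB_cou (X : L0) :
    ιB (cou X) = hat (ract ca.ρ LinearMap.id cvOne) (ι X) := by
  rw [ract_cvOne (isCoact ca), E.map_cou, mulA_eq]

omit E in
theorem hatTwo_ract_cvOne (X Y : Env k P) :
    hatTwo (ract (rhoTwo ca) (muTwo k P) cvOne) X Y = ComodAlg.mulA (X * Y) := by
  rw [ract_cvOne (isCoact_rhoTwo ca)]
  induction X using TensorProduct.induction_on with
  | zero => simp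
  | add x y hx hy => simp only [map_add, LinearMap.add_apply, add_mul, hx, hy]
  | tmul p q =>
    induction Y using TensorProduct.induction_on with
    | zero => simp
    | add x y hx hy => simp only [map_add, mul_add, hx, hy]
    | tmul p' q' =>
      rw [Algebra.TensorProduct.tmul_mul_tmul, mulA_tmul]
      simp [mul_assoc]

theorem iotaB_unit2 (X Y : L0) : ιB (BgdST.unit2 cou X Y) =
    hatTwo (ract (rhoTwo ca) (muTwo k P) cvOne) (ι X) (ι Y) := by
  rw [hatTwo_ract_cvOne, BgdST.unit2, E.map_cou, map_mul ι]

theorem iotaB_conv2 {f g : L0 → L0 → B0} {φ ψ : H ⊗[k] H →ₗ[k] P}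
    (hf : ∀ X Y, ιB (f X Y) = hatTwo (ract (rhoTwo ca) (muTwo k P) φ) (ι X) (ι Y))
    (hg : ∀ X Y, ιB (g X Y) = hatTwo (ract (rhoTwo ca) (muTwo k P) ψ) (ι X) (ι Y)) (X Y : L0) :
    ιB (st.conv2 cop f g X Y) =
      hatTwo (ract (rhoTwo ca) (muTwo k P) (cv φ ψ)) (ι X) (ι Y) := by
  rw [BgdST.conv2, E.iotaB_lift2_omega φ ψ
    (ComodAlg.mulA ∘ₗ hatA.flip (ι X) ∘ₗ ractL ca.ρ (inlA k P).toLinearMap ∘ₗ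
      LinearMap.compRight k ((inlA k P).toLinearMap ∘ₗ ComodAlg.mulA)) (fun y y' => ?_)]
  · change ComodAlg.mulA (hatA (ract ca.ρ (inlA k P).toLinearMap ((inlA k P).toLinearMap ∘ₗ
      ComodAlg.mulA ∘ₗ Omega ca (cv φ ψ) (ι Y))) (ι X)) = _
    rw [mulA_Omega, inlA_comp_ract, mulA_hatA, hatTwo_ract]
  · rw [E.iotaB_lift2_hat (omega ca φ (ι y)) ((inlA k P).toLinearMap ∘ₗ omega ca ψ (ι y'))
      ComodAlg.mulA (fun x x' => ?_), ← mulA_Omega ψ, cv_inlA_comp]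
    · rfl
    · rw [mulA_inlA_mul, inlA_comp_ract, mulA_hatA, map_mul ιB, hf, hg, hatTwo_ract, hatTwo_ract]

theorem iotaB_gammaU {Γ : L0 → L0 → B0} {U Ui : L0 →ₗ[k] B0} {φ φ' ψ : H ⊗[k] H →ₗ[k] P}
    (h1 : ∀ X Y, ιB (Ui (X * st.t (Ui Y))) =
      hatTwo (ract (rhoTwo ca) (muTwo k P) φ) (ι X) (ι Y))
    (h2 : ∀ X Y, ιB (Γ X Y) = hatTwo (ract (rhoTwo ca) (muTwo k P) φ') (ι X) (ι Y))
    (h3 : ∀ X Y, ιB (U (X * Y)) = hatTwo (ract (rhoTwo ca) (muTwo k P) ψ) (ι X) (ι Y))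
    (X Y : L0) :
    ιB (st.gammaU cop Γ U Ui X Y) =
      hatTwo (ract (rhoTwo ca) (muTwo k P) (cv φ (cv φ' ψ))) (ι X) (ι Y) := by
  rw [BgdST.gammaU, E.iotaB_lift2_omega φ (cv φ' ψ)
    (ComodAlg.mulA ∘ₗ hatA.flip (ι X) ∘ₗ ractL ca.ρ (inlA k P).toLinearMap ∘ₗ
      LinearMap.compRight k ((inlA k P).toLinearMap ∘ₗ ComodAlg.mulA)) (fun y1 y23 => ?_)]
  · change ComodAlg.mulA (hatA (ract ca.ρ (inlA k P).toLinearMap ((inlA k P).toLinearMap ∘ₗ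
      ComodAlg.mulA ∘ₗ Omega ca (cv φ (cv φ' ψ)) (ι Y))) (ι X)) = _
    rw [mulA_Omega, inlA_comp_ract, mulA_hatA, hatTwo_ract]
  · rw [E.iotaB_lift2_omega φ' ψ
      (ComodAlg.mulA ∘ₗ hatA.flip (ι X) ∘ₗ ractL ca.ρ (inlA k P).toLinearMap ∘ₗ
        LinearMap.compRight k ((inlA k P).toLinearMap ∘ₗ ComodAlg.mulA) ∘ₗ
        cvL ((inlA k P).toLinearMap ∘ₗ omega ca φ (ι y1))) (fun y2 y3 => ?_)]
    · rfl
    · rw [E.iotaB_lift2_hat (omega ca φ (ι y1)) (cv ((inlA k P).toLinearMap ∘ₗ omega ca φ' (ι y2))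
        ((inlA k P).toLinearMap ∘ₗ omega ca ψ (ι y3))) ComodAlg.mulA (fun x1 x23 => ?_),
        ← mulA_Omega ψ, cv_inlA_comp, cv_inlA_comp]
      · rfl
      · rw [E.iotaB_lift2_hat (omega ca φ' (ι y2)) ((inlA k P).toLinearMap ∘ₗ omega ca ψ (ι y3))
          (LinearMap.mulLeft k (hat (ract ca.ρ LinearMap.id (omega ca φ (ι y1))) (ι x1)) ∘ₗ
            ComodAlg.mulA) (fun x2 x3 => ?_), mulA_inlA_mul]
        · rfl
        · rw [LinearMap.comp_apply, mulA_inlA_mul, inlA_comp_ract, mulA_hatA, map_mul ιB,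
            map_mul ιB, h1, h2, h3, hatTwo_ract, hatTwo_ract, hatTwo_ract, mul_assoc]
          rfl

end IsES
end Evaluation
end HopfGalois

namespace HopfGalois

section CocycleTransport

open LinearMap (mul')
open Coalgebra (comul counit)

variable {k : Type u} [Field k] {H P : Type v} [Ring H] [HopfAlgebra k H] [Ring P] [Algebra k P]
  {ca : ComodAlg k H P}

variable (ca) in
/-- `(p ⊗ p', q ⊗ q') ↦ p₀q₀φ(q₁, p₁) ⊗ q' p'` on `P ⊗ Pᵒᵖ`. -/
noncomputable def twistMul (φ : H ⊗[k] H →ₗ[k] P) : Env k P →ₗ[k] Env k P →ₗ[k] Env k P :=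
  (hatA ∘ₗ ractL ca.ρ (inlA k P).toLinearMap ∘ₗ Omega ca φ).flip

theorem twistMul_apply (φ : H ⊗[k] H →ₗ[k] P) (a c : Env k P) :
    twistMul ca φ a c = hatA (ract ca.ρ (inlA k P).toLinearMap (Omega ca φ c)) a := rfl

theorem twistMul_tmul (φ : H ⊗[k] H →ₗ[k] P) (p q : P) (p' q' : Pᵐᵒᵖ) :
    twistMul ca φ (p ⊗ₜ p') (q ⊗ₜ q') =
      ract (rhoTwo ca) (muTwo k P) φ (p ⊗ₜ q) ⊗ₜ (p' * q') := by
  have h : ∀ z : P, z ⊗ₜ[k] (p' * q') = opR k (MulOpposite.unop p') *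
      (opR k (MulOpposite.unop q') * inlA k P z) := fun z => by simp
  rw [twistMul_apply, hatA_tmul, ract_rhoTwo_tmul, h]
  congr 1
  simp only [ract, LinearMap.comp_apply]
  generalize ca.ρ p = w
  induction w using TensorProduct.induction_on with
  | zero => simp
  | add x y hx hy => simp only [map_add, mul_add, hx, hy]
  | tmul a g =>
    rw [map_tmul, map_tmul, LinearMap.mul'_apply, LinearMap.mul'_apply, Omega_apply, inlA_comp_ract,
      hatA_tmul, LinearMap.comp_apply, map_mul, AlgHom.toLinearMap_apply, AlgHom.toLinearMap_apply,
      ← mul_assoc, ← mul_assoc, inlA_mul_opR]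
    rfl

theorem hatA_ract_Omega_cvOne (a c : Env k P) :
    hatA (ract ca.ρ (inlA k P).toLinearMap (Omega ca cvOne c)) a = a * c := by
  have h : Omega ca cvOne c = LinearMap.mulRight k c ∘ₗ cvOne := by
    ext h
    rw [Omega_cvOne, LinearMap.comp_apply, LinearMap.mulRight_apply, cvOne, LinearMap.comp_apply,
      Algebra.linearMap_apply]
    exact Algebra.smul_def (A := Env k P) (counit (R := k) h) c
  have h' : ract ca.ρ (inlA k P).toLinearMap (LinearMap.mulRight k c ∘ₗ cvOne) =
      LinearMap.mulRight k c ∘ₗ ract ca.ρ (inlA k P).toLinearMap cvOne := by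
    ext p
    simp only [ract, LinearMap.comp_apply]
    generalize ca.ρ p = w
    induction w using TensorProduct.induction_on with
    | zero => simp
    | add x y hx hy => simp only [map_add, hx, hy]
    | tmul a g => simp [mul_assoc]
  rw [h, h', ract_cvOne (isCoact ca)]
  induction a using TensorProduct.induction_on with
  | zero => simp
  | add x y hx hy => simp only [map_add, add_mul, hx, hy]
  | tmul p q => simp [← mul_assoc]

theorem opR_mul_twistMul (φ : H ⊗[k] H →ₗ[k] P) (r : P) (a c : Env k P) :
    twistMul ca φ (opR k r * a) c = opR k r * twistMul ca φ a c := by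
  rw [twistMul_apply, twistMul_apply]
  induction a using TensorProduct.induction_on with
  | zero => simp
  | add x y hx hy => simp only [map_add, mul_add, hx, hy]
  | tmul p q =>
    rw [Algebra.TensorProduct.tmul_mul_tmul, hatA_tmul, hatA_tmul, ← mul_assoc, one_mul]
    simp [opR]

/-- A right `P`-linear map is recovered from its restriction to `P`. -/
theorem hat_comp_inlA (f : Env k P →ₗ[k] P) (hf : ∀ r z, f (opR k r * z) = f z * r) (z : Env k P) :
    hat (f ∘ₗ (inlA k P).toLinearMap) z = f z := by
  induction z using TensorProduct.induction_on with
  | zero => simp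
  | add x y hx hy => simp only [map_add, hx, hy]
  | tmul p q =>
    have h : (p ⊗ₜ q : Env k P) = opR k (MulOpposite.unop q) * inlA k P p := by simp
    rw [hat_tmul, h, hf]
    rfl

theorem hatTwo_opR_mul (G : P ⊗[k] P →ₗ[k] P) (r : P) (a c : Env k P) :
    hatTwo G (opR k r * a) c = hatTwo G a c * r := by
  rw [hatTwo_apply, hatTwo_apply, hat_opR_mul]

theorem hat_hatTwo_flip (G : P ⊗[k] P →ₗ[k] P) (c a : Env k P) :
    hat ((hatTwo G).flip c ∘ₗ (inlA k P).toLinearMap) a = hatTwo G a c := by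
  rw [hat_comp_inlA, LinearMap.flip_apply]
  intro r z
  rw [LinearMap.flip_apply, LinearMap.flip_apply, hatTwo_opR_mul]

theorem hat_hatTwo_twistMul (G : P ⊗[k] P →ₗ[k] P) (φ : H ⊗[k] H →ₗ[k] P) (a c d : Env k P) :
    hat (((hatTwo G).flip d ∘ₗ (twistMul ca φ).flip c) ∘ₗ (inlA k P).toLinearMap) a =
      hatTwo G (twistMul ca φ a c) d := by
  rw [hat_comp_inlA, LinearMap.comp_apply, LinearMap.flip_apply, LinearMap.flip_apply]
  intro r z
  rw [LinearMap.comp_apply, LinearMap.comp_apply, LinearMap.flip_apply, LinearMap.flip_apply,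
    LinearMap.flip_apply, LinearMap.flip_apply, opR_mul_twistMul, hatTwo_opR_mul]

theorem hatTwo_inlA_twistMul (φ : H ⊗[k] H →ₗ[k] P) (p : P) (c d : Env k P) :
    hatTwo (ract (rhoTwo ca) (muTwo k P) φ) (inlA k P p) (twistMul ca φ c d) =
      hatTwo (curry (ract (rhoTwo ca) (muTwo k P) φ) p ∘ₗ ract (rhoTwo ca) (muTwo k P) φ) c d := by
  induction c using TensorProduct.induction_on with
  | zero => simp
  | add x y hx hy => simp only [map_add, LinearMap.add_apply, hx, hy]
  | tmul q q' =>
    induction d using TensorProduct.induction_on with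
    | zero => simp
    | add x y hx hy => simp only [map_add, hx, hy]
    | tmul r r' =>
      rw [twistMul_tmul]
      simp [mul_assoc]

theorem hatTwo_twistMul_inlA (φ : H ⊗[k] H →ₗ[k] P) (p : P) (c d : Env k P) :
    hatTwo (ract (rhoTwo ca) (muTwo k P) φ) (twistMul ca φ (inlA k P p) c) d =
      hatTwo (ract (rhoTwo ca) (muTwo k P) φ ∘ₗ
        (curry (ract (rhoTwo ca) (muTwo k P) φ) p).rTensor P) c d := by
  induction c using TensorProduct.induction_on with
  | zero => simp
  | add x y hx hy => simp only [map_add, LinearMap.add_apply, hx, hy]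
  | tmul q q' =>
    induction d using TensorProduct.induction_on with
    | zero => simp
    | add x y hx hy => simp only [map_add, hx, hy]
    | tmul r r' =>
      rw [show inlA k P p = p ⊗ₜ (1 : Pᵐᵒᵖ) from rfl, twistMul_tmul]
      simp

namespace IsES

variable {B0 L0 : Type v} [Ring B0] [Algebra k B0] [Ring L0] [Algebra k L0] {ιB : B0 →ₐ[k] P}
  {ι : L0 →ₐ[k] Env k P} {st : BgdST k B0 L0} {cop : L0 →ₗ[k] st.T2} {cou : L0 →ₗ[k] B0}
  (E : IsES ca ιB ι st cop cou)

include E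

theorem iotaB_lift2_s_mul {Γ : L0 → L0 → B0} {φ : H ⊗[k] H →ₗ[k] P}
    (h : ∀ X Y, ιB (Γ X Y) = hatTwo (ract (rhoTwo ca) (muTwo k P) φ) (ι X) (ι Y))
    (Λ : Env k P →ₗ[k] P) {f : L0 → B0} (hf : ∀ x, ιB (f x) = Λ (ι x)) (X Y : L0) :
    ιB (st.lift2 (fun y1 y2 => st.lift2 (fun x1 x2 => f (st.s (Γ x1 y1) * (x2 * y2))) (cop X))
      (cop Y)) = Λ (twistMul ca φ (ι X) (ι Y)) := by
  rw [E.iotaB_lift2_omega φ cvOne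
    (Λ ∘ₗ hatA.flip (ι X) ∘ₗ ractL ca.ρ (inlA k P).toLinearMap) (fun y1 y2 => ?_), cv_cvOne]
  · rfl
  · rw [E.iotaB_lift2_hat (omega ca φ (ι y1)) (Omega ca cvOne (ι y2)) Λ (fun x1 x2 => ?_)]
    · rfl
    · rw [hf, map_mul ι, map_mul ι, hatA_ract_Omega_cvOne, E.map_s, h, hatTwo_ract]
      rfl

theorem iotaB_cocL {Γ : L0 → L0 → B0} {φ : H ⊗[k] H →ₗ[k] P}
    (h : ∀ X Y, ιB (Γ X Y) = hatTwo (ract (rhoTwo ca) (muTwo k P) φ) (ι X) (ι Y)) (X Y Z : L0) :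
    ιB (st.cocL cop Γ X Y Z) = hatTwo (ract (rhoTwo ca) (muTwo k P) φ) (ι X)
      (twistMul ca φ (ι Y) (ι Z)) :=
  E.iotaB_lift2_s_mul h (hatTwo (ract (rhoTwo ca) (muTwo k P) φ) (ι X)) (h X) Y Z

theorem iotaB_cocR {Γ : L0 → L0 → B0} {φ : H ⊗[k] H →ₗ[k] P}
    (h : ∀ X Y, ιB (Γ X Y) = hatTwo (ract (rhoTwo ca) (muTwo k P) φ) (ι X) (ι Y)) (X Y Z : L0) :
    ιB (st.cocR cop Γ X Y Z) = hatTwo (ract (rhoTwo ca) (muTwo k P) φ)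
      (twistMul ca φ (ι X) (ι Y)) (ι Z) :=
  E.iotaB_lift2_s_mul h ((hatTwo (ract (rhoTwo ca) (muTwo k P) φ)).flip (ι Z)) (h · Z) X Y

theorem cocycle_iff_of_hatTwo {Γ : L0 → L0 → B0} {φ : H ⊗[k] H →ₗ[k] P}
    (h : ∀ X Y, ιB (Γ X Y) = hatTwo (ract (rhoTwo ca) (muTwo k P) φ) (ι X) (ι Y)) :
    (∀ X Y Z, st.cocL cop Γ X Y Z = st.cocR cop Γ X Y Z) ↔
    ∀ p q r, ract (rhoTwo ca) (muTwo k P) φ (ract (rhoTwo ca) (muTwo k P) φ (p ⊗ₜ q) ⊗ₜ r) =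
      ract (rhoTwo ca) (muTwo k P) φ (p ⊗ₜ ract (rhoTwo ca) (muTwo k P) φ (q ⊗ₜ r)) := by
  let G := hatTwo (ract (rhoTwo ca) (muTwo k P) φ)
  have hL : ∀ a c d, hat (G.flip (twistMul ca φ c d) ∘ₗ (inlA k P).toLinearMap) a =
      G a (twistMul ca φ c d) := fun a c d => hat_hatTwo_flip _ _ a
  have hR : ∀ a c d, hat ((G.flip d ∘ₗ (twistMul ca φ).flip c) ∘ₗ (inlA k P).toLinearMap) a =
      G (twistMul ca φ a c) d := fun a c d => hat_hatTwo_twistMul _ φ a c d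
  have hLR : (∀ X Y Z, st.cocL cop Γ X Y Z = st.cocR cop Γ X Y Z) ↔
      ∀ X Y Z, G (ι X) (twistMul ca φ (ι Y) (ι Z)) = G (twistMul ca φ (ι X) (ι Y)) (ι Z) := by
    simp only [← E.injB.eq_iff, E.iotaB_cocL h, E.iotaB_cocR h, G]
  rw [hLR]
  constructor
  · intro hc p q r
    have h1 : ∀ Y Z p, G (inlA k P p) (twistMul ca φ (ι Y) (ι Z)) =
        G (twistMul ca φ (inlA k P p) (ι Y)) (ι Z) := fun Y Z =>
      LinearMap.congr_fun (E.hat_inj fun X => (hL _ _ _).trans ((hc X Y Z).trans (hR _ _ _).symm))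
    have h2 := E.hatTwo_inj fun Y Z => (hatTwo_inlA_twistMul φ p (ι Y) (ι Z)).symm.trans
      ((h1 Y Z p).trans (hatTwo_twistMul_inlA φ p (ι Y) (ι Z)))
    exact (LinearMap.congr_fun h2 (q ⊗ₜ r)).symm
  · intro hG X Y Z
    rw [← hL, ← hR]
    congr 2
    ext p
    refine (hatTwo_inlA_twistMul φ p (ι Y) (ι Z)).trans
      (Eq.trans ?_ (hatTwo_twistMul_inlA φ p (ι Y) (ι Z)).symm)
    congr 3
    ext q r
    exact (hG p q r).symm

end IsES
end CocycleTransport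
end HopfGalois

namespace HopfGalois

section SweedlerFormulas

open LinearMap (mul')
open Coalgebra (comul counit)

variable {k : Type u} [Field k] {H P : Type v} [Ring H] [HopfAlgebra k H] [Ring P] [Algebra k P]
  {ca : ComodAlg k H P} {act : P →ₗ[k] H →ₗ[k] P}

theorem convH_eq_cv (f g : H →ₗ[k] P) : ComodAlg.convH f g = cv f g :=
  LinearMap.ext fun h => tlift_comul (fun _ _ => rfl) h

theorem adCoaction_eq (f : H →ₗ[k] P) (h : H) : ComodAlg.adCoaction f h =
    cv (inrMap (HopfAlgebra.antipode k ∘ₗ (CoalgHom.id k H).toLinearMap))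
      (cv (inl.toLinearMap ∘ₗ f) (inrMap (CoalgHom.id k H).toLinearMap)) h :=
  tlift_comul (fun x y => (tlift_comul_map (F := inl.toLinearMap ∘ₗ f)
    (G := inrMap (CoalgHom.id k H).toLinearMap) (LinearMap.mulLeft k
      (inrMap (HopfAlgebra.antipode k ∘ₗ (CoalgHom.id k H).toLinearMap) x)) (fun a b => by
    simp [inrMap]) y).trans rfl) h

theorem isCol_id_iff_adCoaction (f : H →ₗ[k] P) :
    IsCol ca (CoalgHom.id k H) f ↔ ∀ h, ca.ρ (f h) = ComodAlg.adCoaction f h := by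
  rw [isCol_iff_antipode, LinearMap.ext_iff]
  simp only [adCoaction_eq, LinearMap.comp_apply]

theorem cvOne_tmul (g h : H) : (cvOne : H ⊗[k] H →ₗ[k] P) (g ⊗ₜ h) =
    algebraMap k P (counit (R := k) h * counit (R := k) g) := by
  simp [cvOne, TensorProduct.counit_tmul]

variable {φ ψ : H ⊗[k] H →ₗ[k] P} {γ δ : H → H → P}

theorem convHH_eq_cv (hγ : ∀ h g, φ (g ⊗ₜ h) = γ h g) (hδ : ∀ h g, ψ (g ⊗ₜ h) = δ h g) (h g : H) :
    ComodAlg.convHH (k := k) γ δ h g = cv φ ψ (g ⊗ₜ h) :=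
  tlift_slice_apply (F := φ) (G := ψ) g (fun x y => tlift_comul (F := slice φ x) (G := slice ψ y)
    (fun a b => by rw [slice_apply, slice_apply, hγ, hδ]) g) h

theorem cocA_tmul (hγ : ∀ h g, φ (g ⊗ₜ h) = γ h g) (h g f : H) :
    tlift k (fun h1 h2 => tlift k (fun g1 g2 => tlift k (fun f1 f2 =>
      act (γ g1 f1) h1 * γ h2 (f2 * g2)) (comul (R := k) f))
        (comul (R := k) g)) (comul (R := k) h) = cocA act φ ((f ⊗ₜ g) ⊗ₜ h) :=
  tlift_slice_apply (F := lift act ∘ₗ φ.rTensor H) (G := φ ∘ₗ (mulCo k H).toLinearMap.rTensor H)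
    (f ⊗ₜ g) (fun h1 h2 => tlift_slice_apply (F := slice (lift act ∘ₗ φ.rTensor H) h1)
      (G := slice (φ ∘ₗ (mulCo k H).toLinearMap.rTensor H) h2) f (fun g1 g2 =>
        tlift_comul (F := slice (slice (lift act ∘ₗ φ.rTensor H) h1) g1)
          (G := slice (slice (φ ∘ₗ (mulCo k H).toLinearMap.rTensor H) h2) g2)
          (fun f1 f2 => by simp [← hγ]) f) g) h

theorem cocB_tmul (hγ : ∀ h g, φ (g ⊗ₜ h) = γ h g) (h g f : H) :
    tlift k (fun h1 h2 => tlift k (fun g1 g2 => γ h1 g1 * γ (g2 * h2) f) (comul (R := k) g))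
      (comul (R := k) h) = cocB φ f (g ⊗ₜ h) :=
  tlift_slice_apply g (fun h1 h2 => tlift_comul (fun g1 g2 => by simp [← hγ]) g) h

theorem cv_act_tmul (hγ : ∀ h g, φ (g ⊗ₜ h) = γ h g) (h g : H) (b : P) :
    tlift k (fun h1 h2 => tlift k (fun g1 g2 => γ h1 g1 * act b (g2 * h2))
      (comul (R := k) g)) (comul (R := k) h) =
      cv φ (act b ∘ₗ (mulCo k H).toLinearMap) (g ⊗ₜ h) :=
  tlift_slice_apply g (fun h1 h2 => tlift_comul (fun g1 g2 => by simp [← hγ]) g) h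

theorem act_cv_tmul (hγ : ∀ h g, φ (g ⊗ₜ h) = γ h g) (h g : H) (b : P) :
    tlift k (fun h1 h2 => tlift k (fun g1 g2 => act b (g1 * h1) * γ h2 g2)
      (comul (R := k) g)) (comul (R := k) h) =
      cv (act b ∘ₗ (mulCo k H).toLinearMap) φ (g ⊗ₜ h) :=
  tlift_slice_apply g (fun h1 h2 => tlift_comul (fun g1 g2 => by simp [← hγ]) g) h

theorem antipode_cv_tmul (hγ : ∀ h g, φ (g ⊗ₜ h) = γ h g) (h g : H) :
    tlift k (fun h1 h23 => tlift k (fun h2 h3 => tlift k (fun g1 g23 => tlift k (fun g2 g3 =>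
      γ h2 g2 ⊗ₜ[k] (HopfAlgebra.antipode (R := k) (g1 * h1) * (g3 * h3)))
        (comul (R := k) g23)) (comul (R := k) g))
      (comul (R := k) h23)) (comul (R := k) h) =
    cv (inrMap (HopfAlgebra.antipode k ∘ₗ (mulCo k H).toLinearMap))
      (cv (inl.toLinearMap ∘ₗ φ) (inrMap (mulCo k H).toLinearMap)) (g ⊗ₜ h) :=
  tlift_slice_apply g (fun h1 h23 => (tlift_slice (F := inl.toLinearMap ∘ₗ φ)
    (G := inrMap (mulCo k H).toLinearMap) (LinearMap.applyₗ g ∘ₗ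
      cvL (slice (inrMap (HopfAlgebra.antipode k ∘ₗ (mulCo k H).toLinearMap)) h1)) (fun h2 h3 =>
      tlift_comul (F := slice (inrMap (HopfAlgebra.antipode k ∘ₗ (mulCo k H).toLinearMap)) h1)
        (fun g1 g23 => (tlift_comul_map (F := slice (inl.toLinearMap ∘ₗ φ) h2)
          (G := slice (inrMap (mulCo k H).toLinearMap) h3) (LinearMap.mulLeft k
            (inrMap (HopfAlgebra.antipode k ∘ₗ (mulCo k H).toLinearMap) (g1 ⊗ₜ h1)))
            (fun g2 g3 => by simp [inrMap, ← hγ]) g23).trans rfl) g) h23).trans rfl) h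

theorem isCol_mulCo_iff_antipode (hγ : ∀ h g, φ (g ⊗ₜ h) = γ h g) :
    IsCol ca (mulCo k H) φ ↔ ∀ h g, ca.ρ (γ h g) =
    tlift k (fun h1 h23 => tlift k (fun h2 h3 => tlift k (fun g1 g23 => tlift k (fun g2 g3 =>
      γ h2 g2 ⊗ₜ[k] (HopfAlgebra.antipode (R := k) (g1 * h1) * (g3 * h3)))
        (comul (R := k) g23)) (comul (R := k) g))
      (comul (R := k) h23)) (comul (R := k) h) := by
  rw [isCol_iff_antipode]
  constructor
  · intro h a g
    rw [antipode_cv_tmul hγ, ← h, LinearMap.comp_apply, hγ]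
  · intro h
    refine TensorProduct.ext' fun g a => ?_
    rw [LinearMap.comp_apply, hγ, h, antipode_cv_tmul hγ]

/-- The map `g ⊗ h ↦ (f(g) ◁ h₁) f(h₂)`. -/
noncomputable def actMul (act : P →ₗ[k] H →ₗ[k] P) (f : H →ₗ[k] P) : H ⊗[k] H →ₗ[k] P :=
  lift (cvL.flip f ∘ₗ act ∘ₗ f)

theorem curry_actMul (f : H →ₗ[k] P) (g : H) : curry (actMul act f) g = cv (act (f g)) f := by
  ext h; rfl

theorem actMul_eq_cv (f : H →ₗ[k] P) : actMul act f = cv (lift (act ∘ₗ f))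
    (f ∘ₗ (TensorProduct.lid k H).toLinearMap ∘ₗ (counit (R := k) (A := H)).rTensor H) := by
  apply TensorProduct.curry_injective
  ext1 g
  rw [curry_actMul, curry_cv]
  have h : lift (cvL.compl₁₂ (curry (lift (act ∘ₗ f))) (curry (f ∘ₗ
      (TensorProduct.lid k H).toLinearMap ∘ₗ (counit (R := k) (A := H)).rTensor H))) =
      (cvL.flip f ∘ₗ act ∘ₗ f) ∘ₗ (TensorProduct.rid k H).toLinearMap ∘ₗ
        (counit (R := k) (A := H)).lTensor H := by
    ext a b c
    have hb : curry (f ∘ₗ (TensorProduct.lid k H).toLinearMap ∘ₗ (counit (R := k) (A := H)).rTensor H) b =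
        counit (R := k) b • f := by ext c; simp
    have ha : curry (lift (act ∘ₗ f)) a = act (f a) := by ext c; rfl
    simp only [AlgebraTensorModule.curry_apply, curry_apply, LinearMap.restrictScalars_self,
      lift.tmul, LinearMap.compl₁₂_apply, LinearMap.comp_apply, LinearMap.lTensor_tmul,
      LinearEquiv.coe_coe, TensorProduct.rid_tmul, map_smul]
    rw [ha, hb, map_smul]
    rfl
  rw [h]
  simp

theorem cv_counit_tmul (f : H →ₗ[k] P) (F : H →ₗ[k] P) (h : H) :
    cv (slice (f ∘ₗ (TensorProduct.lid k H).toLinearMap ∘ₗ (counit (R := k) (A := H)).rTensor H) h) F =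
      LinearMap.mulLeft k (f h) ∘ₗ F := by
  have e : slice (f ∘ₗ (TensorProduct.lid k H).toLinearMap ∘ₗ (counit (R := k) (A := H)).rTensor H) h =
      LinearMap.mulLeft k (f h) ∘ₗ cvOne := by
    ext g
    simp only [slice_apply, LinearMap.comp_apply, LinearMap.rTensor_tmul, LinearEquiv.coe_coe,
      TensorProduct.lid_tmul, map_smul, cvOne, LinearMap.mulLeft_apply, Algebra.linearMap_apply]
    rw [Algebra.smul_def, Algebra.commutes]
  rw [e]
  conv_rhs => rw [← cvOne_cv F]
  ext g
  simp only [cv, LinearMap.comp_apply]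
  generalize comul (R := k) g = w
  induction w using TensorProduct.induction_on with
  | zero => simp
  | add x y hx hy => simp only [map_add, hx, hy]
  | tmul a b => simp [mul_assoc]

theorem gamF_eq_cv (hγ : ∀ h g, φ (g ⊗ₜ h) = γ h g) (f fi : H →ₗ[k] P) (h g : H) :
    ComodAlg.gamF act f fi γ h g =
      cv (actMul act fi) (cv φ (f ∘ₗ (mulCo k H).toLinearMap)) (g ⊗ₜ h) := by
  rw [actMul_eq_cv, cv_assoc]
  refine tlift_slice_apply g (fun h1 h234 => (tlift_slice
    (F := fi ∘ₗ (TensorProduct.lid k H).toLinearMap ∘ₗ (counit (R := k) (A := H)).rTensor H)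
    (G := cv φ (f ∘ₗ (mulCo k H).toLinearMap))
    (LinearMap.applyₗ g ∘ₗ cvL (slice (lift (act ∘ₗ fi)) h1)) (fun h2 h34 => (tlift_slice (F := φ)
      (G := f ∘ₗ (mulCo k H).toLinearMap) (LinearMap.applyₗ g ∘ₗ
        cvL (slice (lift (act ∘ₗ fi)) h1) ∘ₗ cvL (slice (fi ∘ₗ (TensorProduct.lid k H).toLinearMap ∘ₗ
          (counit (R := k) (A := H)).rTensor H) h2)) (fun h3 h4 => ?_) h34).trans rfl) h234).trans rfl) h
  simp only [LinearMap.comp_apply, cvL_apply, cv_counit_tmul]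
  refine tlift_comul (fun g1 g23 => ?_) g
  refine (tlift_comul_map (F := slice φ h3) (G := slice (f ∘ₗ (mulCo k H).toLinearMap) h4)
    (LinearMap.mulLeft k (act (fi g1) h1 * fi h2)) (fun g2 g3 => ?_) g23).trans ?_
  · simp [← hγ, mul_assoc]
  · simp

end SweedlerFormulas
end HopfGalois

namespace HopfGalois

section Cocycles

open LinearMap (mul')
open Coalgebra (comul counit)

variable {k : Type u} [Field k] {H P : Type v} [Ring H] [HopfAlgebra k H] [Ring P] [Algebra k P]
  {ca : ComodAlg k H P} {act : P →ₗ[k] H →ₗ[k] P}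

variable (ca) in
/-- The conditions on a linear map `H ⊗ H → P` shared by the two kinds of cocycles. -/
structure IsCocycle (φ : H ⊗[k] H →ₗ[k] P) : Prop where
  norm_left : curry φ 1 = cvOne
  norm_right : (curry φ).flip 1 = cvOne
  assoc : ∀ p q r, ract (rhoTwo ca) (muTwo k P) φ (ract (rhoTwo ca) (muTwo k P) φ (p ⊗ₜ q) ⊗ₜ r) =
    ract (rhoTwo ca) (muTwo k P) φ (p ⊗ₜ ract (rhoTwo ca) (muTwo k P) φ (q ⊗ₜ r))
  col : IsCol ca (mulCo k H) φ
  inv : ∃ ψ, cv φ ψ = cvOne ∧ cv ψ φ = cvOne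

theorem convHH_eq_one_iff {φ ψ : H ⊗[k] H →ₗ[k] P} {γ δ : H → H → P}
    (hγ : ∀ h g, φ (g ⊗ₜ h) = γ h g) (hδ : ∀ h g, ψ (g ⊗ₜ h) = δ h g) :
    (∀ h g : H, ComodAlg.convHH (k := k) γ δ h g =
      algebraMap k P (counit (R := k) h * counit (R := k) g)) ↔ cv φ ψ = cvOne := by
  constructor
  · intro h
    refine TensorProduct.ext' fun g a => ?_
    rw [← convHH_eq_cv hγ hδ, h, cvOne_tmul]
  · intro h a g
    rw [convHH_eq_cv hγ hδ, h, cvOne_tmul]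

theorem exists_tmul_eq (γ : H →ₗ[k] H →ₗ[k] P) :
    ∃ φ : H ⊗[k] H →ₗ[k] P, ∀ h g, φ (g ⊗ₜ h) = γ h g := ⟨lift γ.flip, fun _ _ => rfl⟩

theorem isZt2_iff (hGal : ca.IsGalois)
    (hbr : ∀ p, ract ca.ρ LinearMap.id (act p) = LinearMap.mulLeft k p)
    {φ : H ⊗[k] H →ₗ[k] P} {γ : H → H → P} (hγ : ∀ h g, φ (g ⊗ₜ h) = γ h g) :
    ComodAlg.IsZt2 ca act γ ↔ IsCocycle ca φ := by
  unfold ComodAlg.IsZt2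
  simp only [cocA_tmul hγ, cocB_tmul hγ, cv_act_tmul hγ, act_cv_tmul hγ,
    ← isCol_mulCo_iff_antipode hγ]
  constructor
  · rintro ⟨-, hn, hc, -, hcol, γi, ⟨γi', hi⟩, h1, h2⟩
    obtain ⟨ψ, hψ⟩ := exists_tmul_eq γi'
    simp only [hi] at hψ
    exact ⟨LinearMap.ext fun h => (hγ h 1).trans (hn h).1,
      LinearMap.ext fun h => (hγ 1 h).trans (hn h).2,
      (cocycle_iff hGal hbr hcol).1 fun f g h => hc h g f, hcol,
      ψ, (convHH_eq_one_iff hγ hψ).1 h1, (convHH_eq_one_iff hψ hγ).1 h2⟩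
  · rintro ⟨h1, h2, h3, h4, ψ, h5, h6⟩
    refine ⟨⟨(curry φ).flip, fun h g => hγ h g⟩, fun h => ⟨?_, ?_⟩,
      fun h g f => (cocycle_iff hGal hbr h4).2 h3 f g h,
      fun h g b => LinearMap.congr_fun (cv_act_comm hGal hbr h4 b) _, h4,
      fun h g => ψ (g ⊗ₜ h), ⟨(curry ψ).flip, fun _ _ => rfl⟩,
      (convHH_eq_one_iff hγ fun _ _ => rfl).2 h5, (convHH_eq_one_iff (fun _ _ => rfl) hγ).2 h6⟩
    · exact (hγ h 1).symm.trans (LinearMap.congr_fun h1 h)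
    · exact (hγ 1 h).symm.trans (LinearMap.congr_fun h2 h)

theorem omega_one (φ : H ⊗[k] H →ₗ[k] P) :
    omega ca φ 1 = (curry φ).flip 1 := by
  ext h
  rw [omega_apply, Algebra.TensorProduct.one_def, hat_tmul, ract_apply_coinv _ _ (by
    rw [ca.coact_one, Algebra.TensorProduct.one_def])]
  simp

theorem hatTwo_ract_one_left (φ : H ⊗[k] H →ₗ[k] P) (c : Env k P) :
    hatTwo (ract (rhoTwo ca) (muTwo k P) φ) 1 c = hat (ract ca.ρ LinearMap.id (curry φ 1)) c := by
  rw [hatTwo_ract, Algebra.TensorProduct.one_def, hat_tmul, ract_apply_coinv _ _ (by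
    rw [ca.coact_one, Algebra.TensorProduct.one_def]), omega_apply]
  simp

theorem hatTwo_ract_one_right (φ : H ⊗[k] H →ₗ[k] P) (a : Env k P) :
    hatTwo (ract (rhoTwo ca) (muTwo k P) φ) a 1 =
      hat (ract ca.ρ LinearMap.id ((curry φ).flip 1)) a := by
  rw [hatTwo_ract, omega_one]

theorem ract_mulRight_comp {N C : Type*} [AddCommGroup N] [Module k N] [AddCommGroup C] [Module k C]
    [Coalgebra k C] (ρ : N →ₗ[k] N ⊗[k] C) (g : N →ₗ[k] P) (F : C →ₗ[k] P) (a : P) :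
    ract ρ g (LinearMap.mulRight k a ∘ₗ F) = LinearMap.mulRight k a ∘ₗ ract ρ g F := by
  ext n
  simp only [ract, LinearMap.comp_apply]
  generalize ρ n = w
  induction w using TensorProduct.induction_on with
  | zero => simp
  | add x y hx hy => simp only [map_add, hx, hy]
  | tmul a b => simp [mul_assoc]

theorem ract_id_mulLeft {C : Type*} [AddCommGroup C] [Module k C]
    [Coalgebra k C] (ρ : P →ₗ[k] P ⊗[k] C) (F : C →ₗ[k] P) (a : P) :
    ract ρ (LinearMap.mulLeft k a) F = LinearMap.mulLeft k a ∘ₗ ract ρ LinearMap.id F := by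
  ext n
  simp only [ract, LinearMap.comp_apply]
  generalize ρ n = w
  induction w using TensorProduct.induction_on with
  | zero => simp
  | add x y hx hy => simp only [map_add, hx, hy]
  | tmul a b => simp [mul_assoc]

theorem hatTwo_ract_actMul (hbr : ∀ p, ract ca.ρ LinearMap.id (act p) = LinearMap.mulLeft k p)
    (f : H →ₗ[k] P) (a c : Env k P) :
    hatTwo (ract (rhoTwo ca) (muTwo k P) (actMul act f)) a c =
      hat (ract ca.ρ LinearMap.id f) (a * opR k (hat (ract ca.ρ LinearMap.id f) c)) := by
  have h : ∀ p q, ract (rhoTwo ca) (muTwo k P) (actMul act f) (p ⊗ₜ q) =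
      ract ca.ρ LinearMap.id f p * ract ca.ρ LinearMap.id f q := fun p q => by
    have e : LinearMap.applyₗ q ∘ₗ ractL ca.ρ LinearMap.id ∘ₗ curry (actMul act f) =
        LinearMap.mulRight k (ract ca.ρ LinearMap.id f q) ∘ₗ f := by
      ext g
      simp only [LinearMap.comp_apply, curry_actMul, ractL_apply, LinearMap.applyₗ_apply_apply]
      rw [← ract_ract (isCoact ca), hbr, ract_id_mulLeft]
      rfl
    rw [ract_rhoTwo_tmul, e, ract_mulRight_comp]
    rfl
  induction a using TensorProduct.induction_on with
  | zero => simp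
  | add x y hx hy => simp only [map_add, LinearMap.add_apply, add_mul, hx, hy]
  | tmul p p' =>
    induction c using TensorProduct.induction_on with
    | zero => simp [opR]
    | add x y hx hy =>
      simp only [map_add, hx, hy, opR, MulOpposite.op_add, TensorProduct.tmul_add, mul_add]
    | tmul q q' =>
      rw [hatTwo_tmul, h, hat_tmul, Algebra.TensorProduct.tmul_mul_tmul, hat_tmul]
      simp [mul_assoc]

theorem hatTwo_ract_comp_mulCo (f : H →ₗ[k] P) (a c : Env k P) :
    hatTwo (ract (rhoTwo ca) (muTwo k P) (f ∘ₗ (mulCo k H).toLinearMap)) a c =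
      hat (ract ca.ρ LinearMap.id f) (a * c) := by
  induction a using TensorProduct.induction_on with
  | zero => simp
  | add x y hx hy => simp only [map_add, LinearMap.add_apply, add_mul, hx, hy]
  | tmul p p' =>
    induction c using TensorProduct.induction_on with
    | zero => simp
    | add x y hx hy => simp only [map_add, mul_add, hx, hy]
    | tmul q q' =>
      rw [hatTwo_tmul, Algebra.TensorProduct.tmul_mul_tmul, hat_tmul,
        ← ract_apply_of_col (rho_comp_muTwo ca)]
      simp [mul_assoc]

end Cocycles
end HopfGalois

namespace HopfGalois

section Comparison

open LinearMap (mul')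
open Coalgebra (comul counit)

variable {k : Type u} [Field k] {H P : Type v} [Ring H] [HopfAlgebra k H] [Ring P] [Algebra k P]
  {ca : ComodAlg k H P} {act : P →ₗ[k] H →ₗ[k] P}
  {B0 L0 : Type v} [Ring B0] [Algebra k B0] [Ring L0] [Algebra k L0] {ιB : B0 →ₐ[k] P}
  {ι : L0 →ₐ[k] Env k P} {st : BgdST k B0 L0} {cop : L0 →ₗ[k] st.T2} {cou : L0 →ₗ[k] B0}

theorem qtlift_balanced_or_eq_zero {M N Q : Type*} [AddCommGroup M] [Module k M] [AddCommGroup N]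
    [Module k N] [AddCommGroup Q] [Module k Q] (p : Submodule k (M ⊗[k] N)) (f : M → N → Q) :
    (∃ F : ((M ⊗[k] N) ⧸ p) →ₗ[k] Q, ∀ x y, F (Submodule.Quotient.mk (x ⊗ₜ[k] y)) = f x y) ∨
      qtlift k p f = 0 := by
  by_cases h : ∃ F : ((M ⊗[k] N) ⧸ p) →ₗ[k] Q,
      ∀ x y, F (Submodule.Quotient.mk (x ⊗ₜ[k] y)) = f x y
  · exact .inl h
  · exact .inr (dif_neg h)

theorem eq_of_cconv_eq (hcou : cou 1 = 1) {U V : L0 →ₗ[k] B0} (h : st.cconv cop U V = cou)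
    (b : B0) (X Y : L0) : U (st.t b * X) * V Y = U X * V (st.s b * Y) := by
  rcases qtlift_balanced_or_eq_zero st.rel (fun x y => U x * V y) with ⟨F, hF⟩ | h0
  · rw [← hF, ← hF]
    congr 1
    exact (Submodule.Quotient.eq _).2 (Submodule.subset_span ⟨b, X, Y, rfl⟩)
  · have h1 : (1 : B0) = 0 := by
      rw [← hcou, ← h, BgdST.cconv, BgdST.lift2, h0]
      rfl
    exact eq_of_zero_eq_one h1.symm _ _

theorem isBimodMap_of_cconv (hcou : cou 1 = 1) {U V : L0 →ₗ[k] B0} (hU : st.IsBimodMap U)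
    (hU1 : U 1 = 1) (h1 : st.cconv cop U V = cou) (h2 : st.cconv cop V U = cou) :
    st.IsBimodMap V := by
  constructor
  · intro b X
    have h := eq_of_cconv_eq hcou h2 b X 1
    rwa [hU.2, hU1, mul_one, mul_one] at h
  · intro b X
    have h := eq_of_cconv_eq hcou h1 b 1 X
    rw [hU.1, hU1, one_mul, one_mul] at h
    exact h.symm

variable (ca) in
/-- A unital colinear map `f : H → P` with convolution inverse `fi`. -/
structure IsGauge (f fi : H →ₗ[k] P) : Prop where
  unital : f 1 = 1
  col : IsCol ca (CoalgHom.id k H) f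
  cv_inv : cv f fi = cvOne
  inv_cv : cv fi f = cvOne

theorem hat_ract_one (f : H →ₗ[k] P) : hat (ract ca.ρ LinearMap.id f) 1 = f 1 := by
  rw [Algebra.TensorProduct.one_def, hat_tmul, ract_apply_coinv _ _ (by
    rw [ca.coact_one, Algebra.TensorProduct.one_def])]
  simp

theorem gammaOf_eq_hatTwo {φ : H ⊗[k] H →ₗ[k] P} {γ : H → H → P}
    (hγ : ∀ h g, φ (g ⊗ₜ h) = γ h g) (X Y : L0) :
    GammaOf ca ι γ X Y = hatTwo (ract (rhoTwo ca) (muTwo k P) φ) (ι X) (ι Y) := by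
  refine LinearMap.congr_fun (tlift_eq
    ((hatTwo (ract (rhoTwo ca) (muTwo k P) φ)).flip (ι Y)) fun p p' => Eq.symm ?_) (ι X)
  refine LinearMap.congr_fun (tlift_eq
    (hatTwo (ract (rhoTwo ca) (muTwo k P) φ) (p ⊗ₜ p')) fun q q' => Eq.symm ?_) (ι Y)
  rw [hatTwo_tmul, ract_rhoTwo_tmul]
  refine (LinearMap.congr_fun (tlift_eq (LinearMap.mulRight k p'.unop ∘ₗ
    LinearMap.mulRight k q'.unop ∘ₗ mul' k P ∘ₗ map LinearMap.id
      (LinearMap.applyₗ q ∘ₗ ractL ca.ρ LinearMap.id ∘ₗ curry φ)) fun p0 p1 => Eq.symm ?_)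
        (ca.ρ p)).trans rfl
  refine (LinearMap.congr_fun (tlift_eq (LinearMap.mulRight k p'.unop ∘ₗ
    LinearMap.mulRight k q'.unop ∘ₗ LinearMap.mulLeft k p0 ∘ₗ mul' k P ∘ₗ
      map LinearMap.id (curry φ p1)) fun q0 q1 => ?_) (ca.ρ q)).trans rfl
  simp [← hγ, mul_assoc]

theorem isCt1_gauge_iff (hcen : ∀ b p : P, ca.ρ b = b ⊗ₜ[k] (1 : H) → p * b = b * p)
    (f fi : H →ₗ[k] P) : (ComodAlg.IsCt1 ca f ∧ ComodAlg.convH f fi = ComodAlg.unitH ∧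
      ComodAlg.convH fi f = ComodAlg.unitH) ↔ IsGauge ca f fi := by
  have hu : (ComodAlg.unitH : H →ₗ[k] P) = cvOne := rfl
  simp only [ComodAlg.IsCt1, convH_eq_cv, hu, ← isCol_id_iff_adCoaction]
  constructor
  · rintro ⟨⟨h1, h2, -, -⟩, h3, h4⟩
    exact ⟨h1, h2, h3, h4⟩
  · rintro ⟨h1, h2, h3, h4⟩
    refine ⟨⟨h1, h2, fun p b hb => ?_, fi, h3, h4⟩, h3, h4⟩
    congr 2
    ext p0 p1
    rw [mul_assoc, ← hcen b (f p1) hb, mul_assoc]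

namespace IsES

variable (E : IsES ca ιB ι st cop cou)

include E

theorem isZ2_iff {Γ : L0 → L0 → B0} {φ : H ⊗[k] H →ₗ[k] P}
    (h : ∀ X Y, ιB (Γ X Y) = hatTwo (ract (rhoTwo ca) (muTwo k P) φ) (ι X) (ι Y)) :
    st.IsZ2 cop cou Γ ↔ IsCocycle ca φ := by
  have hl : (∀ X, Γ 1 X = cou X) ↔ curry φ 1 = cvOne := by
    simp only [← E.injB.eq_iff, h, E.iotaB_cou, map_one ι, hatTwo_ract_one_left]
    exact ⟨E.hat_ract_inj, fun e X => by rw [e]⟩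
  have hr : (∀ X, Γ X 1 = cou X) ↔ (curry φ).flip 1 = cvOne := by
    simp only [← E.injB.eq_iff, h, E.iotaB_cou, map_one ι, hatTwo_ract_one_right]
    exact ⟨E.hat_ract_inj, fun e X => by rw [e]⟩
  have hcv : ∀ {Γ Δ : L0 → L0 → B0} {φ ψ : H ⊗[k] H →ₗ[k] P},
      (∀ X Y, ιB (Γ X Y) = hatTwo (ract (rhoTwo ca) (muTwo k P) φ) (ι X) (ι Y)) →
      (∀ X Y, ιB (Δ X Y) = hatTwo (ract (rhoTwo ca) (muTwo k P) ψ) (ι X) (ι Y)) →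
      ((∀ X Y, st.conv2 cop Γ Δ X Y = BgdST.unit2 cou X Y) ↔ cv φ ψ = cvOne) := by
    intro Γ Δ φ ψ hφ hψ
    simp only [← E.injB.eq_iff, E.iotaB_conv2 hφ hψ, E.iotaB_unit2]
    exact ⟨E.hatTwo_ract_inj, fun e X Y => by rw [e]⟩
  constructor
  · rintro ⟨-, h1, h2, -, h3, Γi, hi, h4, h5⟩
    obtain ⟨ψ, hψ⟩ := E.exists_hatTwo_ract_eq hi
    exact ⟨hl.1 h1, hr.1 h2, (E.cocycle_iff_of_hatTwo h).1 h3, E.isCol_mulCo_of_hatTwo h,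
      ψ, (hcv h hψ).1 h4, (hcv hψ h).1 h5⟩
  · rintro ⟨h1, h2, h3, h4, ψ, h5, h6⟩
    obtain ⟨Γi, hi⟩ := E.exists_of_isCol_mulCo (h4.inv h5 h6)
    exact ⟨E.isBihom_of_hatTwo h, hl.2 h1, hr.2 h2, E.st_indep_of_hatTwo h,
      (E.cocycle_iff_of_hatTwo h).2 h3, fun X Y => Γi X Y, E.isBihom_of_hatTwo hi,
      (hcv h hi).2 h5, (hcv hi h).2 h6⟩

theorem cou_one : cou 1 = 1 := by
  apply E.injB
  rw [E.iotaB_cou, map_one ι, hat_ract_one]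
  simp [cvOne]

theorem isGauge_of_hat {U Ui : L0 →ₗ[k] B0} {f fi : H →ₗ[k] P}
    (hU : ∀ X, ιB (U X) = hat (ract ca.ρ LinearMap.id f) (ι X))
    (hUi : ∀ X, ιB (Ui X) = hat (ract ca.ρ LinearMap.id fi) (ι X)) :
    (st.IsC1 cop cou U ∧ st.cconv cop U Ui = cou ∧ st.cconv cop Ui U = cou) ↔
      IsGauge ca f fi := by
  have h1 : U 1 = 1 ↔ f 1 = 1 := by
    rw [← E.injB.eq_iff, hU, map_one ι, map_one ιB, hat_ract_one]
  have hcv : ∀ {U V : L0 →ₗ[k] B0} {f g : H →ₗ[k] P},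
      (∀ X, ιB (U X) = hat (ract ca.ρ LinearMap.id f) (ι X)) →
      (∀ X, ιB (V X) = hat (ract ca.ρ LinearMap.id g) (ι X)) →
      (st.cconv cop U V = cou ↔ cv f g = cvOne) := by
    intro U V f g hf hg
    rw [LinearMap.ext_iff]
    simp only [← E.injB.eq_iff, E.iotaB_cconv hf hg, E.iotaB_cou]
    exact ⟨E.hat_ract_inj, fun e X => by rw [e]⟩
  constructor
  · rintro ⟨⟨h2, -, -, -⟩, h3, h4⟩
    exact ⟨h1.1 h2, E.isCol_id_of_hat hU, (hcv hU hUi).1 h3, (hcv hUi hU).1 h4⟩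
  · rintro ⟨h2, -, h3, h4⟩
    have h3' := (hcv hU hUi).2 h3
    have h4' := (hcv hUi hU).2 h4
    exact ⟨⟨h1.2 h2, E.isBimodMap_of_hat hU, E.mul_s_eq_mul_t_of_hat hU, Ui,
      E.isBimodMap_of_hat hUi, h3', h4'⟩, h3', h4'⟩

theorem iotaB_gammaU_of_hat
    (hbr : ∀ p, ract ca.ρ LinearMap.id (act p) = LinearMap.mulLeft k p)
    {Γ : L0 → L0 → B0} {φ : H ⊗[k] H →ₗ[k] P} {U Ui : L0 →ₗ[k] B0} {f fi : H →ₗ[k] P}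
    (h : ∀ X Y, ιB (Γ X Y) = hatTwo (ract (rhoTwo ca) (muTwo k P) φ) (ι X) (ι Y))
    (hU : ∀ X, ιB (U X) = hat (ract ca.ρ LinearMap.id f) (ι X))
    (hUi : ∀ X, ιB (Ui X) = hat (ract ca.ρ LinearMap.id fi) (ι X)) (X Y : L0) :
    ιB (st.gammaU cop Γ U Ui X Y) = hatTwo (ract (rhoTwo ca) (muTwo k P)
      (cv (actMul act fi) (cv φ (f ∘ₗ (mulCo k H).toLinearMap)))) (ι X) (ι Y) := by
  refine E.iotaB_gammaU (fun X Y => ?_) h (fun X Y => ?_) X Y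
  · rw [hUi, map_mul ι, E.map_t, hatTwo_ract_actMul hbr, hUi]
  · rw [hU, map_mul ι, hatTwo_ract_comp_mulCo]

theorem gauge_iff (hbr : ∀ p, ract ca.ρ LinearMap.id (act p) = LinearMap.mulLeft k p)
    {γ₁ γ₂ : H → H → P} {φ₁ φ₂ : H ⊗[k] H →ₗ[k] P} {Γ₁ Γ₂ : L0 → L0 → B0}
    (hγ₁ : ∀ h g, φ₁ (g ⊗ₜ h) = γ₁ h g) (hγ₂ : ∀ h g, φ₂ (g ⊗ₜ h) = γ₂ h g)
    (hΓ₁ : ∀ X Y, ιB (Γ₁ X Y) = hatTwo (ract (rhoTwo ca) (muTwo k P) φ₁) (ι X) (ι Y))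
    (hΓ₂ : ∀ X Y, ιB (Γ₂ X Y) = hatTwo (ract (rhoTwo ca) (muTwo k P) φ₂) (ι X) (ι Y)) :
    (∃ f fi : H →ₗ[k] P, ComodAlg.IsCt1 ca f ∧ ComodAlg.convH f fi = ComodAlg.unitH ∧
      ComodAlg.convH fi f = ComodAlg.unitH ∧
      ∀ h g : H, γ₂ h g = ComodAlg.gamF act (⇑f) (⇑fi) γ₁ h g) ↔
    ∃ U Ui : L0 →ₗ[k] B0, st.IsC1 cop cou U ∧ st.cconv cop U Ui = cou ∧
      st.cconv cop Ui U = cou ∧ ∀ X Y : L0, Γ₂ X Y = st.gammaU cop Γ₁ U Ui X Y := by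
  have hcen : ∀ b p : P, ca.ρ b = b ⊗ₜ[k] (1 : H) → p * b = b * p :=
    fun b p hb => E.central' hb p
  constructor
  · rintro ⟨f, fi, h1, h2, h3, h4⟩
    have hg := (isCt1_gauge_iff hcen f fi).1 ⟨h1, h2, h3⟩
    obtain ⟨U, hU⟩ := E.exists_of_isCol_id hg.col
    obtain ⟨Ui, hUi⟩ := E.exists_of_isCol_id (hg.col.inv hg.cv_inv hg.inv_cv)
    obtain ⟨h1', h2', h3'⟩ := (E.isGauge_of_hat hU hUi).2 hg
    have hφ : φ₂ = cv (actMul act fi) (cv φ₁ (f ∘ₗ (mulCo k H).toLinearMap)) :=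
      TensorProduct.ext' fun g h => by rw [hγ₂, h4, gamF_eq_cv hγ₁]
    refine ⟨U, Ui, h1', h2', h3', fun X Y => E.injB ?_⟩
    rw [E.iotaB_gammaU_of_hat hbr hΓ₁ hU hUi, hΓ₂, hφ]
  · rintro ⟨U, Ui, h1, h2, h3, h4⟩
    obtain ⟨f, hU⟩ := E.exists_hat_ract_eq h1.2.1
    obtain ⟨fi, hUi⟩ := E.exists_hat_ract_eq
      (isBimodMap_of_cconv E.cou_one h1.2.1 h1.1 h2 h3)
    have hg := (E.isGauge_of_hat hU hUi).1 ⟨h1, h2, h3⟩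
    obtain ⟨h1', h2', h3'⟩ := (isCt1_gauge_iff hcen f fi).2 hg
    have hφ : φ₂ = cv (actMul act fi) (cv φ₁ (f ∘ₗ (mulCo k H).toLinearMap)) :=
      E.hatTwo_ract_inj fun X Y => by
        rw [← hΓ₂, h4, E.iotaB_gammaU_of_hat hbr hΓ₁ hU hUi]
    refine ⟨f, fi, h1', h2', h3', fun h g => ?_⟩
    rw [gamF_eq_cv hγ₁, ← hφ, hγ₂]

end IsES
end Comparison
end HopfGalois

/-- For a faithfully flat Hopf–Galois extension `B ⊆ P` with `P` a
◁-commutative right `H`-module algebra, `H²(L(P,H),B) ≅ H̃²(H,P)`: the equivalence classes of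
`Z²(L(P,H),B)` under `Γ ↦ Γ^U` (`U ∈ C¹(L(P,H),B)`) are in bijection with the equivalence
classes of `Z̃²(H,P)` under `γ ↦ γ^f` (`f ∈ C̃¹(H,P)`), compatibly with `γ ↦ Γ_γ`. -/
theorem H2_iso_Ht2
    {k : Type u} [Field k] {H P : Type v} [Ring H] [HopfAlgebra k H] [Ring P] [Algebra k P]
    (ca : ComodAlg k H P) (hGal : ca.IsGalois) (hFF : ca.IsFaithfullyFlat)
    {B0 L0 : Type v} [Ring B0] [Algebra k B0] [Ring L0] [Algebra k L0]
    (ιB : B0 →ₐ[k] P) (hιB : Function.Injective ιB)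
    (hιBrange : Set.range ιB = {p : P | ca.ρ p = p ⊗ₜ[k] (1 : H)})
    (ι : L0 →ₐ[k] (P ⊗[k] Pᵐᵒᵖ)) (hι : Function.Injective ι)
    (hιrange : Set.range ι = {z : P ⊗[k] Pᵐᵒᵖ | ca.betaA z = z ⊗ₜ[k] (1 : H)})
    (st : BgdST k B0 L0) (cop : L0 →ₗ[k] st.T2) (cou : L0 →ₗ[k] B0)
    (hbgd : st.IsLeftBialgebroid cop cou)
    (hs : ∀ b : B0, ι (st.s b) = (ιB b) ⊗ₜ[k] MulOpposite.op (1 : P))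
    (ht : ∀ b : B0, ι (st.t b) = (1 : P) ⊗ₜ[k] MulOpposite.op (ιB b))
    (hcou : ∀ z : L0, ιB (cou z) = ComodAlg.mulA (ι z))
    (hcop : ∀ (V : Type v) [AddCommGroup V] [Module k V]
      (G : (P ⊗[k] Pᵐᵒᵖ) →ₗ[k] (P ⊗[k] Pᵐᵒᵖ) →ₗ[k] V),
      (∀ (b : B0) (X Y : P ⊗[k] Pᵐᵒᵖ),
        G ((((1 : P) ⊗ₜ[k] MulOpposite.op (ιB b)) : P ⊗[k] Pᵐᵒᵖ) * X) Y =
          G X ((((ιB b) ⊗ₜ[k] MulOpposite.op (1 : P)) : P ⊗[k] Pᵐᵒᵖ) * Y)) →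
      ∀ z : L0, st.lift2 (fun x y => G (ι x) (ι y)) (cop z) =
        ca.esDeltaEval (fun x y => G x y) (ι z))
    (act : P →ₗ[k] H →ₗ[k] P)
    (hact_one : ∀ p : P, act p 1 = p)
    (hact_mulH : ∀ (p : P) (g h : H), act (act p g) h = act p (g * h))
    (hone_act : ∀ h : H, act 1 h = algebraMap k P (Coalgebra.counit (R := k) h))
    (hmul_act : ∀ (p q : P) (h : H), act (p * q) h =
      tlift k (fun h1 h2 => act p h1 * act q h2) (Coalgebra.comul (R := k) h))
    (hbraid : ∀ p q : P, p * q = tlift k (fun q0 q1 => q0 * act p q1) (ca.ρ q)) :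
    ∃ e : Quot (fun (γ1 γ2 : {γ : H → H → P // ComodAlg.IsZt2 ca act γ}) =>
        ∃ f fi : H →ₗ[k] P, ComodAlg.IsCt1 ca f ∧
          ComodAlg.convH f fi = ComodAlg.unitH ∧ ComodAlg.convH fi f = ComodAlg.unitH ∧
          ∀ h g : H, γ2.1 h g = ComodAlg.gamF act (⇑f) (⇑fi) γ1.1 h g) ≃
      Quot (fun (Γ1 Γ2 : {Γ : L0 → L0 → B0 // st.IsZ2 cop cou Γ}) =>
        ∃ U Ui : L0 →ₗ[k] B0, st.IsC1 cop cou U ∧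
          st.cconv cop U Ui = cou ∧ st.cconv cop Ui U = cou ∧
          ∀ X Y : L0, Γ2.1 X Y = st.gammaU cop Γ1.1 U Ui X Y),
      ∀ (γs : {γ : H → H → P // ComodAlg.IsZt2 ca act γ})
        (Γs : {Γ : L0 → L0 → B0 // st.IsZ2 cop cou Γ}),
        (∀ z w : L0, ιB (Γs.1 z w) = GammaOf ca ι γs.1 z w) →
        e (Quot.mk _ γs) = Quot.mk _ Γs := by
  have hbr : ∀ p, HopfGalois.ract ca.ρ LinearMap.id (act p) = LinearMap.mulLeft k p := by
    intro p
    ext q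
    refine Eq.trans ?_ (hbraid p q).symm
    exact (LinearMap.congr_fun (HopfGalois.tlift_eq
      (LinearMap.mul' k P ∘ₗ TensorProduct.map LinearMap.id (act p)) fun _ _ => rfl) (ca.ρ q)).symm
  have hrangeB : ∀ p, ca.ρ p = p ⊗ₜ[k] (1 : H) ↔ ∃ b, ιB b = p :=
    fun p => (Set.ext_iff.1 hιBrange p).symm
  have hcen : ∀ b p, p * ιB b = ιB b * p := by
    intro b p
    refine (LinearMap.congr_fun (hbr p) (ιB b)).symm.trans ?_
    have hb := (hrangeB (ιB b)).2 ⟨b, rfl⟩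
    simp [HopfGalois.ract, hb, hact_one]
  have E : HopfGalois.IsES ca ιB ι st cop cou :=
    ⟨hGal, hFF, hιB, hrangeB, hι, fun z => (Set.ext_iff.1 hιrange z).symm, hs, ht, hcou, hcop, hcen⟩
  have hΓγ : ∀ γs : {γ : H → H → P // ComodAlg.IsZt2 ca act γ},
      ∃ Γs : {Γ : L0 → L0 → B0 // st.IsZ2 cop cou Γ},
        ∀ z w, ιB (Γs.1 z w) = GammaOf ca ι γs.1 z w := by
    rintro ⟨γ, hγ⟩
    obtain ⟨γ', hγ'⟩ := hγ.1
    obtain ⟨φ, hφ⟩ := HopfGalois.exists_tmul_eq γ'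
    simp only [hγ'] at hφ
    have hco := (HopfGalois.isZt2_iff hGal hbr hφ).1 hγ
    obtain ⟨Γ, hΓ⟩ := E.exists_of_isCol_mulCo hco.col
    exact ⟨⟨fun X Y => Γ X Y, (E.isZ2_iff hΓ).2 hco⟩, fun z w =>
      (hΓ z w).trans (HopfGalois.gammaOf_eq_hatTwo hφ z w).symm⟩
  have hφγ : ∀ γs : {γ : H → H → P // ComodAlg.IsZt2 ca act γ},
      ∃ φ : H ⊗[k] H →ₗ[k] P, ∀ h g, φ (g ⊗ₜ h) = γs.1 h g := by
    rintro ⟨γ, ⟨γ', hγ'⟩, -⟩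
    obtain ⟨φ, hφ⟩ := HopfGalois.exists_tmul_eq γ'
    exact ⟨φ, fun h g => (hφ h g).trans (hγ' h g)⟩
  choose F hF using hΓγ
  choose φ hφ using hφγ
  have hrel := fun γs z w => (hF γs z w).trans (HopfGalois.gammaOf_eq_hatTwo (hφ γs) z w)
  have hbij : Function.Bijective F := by
    constructor
    · intro γ₁ γ₂ h
      have he : φ γ₁ = φ γ₂ := E.hatTwo_ract_inj fun X Y => by rw [← hrel, ← hrel, h]
      ext h g
      rw [← hφ, ← hφ, he]
    · rintro ⟨Γ, hΓ⟩
      obtain ⟨ψ, hψ⟩ := E.exists_hatTwo_ract_eq hΓ.1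
      refine ⟨⟨fun h g => ψ (g ⊗ₜ h), (HopfGalois.isZt2_iff hGal hbr fun _ _ => rfl).2
        ((E.isZ2_iff hψ).1 hΓ)⟩, ?_⟩
      ext X Y
      apply hιB
      rw [hF, HopfGalois.gammaOf_eq_hatTwo fun _ _ => rfl, ← hψ]
  refine ⟨Quot.congr (Equiv.ofBijective F hbij) fun γ₁ γ₂ =>
    E.gauge_iff hbr (hφ γ₁) (hφ γ₂) (hrel γ₁) (hrel γ₂), fun γs Γs h => ?_⟩
  have hFΓ : F γs = Γs := by
    ext X Y
    apply hιB
    rw [hF, h]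
  exact congrArg _ hFΓ
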